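/- Let d ≥ 2 and p₀ > p_c(d). There exists a constant κ_d > 0, depending only on the dimension d and on p₀, such that for all p ≤ q in [p₀, 1], sup_{x ∈ S^{d−1}} |μ_p(x) − μ_q(x)| ≤ κ_d (q − p) |log(q − p)|, where S^{d−1} is the unit sphere of ℝ^d for the Euclidean norm. -/

import Mathlib

open MeasureTheory Filter Topology
open scoped ENNReal

namespace Perco

/-- Vertices of the hypercubic lattice `ℤ^d`. -/
abbrev V (d : ℕ) := Fin d → ℤ

/-- The `ℓ¹` distance on `ℤ^d`. -/
def dist1 {d : ℕ} (x y : V d) : ℕ := ∑ i, (x i - y i).natAbs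

/-- The `ℓ¹` norm, as a real number. -/
def norm1 {d : ℕ} (x : V d) : ℝ := (dist1 x 0 : ℝ)

/-- The `ℓ¹` distance, descended to unordered pairs. -/
def sym2dist1 {d : ℕ} : Sym2 (V d) → ℕ :=
  Sym2.lift ⟨fun x y => dist1 x y, fun x y => by
    unfold dist1
    exact Finset.sum_congr rfl fun i _ => by rw [← Int.natAbs_neg, neg_sub]⟩

/-- Edges of the lattice `(ℤ^d, 𝔼^d)`: unordered pairs of nearest neighbours. -/
def Edge (d : ℕ) : Type := {e : Sym2 (V d) // sym2dist1 e = 1}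

/-- A bond percolation configuration: every edge is open (`true`) or closed (`false`). -/
abbrev Config (d : ℕ) := Edge d → Bool

/-- The unordered pair `e` is an open edge of the configuration `ω`. -/
def openE {d : ℕ} (ω : Config d) (e : Sym2 (V d)) : Prop :=
  ∃ h : sym2dist1 e = 1, ω ⟨e, h⟩ = true

/-- `⟨x, y⟩` is an open edge of the configuration `ω`. -/
def edgeOpen {d : ℕ} (ω : Config d) (x y : V d) : Prop := openE ω s(x, y)

/-- `f 0, f 1, …, f n` is an `ω`-open path (with `n` edges). -/
def IsOpenPath {d : ℕ} (ω : Config d) (n : ℕ) (f : ℕ → V d) : Prop :=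
  ∀ i < n, edgeOpen ω (f i) (f (i + 1))

/-- `f 0, …, f n` is a (not necessarily open) lattice path of `ℤ^d`. -/
def IsLatticePath {d : ℕ} (n : ℕ) (f : ℕ → V d) : Prop :=
  ∀ i < n, dist1 (f i) (f (i + 1)) = 1

/-- The chemical distance between `x` and `y` in the configuration `ω`:
the minimal number of edges of an `ω`-open path from `x` to `y` (`⊤` if there is none). -/
noncomputable def chemDist {d : ℕ} (ω : Config d) (x y : V d) : ℝ≥0∞ :=
  sInf {r : ℝ≥0∞ | ∃ (n : ℕ) (f : ℕ → V d),
    IsOpenPath ω n f ∧ f 0 = x ∧ f n = y ∧ r = (n : ℝ≥0∞)}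

/-- `x` and `y` are connected by an `ω`-open path. -/
def Connected {d : ℕ} (ω : Config d) (x y : V d) : Prop := chemDist ω x y ≠ ⊤

/-- The open cluster of the vertex `x`. -/
def cluster {d : ℕ} (ω : Config d) (x : V d) : Set (V d) := {y | Connected ω x y}

/-- `x` lies in an infinite open cluster. -/
def InInfiniteCluster {d : ℕ} (ω : Config d) (x : V d) : Prop := (cluster ω x).Infinite

open Classical in
/-- The regularized point `x̃`: a point of the infinite cluster minimizing the `ℓ¹`
distance to `x` (with a deterministic rule to break ties); `x` itself if there is none. -/
noncomputable def regPoint {d : ℕ} (ω : Config d) (x : V d) : V d :=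
  if h : ∃ y : V d, InInfiniteCluster ω y ∧
      ∀ z : V d, InInfiniteCluster ω z → dist1 x y ≤ dist1 x z
  then h.choose else x

/-- Real-valued chemical distance (in the configuration `ωdist`) between the
regularizations (w.r.t. the configuration `ωreg`) of `x` and `y`. -/
noncomputable def DReg {d : ℕ} (ωdist ωreg : Config d) (x y : V d) : ℝ :=
  (chemDist ωdist (regPoint ωreg x) (regPoint ωreg y)).toReal

open Classical in
/-- The number of elements of a set, as an element of `ℝ≥0∞` (`⊤` for infinite sets). -/
noncomputable def eSize {α : Type*} (A : Set α) : ℝ≥0∞ :=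
  if h : A.Finite then (h.toFinset.card : ℝ≥0∞) else ⊤

/-!  ### Boxes and renormalization  -/

/-- The box of "radius" `R` centered at `c`: `∏ₖ [c k - R, c k + R)`. -/
def boxC {d : ℕ} (c : V d) (R : ℕ) : Set (V d) :=
  {x | ∀ k, c k - (R : ℤ) ≤ x k ∧ x k < c k + (R : ℤ)}

/-- The center `i(2N+1)` of the `N`-box of macroscopic index `i`. -/
def center {d : ℕ} (N : ℕ) (i : V d) : V d := fun k => i k * (2 * (N : ℤ) + 1)

/-- The `N`-box `B_N(i) = i(2N+1) + [-N, N)^d`. -/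
def macroBox {d : ℕ} (N : ℕ) (i : V d) : Set (V d) := boxC (center N i) N

/-- The enlarged box `B'_N(i) = i(2N+1) + [-3N, 3N)^d`. -/
def macroBox' {d : ℕ} (N : ℕ) (i : V d) : Set (V d) := boxC (center N i) (3 * N)

/-- An open path all of whose vertices stay in the set `S`. -/
def IsOpenPathIn {d : ℕ} (ω : Config d) (S : Set (V d)) (n : ℕ) (f : ℕ → V d) : Prop :=
  IsOpenPath ω n f ∧ ∀ i ≤ n, f i ∈ S

/-- `x` and `y` are connected by an open path inside `S`. -/
def ConnectedIn {d : ℕ} (ω : Config d) (S : Set (V d)) (x y : V d) : Prop :=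
  ∃ (n : ℕ) (f : ℕ → V d), IsOpenPathIn ω S n f ∧ f 0 = x ∧ f n = y

/-- The open cluster of `x` inside the set `S`. -/
def clusterIn {d : ℕ} (ω : Config d) (S : Set (V d)) (x : V d) : Set (V d) :=
  {y | ConnectedIn ω S x y}

/-- `C` is an open cluster of the region `S`. -/
def IsClusterIn {d : ℕ} (ω : Config d) (S : Set (V d)) (C : Set (V d)) : Prop :=
  ∃ x ∈ S, C = clusterIn ω S x

/-- The cluster `C` has diameter at least `m`. -/
def diamGE {d : ℕ} (C : Set (V d)) (m : ℕ) : Prop :=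
  ∃ x ∈ C, ∃ y ∈ C, ∃ k, (m : ℤ) ≤ |x k - y k|

/-- The cluster `C` is crossing for the box `boxC c R`: for each of the `d` directions,
`C ∩ boxC c R` contains an open path connecting the two opposite faces of the box. -/
def CrossingFor {d : ℕ} (ω : Config d) (C : Set (V d)) (c : V d) (R : ℕ) : Prop :=
  ∀ k : Fin d, ∃ (n : ℕ) (f : ℕ → V d), IsOpenPath ω n f ∧
    (∀ m ≤ n, f m ∈ C ∩ boxC c R) ∧ f 0 k = c k - (R : ℤ) ∧ f n k = c k + (R : ℤ) - 1

/-- The `N`-box `B_N(i)` is good (for the configuration `ω`, with parameter `β`):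
(i) there is a unique open cluster `C` of `B'_N(i)` of diameter at least `N`;
(ii) `C` is crossing for each of the `3^d` `N`-boxes included in `B'_N(i)`;
(iii) any two points of `C ∩ B'_N(i)` are at chemical distance at most `12βN`. -/
def IsGoodBox {d : ℕ} (ω : Config d) (N : ℕ) (β : ℝ) (i : V d) : Prop :=
  ∃ C : Set (V d),
    IsClusterIn ω (macroBox' N i) C ∧ diamGE C N ∧
    (∀ C', IsClusterIn ω (macroBox' N i) C' → diamGE C' N → C' = C) ∧
    (∀ j : V d, (∀ k, |j k - i k| ≤ 1) → CrossingFor ω C (center N j) N) ∧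
    (∀ x ∈ macroBox' N i, ∀ y ∈ macroBox' N i, x ∈ C → y ∈ C →
      chemDist ω x y ≤ ENNReal.ofReal (12 * β * N))

/-- `x` belongs to the crossing cluster of the good box `B_N(j)`, i.e. to a cluster of
`B'_N(j)` of diameter at least `N`. -/
def InCrossingCluster {d : ℕ} (ω : Config d) (N : ℕ) (j : V d) (x : V d) : Prop :=
  ∃ C : Set (V d), IsClusterIn ω (macroBox' N j) C ∧ diamGE C N ∧ x ∈ C

/-!  ### Macroscopic site percolation -/

/-- A nearest-neighbour path of macroscopic sites staying in `S`. -/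
def IsSitePathIn {d : ℕ} (S : Set (V d)) (n : ℕ) (f : ℕ → V d) : Prop :=
  (∀ m ≤ n, f m ∈ S) ∧ ∀ m < n, dist1 (f m) (f (m + 1)) = 1

/-- The sites `i` and `j` are connected by a nearest-neighbour path inside `S`. -/
def SiteConnectedIn {d : ℕ} (S : Set (V d)) (i j : V d) : Prop :=
  ∃ (n : ℕ) (f : ℕ → V d), IsSitePathIn S n f ∧ f 0 = i ∧ f n = j

/-- A `*`-path of macroscopic sites staying in `S` (consecutive sites are `*`-neighbours:
their `ℓ^∞` distance is `1`). -/
def IsStarPathIn {d : ℕ} (S : Set (V d)) (n : ℕ) (f : ℕ → V d) : Prop :=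
  (∀ m ≤ n, f m ∈ S) ∧ ∀ m < n, f m ≠ f (m + 1) ∧ ∀ k, |f (m + 1) k - f m k| ≤ 1

/-- The set of good macroscopic sites. -/
def goodSites {d : ℕ} (ω : Config d) (N : ℕ) (β : ℝ) : Set (V d) :=
  {i | IsGoodBox ω N β i}

/-- The macroscopic site `i` belongs to an infinite cluster of good boxes. -/
def InInfiniteGoodCluster {d : ℕ} (ω : Config d) (N : ℕ) (β : ℝ) (i : V d) : Prop :=
  IsGoodBox ω N β i ∧ {j | SiteConnectedIn (goodSites ω N β) i j}.Infinite

/-- The union of the bad connected components (of the macroscopic site percolation)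
meeting the set `Γ`; its size is `Σ_{C ∈ Bad, C ∩ Γ ≠ ∅} |C|`. -/
def badTouching {d : ℕ} (ω : Config d) (N : ℕ) (β : ℝ) (Γ : Set (V d)) : Set (V d) :=
  {j | ∃ i ∈ Γ, i ∉ goodSites ω N β ∧ SiteConnectedIn {k | k ∉ goodSites ω N β} i j}

/-!  ### Edges and sites of a path -/

/-- The set of edges of the path `f 0, …, f n`. -/
def pathEdges {d : ℕ} (n : ℕ) (f : ℕ → V d) : Set (Sym2 (V d)) :=
  {e | ∃ i < n, e = s(f i, f (i + 1))}

/-- The set of vertices of the path `f 0, …, f n`. -/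
def pathVerts {d : ℕ} (n : ℕ) (f : ℕ → V d) : Set (V d) :=
  {v | ∃ i ≤ n, f i = v}

/-- The set of `ω`-closed edges of the path `f 0, …, f n`. -/
def closedEdges {d : ℕ} (ω : Config d) (n : ℕ) (f : ℕ → V d) : Set (Sym2 (V d)) :=
  {e | e ∈ pathEdges n f ∧ ¬ openE ω e}

/-- The set `Γ` of macroscopic sites whose `N`-box is visited by the path `f 0, …, f n`. -/
def visitedSites {d : ℕ} (N : ℕ) (n : ℕ) (f : ℕ → V d) : Set (V d) :=
  {i | ∃ m ≤ n, f m ∈ macroBox N i}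

/-!  ### Probability: i.i.d. Bernoulli bond percolation -/

/-- A family of i.i.d. Bernoulli bond percolation measures on the configurations:
`P p` is a probability measure under which the states of the edges are independent
Bernoulli variables of parameter `p`. -/
structure BernoulliFamily (d : ℕ) where
  P : ℝ → Measure (Config d)
  prob : ∀ p, IsProbabilityMeasure (P p)
  iid : ∀ p, 0 ≤ p → p ≤ 1 → ∀ (s : Finset (Edge d)) (f : Edge d → Bool),
    P p {ω : Config d | ∀ e ∈ s, ω e = f e}
      = ∏ e ∈ s, ENNReal.ofReal (if f e then p else 1 - p)

/-- The critical parameter `p_c(d)` of the family. -/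
noncomputable def pc {d : ℕ} (F : BernoulliFamily d) : ℝ :=
  sInf {p : ℝ | 0 ≤ p ∧ p ≤ 1 ∧ 0 < F.P p {ω : Config d | InInfiniteCluster ω 0}}

/-- `t` is the time constant of the percolation measure `P`: for every `x ∈ ℤ^d`,
`D^{𝒞}(0̃, ñx)/n → t x` almost surely. -/
def ASTimeConstant {d : ℕ} (P : Measure (Config d)) (t : V d → ℝ) : Prop :=
  ∀ x : V d, ∀ᵐ ω ∂P, Tendsto (fun n : ℕ => DReg ω ω 0 (n • x) / n) atTop (𝓝 (t x))

/-!  ### Couplings -/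

/-- Two-stage coupling configurations: each edge carries a pair `(V, Z)` of Booleans. -/
abbrev CConfig (d : ℕ) := Edge d → Bool × Bool

/-- The `q`-configuration of a coupled configuration: `e` is `q`-open iff `V e = 1`. -/
def cfgQ {d : ℕ} (u : CConfig d) : Config d := fun e => (u e).1

/-- The `p`-configuration of a coupled configuration: `e` is `p`-open iff `V e Z e = 1`. -/
def cfgP {d : ℕ} (u : CConfig d) : Config d := fun e => (u e).1 && (u e).2

/-- Two-stage coupling of the `p`- and `q`-percolations: on each edge, independently,
`V` is Bernoulli of parameter `q` and `Z` is an independent Bernoulli of parameter `p/q`. -/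
structure CouplingMeasure (d : ℕ) (p q : ℝ) where
  Q : Measure (CConfig d)
  prob : IsProbabilityMeasure Q
  iid : ∀ (s : Finset (Edge d)) (f : Edge d → Bool × Bool),
    Q {u : CConfig d | ∀ e ∈ s, u e = f e}
      = ∏ e ∈ s,
          (ENNReal.ofReal (if (f e).1 then q else 1 - q) *
            ENNReal.ofReal (if (f e).2 then p / q else 1 - p / q))

/-- Standard coupling: i.i.d. uniform variables on `[0,1]`, one for each edge. -/
structure UniformCoupling (d : ℕ) where
  Q : Measure (Edge d → ℝ)
  prob : IsProbabilityMeasure Q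
  iid : ∀ (s : Finset (Edge d)) (a : Edge d → ℝ), (∀ e ∈ s, 0 ≤ a e ∧ a e ≤ 1) →
    Q {u | ∀ e ∈ s, u e ≤ a e} = ∏ e ∈ s, ENNReal.ofReal (a e)

open Classical in
/-- The `p`-configuration of the standard coupling: `e` is `p`-open iff `U e ≤ p`. -/
noncomputable def cfgAt {d : ℕ} (u : Edge d → ℝ) (p : ℝ) : Config d :=
  fun e => if u e ≤ p then true else false

/-- The critical parameter `p_c(d)` read on the standard coupling. -/
noncomputable def pcU {d : ℕ} (U : UniformCoupling d) : ℝ :=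
  sInf {p : ℝ | 0 ≤ p ∧ p ≤ 1 ∧ 0 < U.Q {u | InInfiniteCluster (cfgAt u p) 0}}

open Classical in
/-- A deterministically chosen geodesic (open path of minimal length) from `x` to `y`
in the configuration `ω` (a trivial constant path if there is none). -/
noncomputable def geod {d : ℕ} (ω : Config d) (x y : V d) : ℕ × (ℕ → V d) :=
  if h : ∃ nf : ℕ × (ℕ → V d), IsOpenPath ω nf.1 nf.2 ∧ nf.2 0 = x ∧ nf.2 nf.1 = y ∧
      (nf.1 : ℝ≥0∞) = chemDist ω x y
  then h.choose else (0, fun _ => x)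

/-!  ### Norms on `ℝ^d` -/

/-- `f` is a norm on the Euclidean space `ℝ^d`. -/
def IsNorm {d : ℕ} (f : EuclideanSpace ℝ (Fin d) → ℝ) : Prop :=
  (∀ x, 0 ≤ f x) ∧ (∀ x, f x = 0 ↔ x = 0) ∧
  (∀ (c : ℝ) (x), f (c • x) = |c| * f x) ∧ ∀ x y, f (x + y) ≤ f x + f y

/-- The canonical embedding of `ℤ^d` into the Euclidean space `ℝ^d`. -/
noncomputable def toEuc {d : ℕ} (x : V d) : EuclideanSpace ℝ (Fin d) :=
  (WithLp.equiv 2 (Fin d → ℝ)).symm fun i => (x i : ℝ)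

/-- Property (1) of the path-modification lemma: the edges of `γ' \ γ` decompose as a
disjoint union of self-avoiding `p`-open paths intersecting `γ' ∩ γ` at their endpoints. -/
def DisjointPathDecomposition {d : ℕ} (ωp : Config d) (n : ℕ) (f : ℕ → V d)
    (n' : ℕ) (g : ℕ → V d) : Prop :=
  ∃ (K : ℕ) (m : ℕ → ℕ) (h : ℕ → ℕ → V d),
    (⋃ j ∈ Finset.range K, pathEdges (m j) (h j)) = pathEdges n' g \ pathEdges n f ∧
    (∀ j < K, IsOpenPath ωp (m j) (h j)) ∧
    (∀ j < K, ∀ a ≤ m j, ∀ b ≤ m j, h j a = h j b → a = b) ∧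
    (∀ j < K, ∀ l < K, j ≠ l → Disjoint (pathEdges (m j) (h j)) (pathEdges (m l) (h l))) ∧
    (∀ j < K, h j 0 ∈ pathVerts n f ∧ h j (m j) ∈ pathVerts n f) ∧
    (∀ j < K, ∀ a, 0 < a → a < m j → h j a ∉ pathVerts n f)

/-- The conclusion of the path-modification lemma, for the constant `ρ`:
any `q`-open path between well-connected points of `𝒞_p` can be turned into a `p`-open
path, the total length of the bypasses being controlled by the bad clusters met and the
number of `p`-closed edges. -/
def BypassProperty (d : ℕ) (ρ : ℕ) : Prop :=
  ∀ (N : ℕ), 1 ≤ N → ∀ (β : ℝ), 1 ≤ β → ∀ (ωp ωq : Config d),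
    (∀ e, ωp e = true → ωq e = true) →
    ∀ y z : V d, InInfiniteCluster ωp y → InInfiniteCluster ωp z →
    (∃ i, y ∈ macroBox N i ∧ InInfiniteGoodCluster ωp N β i) →
    (∃ i, z ∈ macroBox N i ∧ InInfiniteGoodCluster ωp N β i) →
    ∀ (n : ℕ) (f : ℕ → V d), IsOpenPath ωq n f → f 0 = y → f n = z →
    ∃ (n' : ℕ) (g : ℕ → V d), IsOpenPath ωp n' g ∧ g 0 = y ∧ g n' = z ∧
      DisjointPathDecomposition ωp n f n' g ∧
      eSize (pathEdges n' g \ pathEdges n f) ≤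
        ((ρ * N : ℕ) : ℝ≥0∞) *
          (eSize (badTouching ωp N β (visitedSites N n f)) + eSize (closedEdges ωp n f))


section Part1

/-! ### Generic linking inside a set -/

/-- `x` and `y` are linked by a chain of `r`-related points inside `S`. -/
def LinkR {α : Type*} (r : α → α → Prop) (S : Set α) (x y : α) : Prop :=
  x ∈ S ∧ Relation.ReflTransGen (fun a b => r a b ∧ a ∈ S ∧ b ∈ S) x y

section LinkR
variable {α : Type*} {r : α → α → Prop} {S T : Set α} {x y z : α}

lemma LinkR.refl (h : x ∈ S) : LinkR r S x x := ⟨h, Relation.ReflTransGen.refl⟩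

lemma LinkR.left (h : LinkR r S x y) : x ∈ S := h.1

lemma LinkR.right (h : LinkR r S x y) : y ∈ S := by
  obtain ⟨h1, h2⟩ := h
  cases h2 with
  | refl => exact h1
  | tail _ h => exact h.2.2

lemma LinkR.trans (h : LinkR r S x y) (h' : LinkR r S y z) : LinkR r S x z :=
  ⟨h.1, h.2.trans h'.2⟩

lemma LinkR.tail (h : LinkR r S x y) (h' : r y z) (hz : z ∈ S) : LinkR r S x z :=
  ⟨h.1, h.2.tail ⟨h', h.right, hz⟩⟩

lemma LinkR.single (h' : r x y) (hx : x ∈ S) (hy : y ∈ S) : LinkR r S x y :=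
  (LinkR.refl hx).tail h' hy

lemma LinkR.symm (hr : ∀ a b, r a b → r b a) (h : LinkR r S x y) : LinkR r S y x := by
  refine ⟨h.right, ?_⟩
  have := h.2
  induction this with
  | refl => exact Relation.ReflTransGen.refl
  | tail h1 h2 ih => exact Relation.ReflTransGen.head ⟨hr _ _ h2.1, h2.2.2, h2.2.1⟩ (ih ⟨h.1, h1⟩)

lemma LinkR.induct {P : α → Prop} (h : LinkR r S x y) (h0 : P x)
    (hs : ∀ a b, LinkR r S x a → P a → r a b → b ∈ S → P b) : P y := by
  obtain ⟨h1, h2⟩ := h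
  induction h2 with
  | refl => exact h0
  | tail h3 h4 ih => exact hs _ _ ⟨h1, h3⟩ ih h4.1 h4.2.2

lemma LinkR.mono (hST : S ⊆ T) (h : LinkR r S x y) : LinkR r T x y :=
  h.induct (P := fun y => LinkR r T x y) (LinkR.refl (hST h.1))
    (fun _ _ _ ih hab hb => ih.tail hab (hST hb))

lemma LinkR.monoR {r' : α → α → Prop} (hrr : ∀ a ∈ S, ∀ b ∈ S, r a b → r' a b)
    (h : LinkR r S x y) : LinkR r' S x y :=
  h.induct (P := fun y => LinkR r' S x y) (LinkR.refl h.1)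
    (fun _ _ ha ih hab hb => ih.tail (hrr _ ha.right _ hb hab) hb)

/-- a link stays in any set which is closed under steps -/
lemma LinkR.restrict (h : LinkR r S x y) :
    LinkR r {z | LinkR r S x z} x y :=
  h.induct (P := fun y => LinkR r {z | LinkR r S x z} x y) (LinkR.refl (LinkR.refl h.1))
    (fun _ _ ha ih hab hb => ih.tail hab (ha.tail hab hb))

lemma LinkR.map {β : Type*} {r' : β → β → Prop} {T : Set β} (g : α → β)
    (hg : ∀ a ∈ S, g a ∈ T) (hrr : ∀ a b, r a b → r' (g a) (g b))
    (h : LinkR r S x y) : LinkR r' T (g x) (g y) :=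
  h.induct (P := fun y => LinkR r' T (g x) (g y)) (LinkR.refl (hg _ h.1))
    (fun _ _ _ ih hab hb => ih.tail (hrr _ _ hab) (hg _ hb))

/-- first exit from a set -/
lemma LinkR.exit (h : LinkR r S x y) {A : Set α} (hx : x ∈ A) (hy : y ∉ A) :
    ∃ a b, LinkR r (S ∩ A) x a ∧ r a b ∧ b ∈ S ∧ b ∉ A := by
  have key : LinkR r (S ∩ A) x y ∨ ∃ a b, LinkR r (S ∩ A) x a ∧ r a b ∧ b ∈ S ∧ b ∉ A := by
    refine h.induct (P := fun y => LinkR r (S ∩ A) x y ∨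
      ∃ a b, LinkR r (S ∩ A) x a ∧ r a b ∧ b ∈ S ∧ b ∉ A) (Or.inl (LinkR.refl ⟨h.1, hx⟩)) ?_
    rintro a b _ (ih | ih) hab hb
    · by_cases hbA : b ∈ A
      · exact Or.inl (ih.tail hab ⟨hb, hbA⟩)
      · exact Or.inr ⟨a, b, ih, hab, hb, hbA⟩
    · exact Or.inr ih
  rcases key with h | h
  · exact absurd h.right.2 hy
  · exact h

lemma LinkR.of_path (n : ℕ) (f : ℕ → α) (hf : ∀ i < n, r (f i) (f (i + 1)))
    (hS : ∀ i ≤ n, f i ∈ S) : LinkR r S (f 0) (f n) := by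
  induction n with
  | zero => exact LinkR.refl (hS 0 le_rfl)
  | succ n ih =>
    exact (ih (fun i hi => hf i (by omega)) (fun i hi => hS i (by omega))).tail
      (hf n (by omega)) (hS _ le_rfl)

lemma LinkR.of_subpath (f : ℕ → α) (a b : ℕ) (hab : a ≤ b)
    (hf : ∀ i, a ≤ i → i < b → r (f i) (f (i + 1)))
    (hS : ∀ i, a ≤ i → i ≤ b → f i ∈ S) : LinkR r S (f a) (f b) := by
  have := LinkR.of_path (r := r) (S := S) (b - a) (fun i => f (a + i))
    (fun i hi => hf (a + i) (by omega) (by omega)) (fun i hi => hS _ (by omega) (by omega))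
  simpa [Nat.add_sub_cancel' hab] using this

lemma LinkR.path (h : LinkR r S x y) : ∃ (n : ℕ) (f : ℕ → α),
    (∀ i < n, r (f i) (f (i + 1))) ∧ (∀ i ≤ n, f i ∈ S) ∧ f 0 = x ∧ f n = y := by
  refine h.induct (P := fun y => ∃ (n : ℕ) (f : ℕ → α),
    (∀ i < n, r (f i) (f (i + 1))) ∧ (∀ i ≤ n, f i ∈ S) ∧ f 0 = x ∧ f n = y) ?_ ?_
  · exact ⟨0, fun _ => x, by simp, fun _ _ => h.1, rfl, rfl⟩
  · rintro a b _ ⟨n, f, h1, h2, h3, h4⟩ hab hb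
    refine ⟨n + 1, fun i => if i ≤ n then f i else b, ?_, ?_, ?_, ?_⟩
    · intro i hi
      rcases Nat.lt_succ_iff_lt_or_eq.1 hi with hi | rfl
      · have : i ≤ n := by omega
        have h' : i + 1 ≤ n := by omega
        simpa [this, h'] using h1 i hi
      · simpa [h4] using hab
    · intro i _
      by_cases hi' : i ≤ n
      · simpa [hi'] using h2 i hi'
      · simpa [hi'] using hb
    · simp [h3]
    · simp

/-- short path in a finite set -/
lemma LinkR.short_path {S : Finset α} (h : LinkR r (S : Set α) x y) : ∃ (n : ℕ) (f : ℕ → α),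
    n + 1 ≤ S.card ∧ (∀ i < n, r (f i) (f (i + 1))) ∧ (∀ i ≤ n, f i ∈ S) ∧ f 0 = x ∧ f n = y := by
  classical
  have hex : ∃ n, ∃ f : ℕ → α, (∀ i < n, r (f i) (f (i + 1))) ∧ (∀ i ≤ n, f i ∈ S) ∧
      f 0 = x ∧ f n = y := h.path
  obtain ⟨f, h1, h2, h3, h4⟩ := Nat.find_spec hex
  set n := Nat.find hex with hn
  have hinj : ∀ i j, i < j → j ≤ n → f i ≠ f j := by
    intro i j hij hj heq
    refine Nat.find_min hex (m := n - (j - i)) (by omega)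
      ⟨fun k => if k ≤ i then f k else f (k + (j - i)), ?_, ?_, ?_, ?_⟩
    · intro k hk
      by_cases h' : k + 1 ≤ i
      · have : k ≤ i := by omega
        simpa [this, h'] using h1 k (by omega)
      · by_cases h'' : k ≤ i
        · have hki : k = i := by omega
          subst hki
          have := h1 j (by omega)
          simp only [le_refl, if_true, Nat.not_succ_le_self, if_false, heq]
          rw [show k + 1 + (j - k) = j + 1 by omega]
          exact this
        · have := h1 (k + (j - i)) (by omega)
          simp only [h', h'', if_false]
          rw [show k + 1 + (j - i) = k + (j - i) + 1 by omega]
          exact this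
    · intro k hk
      by_cases h'' : k ≤ i
      · simpa [h''] using h2 k (by omega)
      · simpa [h''] using h2 (k + (j - i)) (by omega)
    · simp [h3]
    · by_cases h'' : n - (j - i) ≤ i
      · have : n = j := by omega
        have h5 : n - (j - i) = i := by omega
        simp only [h5, le_refl, if_true, heq]
        rw [← this]; exact h4
      · simp only [h'', if_false]
        rw [show n - (j - i) + (j - i) = n by omega]; exact h4
  refine ⟨n, f, ?_, h1, h2, h3, h4⟩
  have : (Finset.image f (Finset.range (n + 1))).card = n + 1 := by
    rw [Finset.card_image_of_injOn, Finset.card_range]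
    intro i hi j hj hij
    simp only [Finset.coe_range, Set.mem_Iio] at hi hj
    rcases lt_trichotomy i j with h | h | h
    · exact absurd hij (hinj i j h (by omega))
    · exact h
    · exact absurd hij.symm (hinj j i h (by omega))
  rw [← this]
  apply Finset.card_le_card
  intro z hz
  simp only [Finset.mem_image, Finset.mem_range] at hz
  obtain ⟨i, hi, rfl⟩ := hz
  exact h2 i (by omega)

end LinkR

/-! ### Star adjacency on the lattice -/

section Star
variable {d : ℕ}

/-- (reflexive) `*`-adjacency -/
def nb (x y : V d) : Prop := ∀ k, |x k - y k| ≤ 1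

lemma nb.symm {x y : V d} (h : nb x y) : nb y x := fun k => by rw [abs_sub_comm]; exact h k

lemma nb_symm (x y : V d) (h : nb x y) : nb y x := h.symm

lemma nb_refl (x : V d) : nb x x := fun k => by simp

/-- `*`-connected set -/
def SConn (A : Set (V d)) : Prop := ∀ x ∈ A, ∀ y ∈ A, LinkR nb A x y

/-- sup-norm ball -/
def bx (c : V d) (n : ℕ) : Set (V d) := {x | ∀ k, |x k - c k| ≤ (n : ℤ)}

/-- the star-component of `j` in the complement of `A` -/
def cpt (A : Set (V d)) (j : V d) : Set (V d) := {y | LinkR nb Aᶜ j y}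

/-- boundary of the component -/
def bdy (A : Set (V d)) (j : V d) : Set (V d) := {s | s ∈ cpt A j ∧ ∃ a ∈ A, nb a s}

lemma sconn_cpt (A : Set (V d)) (j : V d) : SConn (cpt A j) := by
  intro x hx y hy
  have h1 := (LinkR.restrict hx).symm nb_symm
  have h2 := LinkR.restrict hy
  exact h1.trans h2

lemma sconn_comp (X : Set (V d)) (j : V d) : SConn {y | LinkR nb X j y} := by
  intro x hx y hy
  exact ((LinkR.restrict hx).symm nb_symm).trans (LinkR.restrict hy)

lemma cross_bdy {A X : Set (V d)} {j g a : V d} (h : LinkR nb X g a) (hg : g ∈ cpt A j)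
    (ha : a ∈ A) : ∃ s ∈ bdy A j, s ∈ X := by
  obtain ⟨u, v, h1, h2, h3, h4⟩ := h.exit (A := cpt A j) hg
    (fun h => h.right ha)
  refine ⟨u, ⟨h1.right.2, v, ?_, h2.symm⟩, h1.right.1⟩
  by_contra hv
  exact h4 (LinkR.tail h1.right.2 h2 hv)

/-! discrete Poincare lemma -/

/-- radial contraction -/
def rho (x : V d) : V d := fun k => x k - (x k).sign

/-- primitive of a closed one-form -/
def psiN (φ : V d → V d → Bool) : ℕ → V d → Bool
  | 0, _ => false
  | n + 1, x => xor (φ x (rho x)) (psiN φ n (rho x))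

lemma nb_rho (x : V d) : nb x (rho x) := by
  intro k
  simp only [rho]
  rcases lt_trichotomy (x k) 0 with h | h | h
  · rw [Int.sign_eq_neg_one_of_neg h]; simp
  · simp [h]
  · rw [Int.sign_eq_one_of_pos h]; simp

lemma abs_rho (x : V d) (n : ℕ) (h : ∀ k, |x k| ≤ (n + 1 : ℕ)) (k : Fin d) : |rho x k| ≤ n := by
  have := h k
  simp only [rho]
  push_cast at this
  rw [abs_le] at *
  rcases lt_trichotomy (x k) 0 with h | h | h
  · rw [Int.sign_eq_neg_one_of_neg h]; omega
  · simp [h]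
  · rw [Int.sign_eq_one_of_pos h]; omega

lemma sign_cases (a : ℤ) : (a < 0 ∧ a.sign = -1) ∨ (a = 0 ∧ a.sign = 0) ∨ (0 < a ∧ a.sign = 1) := by
  rcases lt_trichotomy a 0 with h | h | h
  · exact Or.inl ⟨h, Int.sign_eq_neg_one_of_neg h⟩
  · exact Or.inr (Or.inl ⟨h, by simp [h]⟩)
  · exact Or.inr (Or.inr ⟨h, Int.sign_eq_one_of_pos h⟩)

lemma cone (x y : V d) (h : nb x y) : ∃ w : V d, nb x w ∧ nb y w ∧ nb (rho x) w ∧ nb (rho y) w ∧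
    nb (rho x) (rho y) := by
  refine ⟨fun k => if (x k).natAbs ≤ (y k).natAbs then x k else y k, ?_, ?_, ?_, ?_, ?_⟩ <;>
  · intro k
    have h1 := h k
    have h2 := sign_cases (x k)
    have h3 := sign_cases (y k)
    simp only [rho]
    rw [abs_le] at *
    (try split_ifs) <;> omega

lemma psiN_spec (φ : V d → V d → Bool) (h0 : ∀ x, φ x x = false)
    (ht : ∀ x y z, nb x y → nb y z → nb x z → xor (φ x y) (xor (φ y z) (φ x z)) = false) (n : ℕ) :
    ∀ x y, nb x y → (∀ k, |x k| ≤ n) → (∀ k, |y k| ≤ n) →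
      xor (psiN φ n x) (psiN φ n y) = φ x y := by
  induction n with
  | zero =>
    intro x y _ hx hy
    have : x = y := by
      funext k
      have h1 := hx k
      have h2 := hy k
      simp only [Nat.cast_zero, abs_nonpos_iff] at h1 h2
      rw [h1, h2]
    subst this
    simp [psiN, h0]
  | succ n ih =>
    intro x y hxy hx hy
    obtain ⟨w, h1, h2, h3, h4, h5⟩ := cone x y hxy
    have e := ih _ _ h5 (abs_rho x n hx) (abs_rho y n hy)
    have t1 := ht x y w hxy h2 h1
    have t2 := ht x (rho x) w (nb_rho x) h3 h1
    have t3 := ht y (rho y) w (nb_rho y) h4 h2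
    have t4 := ht _ _ w h5 h4 h3
    simp only [psiN]
    revert e t1 t2 t3 t4
    generalize φ x y = a1
    generalize φ x w = a2
    generalize φ y w = a3
    generalize φ x (rho x) = a4
    generalize φ y (rho y) = a5
    generalize φ (rho x) w = a6
    generalize φ (rho y) w = a7
    generalize φ (rho x) (rho y) = a8
    generalize psiN φ n (rho x) = a9
    generalize psiN φ n (rho y) = a10
    revert a1 a2 a3 a4 a5 a6 a7 a8 a9 a10
    decide

lemma psiN_stable (φ : V d → V d → Bool) (h0 : ∀ x, φ x x = false) (n : ℕ) :
    ∀ x : V d, (∀ k, |x k| ≤ n) → psiN φ (n + 1) x = psiN φ n x := by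
  induction n with
  | zero =>
    intro x hx
    have : rho x = x := by
      funext k
      have h1 := hx k
      simp only [Nat.cast_zero, abs_nonpos_iff] at h1
      simp [rho, h1]
    simp [psiN, this, h0]
  | succ n ih =>
    intro x hx
    rw [psiN, ih _ (abs_rho x n hx), ← psiN]

lemma poincare (φ : V d → V d → Bool) (h0 : ∀ x, φ x x = false)
    (ht : ∀ x y z, nb x y → nb y z → nb x z → xor (φ x y) (xor (φ y z) (φ x z)) = false) :
    ∃ ψ : V d → Bool, ∀ x y, nb x y → xor (ψ x) (ψ y) = φ x y := by
  have hst : ∀ (n : ℕ) (x : V d), (∀ k, |x k| ≤ n) → ∀ m, n ≤ m → psiN φ m x = psiN φ n x := by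
    intro n x hx m hm
    induction m, hm using Nat.le_induction with
    | base => rfl
    | succ m hm ih =>
      rw [psiN_stable φ h0 m x (fun k => (hx k).trans (by exact_mod_cast hm)), ih]
  let N : V d → ℕ := fun x => ∑ k, (x k).natAbs
  have hN : ∀ x k, |x k| ≤ N x := by
    intro x k
    rw [Int.abs_eq_natAbs]
    exact_mod_cast Finset.single_le_sum (f := fun k => (x k).natAbs) (fun _ _ => Nat.zero_le _)
      (Finset.mem_univ k)
  refine ⟨fun x => psiN φ (N x) x, fun x y hxy => ?_⟩
  change xor (psiN φ (N x) x) (psiN φ (N y) y) = φ x y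
  rw [← hst (N x) x (hN x) (max (N x) (N y)) (le_max_left _ _),
    ← hst (N y) y (hN y) (max (N x) (N y)) (le_max_right _ _)]
  exact psiN_spec φ h0 ht _ x y hxy
    (fun k => (hN x k).trans (by exact_mod_cast le_max_left _ _))
    (fun k => (hN y k).trans (by exact_mod_cast le_max_right _ _))

/-- The topological kernel: the boundary of a component of the complement of a connected set is
connected. -/
theorem sconn_bdy {A : Set (V d)} (hA : SConn A) (j : V d) : SConn (bdy A j) := by
  classical
  intro s hs t ht
  by_contra hst
  let S1 : Set (V d) := {t | LinkR nb (bdy A j) s t}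
  have hS1 : S1 ⊆ bdy A j := fun t ht => LinkR.right ht
  have hAS : ∀ x ∈ A, x ∉ cpt A j := fun x hx h => LinkR.right h hx
  let φ : V d → V d → Bool := fun x y => decide ((x ∈ A ∧ y ∈ S1) ∨ (y ∈ A ∧ x ∈ S1))
  obtain ⟨ψ, hψ⟩ := poincare φ
    (fun x => by
      simp only [φ, or_self, decide_eq_false_iff_not, not_and]
      exact fun h h' => hAS x h (hS1 h').1)
    (by
      intro x y z hxy hyz hxz
      have e1 : ∀ x, x ∈ A → x ∉ S1 := fun x h h' => hAS x h (hS1 h').1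
      have e2 : ∀ a b c, a ∈ A → b ∈ S1 → nb a c → nb b c → c ∈ A ∨ c ∈ S1 := by
        intro a b c ha hb hac hbc
        by_contra hc
        push Not at hc
        apply hc.2
        exact LinkR.tail hb hbc ⟨LinkR.tail (hS1 hb).1 hbc hc.1, a, ha, hac⟩
      have f1 := e2 x y z
      have f2 := e2 y x z
      have f3 := e2 x z y
      have f4 := e2 z x y
      have f5 := e2 y z x
      have f6 := e2 z y x
      have g1 := e1 x
      have g2 := e1 y
      have g3 := e1 z
      simp only [hxy, hyz, hxz, hxy.symm, hyz.symm, hxz.symm, true_imp_iff] at f1 f2 f3 f4 f5 f6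
      simp only [φ]
      by_cases a1 : x ∈ A <;> by_cases a2 : y ∈ A <;> by_cases a3 : z ∈ A <;>
      by_cases b1 : x ∈ S1 <;> by_cases b2 : y ∈ S1 <;> by_cases b3 : z ∈ S1 <;>
      simp_all)
  have hc : ∀ X : Set (V d), (∀ x ∈ X, ∀ y ∈ X, φ x y = false) → ∀ x y, LinkR nb X x y →
      ψ x = ψ y := by
    intro X hX x y hxy
    refine hxy.induct (P := fun y => ψ x = ψ y) rfl ?_
    intro a b ha ih hab hb
    have := hψ a b hab
    rw [hX a ha.right b hb] at this
    rw [ih]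
    simpa using this
  have hcA := hc A (fun x hx y hy => by
    simp only [φ, decide_eq_false_iff_not]
    rintro (⟨-, h⟩ | ⟨-, h⟩)
    · exact hAS _ hy (hS1 h).1
    · exact hAS _ hx (hS1 h).1)
  have hcC := hc (cpt A j) (fun x hx y hy => by
    simp only [φ, decide_eq_false_iff_not]
    rintro (⟨h, -⟩ | ⟨h, -⟩)
    · exact hAS _ h hx
    · exact hAS _ h hy)
  obtain ⟨a, ha, has⟩ := hs.2
  obtain ⟨b, hb, hbt⟩ := ht.2
  have k1 := hcA a b (hA a ha b hb)
  have k2 := hcC s t (sconn_cpt A j s hs.1 t ht.1)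
  have k3 := hψ a s has
  have k4 := hψ b t hbt
  have k5 : φ a s = true := by
    simp only [φ, decide_eq_true_eq]; exact Or.inl ⟨ha, LinkR.refl hs⟩
  have k6 : φ b t = false := by
    simp only [φ, decide_eq_false_iff_not]
    rintro (⟨-, h⟩ | ⟨h, -⟩)
    · exact hst h
    · exact hAS _ h ht.1
  rw [k1, k2, k4, k6] at k3
  rw [k5] at k3
  exact absurd k3 (by decide)

end Star

end Part1

section Part2

section Star
variable {d : ℕ}

/-- coordinate hull -/
def hull (u v : V d) : Set (V d) := {w | ∀ k, (u k ≤ w k ∧ w k ≤ v k) ∨ (v k ≤ w k ∧ w k ≤ u k)}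

lemma mem_hull_left (u v : V d) : u ∈ hull u v := fun k => by omega

lemma link_hull_aux (n : ℕ) : ∀ u v : V d, (∀ k, |u k - v k| ≤ n) →
    ∀ X : Set (V d), hull u v ⊆ X → LinkR nb X u v := by
  induction n with
  | zero =>
    intro u v h X hX
    have : u = v := by
      funext k
      have := h k
      simp only [Nat.cast_zero, abs_nonpos_iff] at this
      omega
    subst this
    exact LinkR.refl (hX (mem_hull_left _ _))
  | succ n ih =>
    intro u v h X hX
    let u' : V d := fun k => u k + (v k - u k).sign
    have h1 : hull u' v ⊆ hull u v := by
      intro w hw k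
      have := hw k
      have h2 := sign_cases (v k - u k)
      simp only [u'] at this
      omega
    have h2 := ih u' v (fun k => by
      have h1 := h k
      have h2 := sign_cases (v k - u k)
      simp only [u']
      push_cast at h1
      rw [abs_le] at *
      omega) X (h1.trans hX)
    refine LinkR.trans (LinkR.single ?_ (hX (mem_hull_left _ _)) h2.left) h2
    intro k
    have h2 := sign_cases (v k - u k)
    simp only [u']
    rw [abs_le]
    omega

lemma link_hull {u v : V d} {X : Set (V d)} (hX : hull u v ⊆ X) : LinkR nb X u v := by
  refine link_hull_aux (∑ k, (u k - v k).natAbs) u v (fun k => ?_) X hX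
  rw [Int.abs_eq_natAbs]
  exact_mod_cast Finset.single_le_sum (f := fun k => (u k - v k).natAbs) (fun _ _ => Nat.zero_le _)
      (Finset.mem_univ k)

lemma link_univ (u v : V d) : LinkR nb Set.univ u v := link_hull (Set.subset_univ _)

lemma exists_ne (hd : 2 ≤ d) (k : Fin d) : ∃ l : Fin d, l ≠ k := by
  by_cases h : k = ⟨0, by omega⟩
  · exact ⟨⟨1, by omega⟩, by rw [h]; simp [Fin.ext_iff]⟩
  · exact ⟨⟨0, by omega⟩, fun h' => h h'.symm⟩

lemma link_compl_bx_aux (hd : 2 ≤ d) {Y : Set (V d)} (hY : ∀ u ∈ Y, ∀ v ∈ Y, hull u v ⊆ Y)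
    {s κ : V d} {l : ℕ} (hκ : κ ∈ Y) (hfar : ∀ k, (l : ℤ) < |κ k - s k|) {u : V d}
    (hmix : ∀ k, Function.update κ k (u k) ∈ Y)
    (hu : u ∈ Y) (hus : u ∉ bx s l) : LinkR nb (Y \ bx s l) u κ := by
  classical
  simp only [bx, Set.mem_ofPred_eq, not_forall, not_le] at hus
  obtain ⟨k, hk⟩ := hus
  obtain ⟨l', hl'⟩ := exists_ne hd k
  let u' : V d := Function.update κ k (u k)
  have e1 : u' k = u k := by simp [u']
  have e2 : u' l' = κ l' := by simp [u', hl']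
  have a1 : LinkR nb (Y \ bx s l) u u' := by
    apply link_hull
    intro w hw
    refine ⟨hY _ hu _ (hmix k) hw, fun hb => ?_⟩
    have := hw k
    have hb' := hb k
    rw [e1] at this
    have : w k = u k := by omega
    rw [this] at hb'
    omega
  have a2 : LinkR nb (Y \ bx s l) u' κ := by
    apply link_hull
    intro w hw
    refine ⟨hY _ (hmix k) _ hκ hw, fun hb => ?_⟩
    have := hw l'
    have hb' := hb l'
    have h3 := hfar l'
    rw [e2] at this
    have : w l' = κ l' := by omega
    rw [this] at hb'
    omega
  exact a1.trans a2

lemma link_compl_bx (hd : 2 ≤ d) {s u v : V d} {l : ℕ} (hu : u ∉ bx s l) (hv : v ∉ bx s l) :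
    LinkR nb (bx s l)ᶜ u v := by
  have key : ∀ u : V d, u ∉ bx s l → LinkR nb (Set.univ \ bx s l) u (fun k => s k + l + 1) :=
    fun u hu => link_compl_bx_aux hd (fun _ _ _ _ => Set.subset_univ _) (Set.mem_univ _)
      (fun k => by rw [lt_abs]; left; omega) (fun _ => Set.mem_univ _) (Set.mem_univ _) hu
  have := (key u hu).trans ((key v hv).symm nb_symm)
  rwa [← Set.compl_eq_univ_sdiff] at this

lemma hull_bx (c : V d) (n : ℕ) : ∀ u ∈ bx c n, ∀ v ∈ bx c n, hull u v ⊆ bx c n := by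
  intro u hu v hv w hw k
  have h1 := hu k
  have h2 := hv k
  have h3 := hw k
  rw [abs_le] at *
  omega

lemma link_bx_diff (hd : 2 ≤ d) {c s u v : V d} {l N : ℕ} (hl : l < N)
    (hu : u ∈ bx c N) (hv : v ∈ bx c N) (hus : u ∉ bx s l) (hvs : v ∉ bx s l) :
    LinkR nb (bx c N \ bx s l) u v := by
  classical
  let κ : V d := fun k => if c k ≤ s k then c k - N else c k + N
  have hκ : κ ∈ bx c N := by
    intro k
    simp only [κ]
    rw [abs_le]
    split_ifs <;> omega
  have key : ∀ u : V d, u ∈ bx c N → u ∉ bx s l → LinkR nb (bx c N \ bx s l) u κ := by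
    intro u hu hus
    refine link_compl_bx_aux hd (hull_bx c N) hκ ?_ ?_ hu hus
    · intro k
      simp only [κ]
      rw [lt_abs]
      split_ifs <;> omega
    · intro k k'
      by_cases h : k' = k
      · subst h; simpa using hu k'
      · simpa [h] using hκ k'
  exact (key u hu hus).trans ((key v hv hvs).symm nb_symm)

/-- clamp to a box -/
def cl (c : V d) (N : ℕ) (v : V d) : V d := fun k => max (c k - N) (min (c k + N) (v k))

lemma cl_mem (c : V d) (N : ℕ) (v : V d) : cl c N v ∈ bx c N := by
  intro k
  simp only [cl]
  rw [abs_le]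
  omega

lemma cl_of_mem {c : V d} {N : ℕ} {v : V d} (h : v ∈ bx c N) : cl c N v = v := by
  funext k
  have := h k
  simp only [cl]
  rw [abs_le] at this
  omega

lemma cl_nb (c : V d) (N : ℕ) {u v : V d} (h : nb u v) : nb (cl c N u) (cl c N v) := by
  intro k
  have := h k
  simp only [cl]
  rw [abs_le] at *
  omega

/-- In a box where bad clusters are small there is a main good cluster. -/
theorem main_cluster (hd : 2 ≤ d) (c : V d) (N l : ℕ) (hl : l + 2 ≤ N) (B : Set (V d))
    (hB : ∀ S ⊆ B ∩ bx c N, SConn S → ∀ x ∈ S, S ⊆ bx x l) :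
    ∃ M : Set (V d), M ⊆ bx c N \ B ∧ (∀ i ∈ M, ∀ j ∈ M, LinkR nb (bx c N \ B) i j) ∧
      ∀ Γ ⊆ bx c N, SConn Γ → (∃ x ∈ Γ, ∃ y ∈ Γ, ∃ k, (2 * l : ℤ) < |x k - y k|) →
        (Γ ∩ M).Nonempty := by
  classical
  let Λ := bx c N
  let Bt : Set (V d) := {v | cl c N v ∈ B}
  -- sets connected inside Bt are small after clamping
  have small : ∀ x y, LinkR nb Bt x y → ∀ k, |cl c N y k - cl c N x k| ≤ (l : ℤ) := by
    intro x y h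
    have h1 : SConn {z | LinkR nb (B ∩ Λ) (cl c N x) z} := sconn_comp _ _
    have h2 : LinkR nb (B ∩ Λ) (cl c N x) (cl c N y) :=
      h.map (cl c N) (fun a ha => ⟨ha, cl_mem _ _ _⟩) (fun a b hab => cl_nb _ _ hab)
    exact hB _ (fun z hz => LinkR.right hz) h1 (cl c N x) (LinkR.refl h2.left) h2
  let k0 : Fin d := ⟨0, by omega⟩
  let k1 : Fin d := ⟨1, by omega⟩
  have k01 : k0 ≠ k1 := by simp [k0, k1, Fin.ext_iff]
  let G0 : Set (V d) := {v | ∀ k, k ≠ k0 → v k = c k}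
  let A0 : Set (V d) := {v | v ∈ G0 ∨ ∃ b ∈ Bt, (∃ g ∈ G0, nb g b) ∧ LinkR nb Bt b v}
  have hG0A : G0 ⊆ A0 := fun v hv => Or.inl hv
  have hG0 : SConn G0 := by
    intro x hx y hy
    apply link_hull
    intro w hw k hk
    have := hw k
    rw [hx k hk, hy k hk] at this
    omega
  have hA0c : c ∈ A0 := Or.inl (fun k _ => rfl)
  have hA0l : ∀ v ∈ A0, LinkR nb A0 c v := by
    rintro v (hv | ⟨b, hb, ⟨g, hg, hgb⟩, hbv⟩)
    · exact (hG0 c (fun k _ => rfl) v hv).mono hG0A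
    · have e1 : LinkR nb A0 c g := (hG0 c (fun k _ => rfl) g hg).mono hG0A
      have e2 : LinkR nb A0 b v := by
        refine LinkR.mono ?_ (LinkR.restrict hbv)
        intro z hz
        exact Or.inr ⟨b, hb, ⟨g, hg, hgb⟩, hz⟩
      exact (e1.tail hgb e2.left).trans e2
  have hA0 : SConn A0 := fun x hx y hy => ((hA0l x hx).symm nb_symm).trans (hA0l y hy)
  have htube : ∀ v ∈ A0, v k1 - c k1 ≤ l + 1 := by
    rintro v (hv | ⟨b, hb, ⟨g, hg, hgb⟩, hbv⟩)
    · rw [hv k1 k01.symm]; omega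
    · have e1 := small b v hbv k1
      have e2 := hgb k1
      rw [hg k1 k01.symm] at e2
      simp only [cl] at e1
      rw [abs_le] at e1 e2
      omega
  let j : V d := fun k => if k = k1 then c k + (l + 2) else c k
  have hhalf : ∀ v : V d, v k1 - c k1 = l + 2 → v ∈ cpt A0 j := by
    intro v hv
    apply link_hull
    intro w hw hwA
    have e1 := hw k1
    have e2 := htube w hwA
    simp only [j, if_true] at e1
    omega
  let S := bdy A0 j
  have hS : SConn S := sconn_bdy hA0 j
  have hSB : ∀ s ∈ S, s ∉ Bt := by
    rintro s ⟨hs1, a, ha, has⟩ hsB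
    apply hs1.right
    rcases ha with ha | ⟨b, hb, hg, hba⟩
    · exact Or.inr ⟨s, hsB, ⟨a, ha, has⟩, LinkR.refl hsB⟩
    · exact Or.inr ⟨b, hb, hg, hba.tail has hsB⟩
  -- S meets every column
  have hcol : ∀ t : ℤ, |t| ≤ N → ∃ s ∈ S, s k0 = c k0 + t ∧ s ∈ bx c N := by
    intro t ht
    let u0 : V d := Function.update c k0 (c k0 + t)
    let u1 : V d := Function.update u0 k1 (c k1 + (l + 2))
    have e0 : u0 ∈ A0 := Or.inl (fun k hk => by simp [u0, hk])
    have e1 : u1 ∈ cpt A0 j := hhalf u1 (by simp [u1])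
    obtain ⟨s, hs, hs'⟩ := cross_bdy (link_hull (u := u1) (v := u0) subset_rfl) e1 e0
    refine ⟨s, hs, ?_, ?_⟩
    · have := hs' k0
      simp only [u1, u0, Function.update_self, Function.update_of_ne k01] at this
      omega
    · intro k
      have := hs' k
      rw [abs_le] at *
      by_cases h1 : k = k1
      · subst h1
        simp only [u1, u0, Function.update_self, Function.update_of_ne k01.symm] at this
        omega
      · by_cases h0 : k = k0
        · subst h0
          simp only [u1, u0, Function.update_self, Function.update_of_ne k01] at this
          omega
        · simp only [u1, u0, Function.update_of_ne h0, Function.update_of_ne h1] at this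
          omega
  obtain ⟨s0, hs0, hs0', hs0b⟩ := hcol N (by simp)
  obtain ⟨s1, hs1, hs1', hs1b⟩ := hcol (-N) (by simp)
  let A : Set (V d) := {v | LinkR nb Btᶜ s0 v}
  have hSA : ∀ s ∈ S, s ∈ A := fun s hs => LinkR.mono (fun x hx => hSB x hx) (hS s0 hs0 s hs)
  have hA : SConn A := sconn_comp _ _
  refine ⟨A ∩ bx c N, ?_, ?_, ?_⟩
  · rintro v ⟨hv, hv'⟩
    refine ⟨hv', fun hvB => hv.right ?_⟩
    simp only [Bt, Set.mem_ofPred_eq]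
    rwa [cl_of_mem hv']
  · rintro x ⟨hx, hx'⟩ y ⟨hy, hy'⟩
    have h1 : LinkR nb Btᶜ x y := (hx.symm nb_symm).trans hy
    have h2 := h1.map (r' := nb) (S := Btᶜ) (T := bx c N \ B) (cl c N)
      (fun a ha => ⟨cl_mem _ _ _, fun h => ha h⟩) (fun a b hab => cl_nb _ _ hab)
    rwa [cl_of_mem hx', cl_of_mem hy'] at h2
  · rintro Γ hΓ hΓc ⟨x, hx, y, hy, k, hk⟩
    by_contra hne
    have hdis : ∀ v ∈ Γ, v ∉ A := fun v hv hvA => hne ⟨v, hv, hvA, hΓ hv⟩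
    have hΓC : ∀ v ∈ Γ, v ∈ cpt A x := fun v hv =>
      LinkR.mono (fun z hz => hdis z hz) (hΓc x hx v hv)
    have hS2 : SConn (bdy A x) := sconn_bdy hA x
    have hS2B : bdy A x ⊆ Bt := by
      rintro s ⟨hs1, a, ha, has⟩
      by_contra hsB
      exact hs1.right (LinkR.tail ha has hsB)
    obtain ⟨σ, hσ, -⟩ := cross_bdy (link_univ x s0) (hΓC x hx) (hSA s0 hs0)
    have hS2s : ∀ s ∈ bdy A x, s ∈ bx c N → s ∈ bx (cl c N σ) l := by
      intro s hs hsb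
      have := small σ s (LinkR.mono hS2B (hS2 σ hσ s hs))
      rw [cl_of_mem hsb] at this
      exact this
    have far : ∀ a b : V d, ∀ k, (2 * l : ℤ) < |a k - b k| →
        a ∉ bx (cl c N σ) l ∨ b ∉ bx (cl c N σ) l := by
      intro a b k hab
      by_contra h
      push Not at h
      have h1 := h.1 k
      have h2 := h.2 k
      rw [lt_abs] at hab
      rw [abs_le] at h1 h2
      omega
    obtain ⟨g, hg, hg'⟩ : ∃ g ∈ Γ, g ∉ bx (cl c N σ) l := by
      rcases far x y k hk with h | h
      · exact ⟨x, hx, h⟩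
      · exact ⟨y, hy, h⟩
    obtain ⟨a, ha, hab, ha'⟩ : ∃ a ∈ A, a ∈ bx c N ∧ a ∉ bx (cl c N σ) l := by
      rcases far s0 s1 k0 (by rw [hs0', hs1', lt_abs]; left; omega) with h | h
      · exact ⟨s0, hSA s0 hs0, hs0b, h⟩
      · exact ⟨s1, hSA s1 hs1, hs1b, h⟩
    obtain ⟨s, hs, hs'⟩ := cross_bdy (link_bx_diff hd (show l < N by omega) (hΓ hg) hab hg' ha')
      (hΓC g hg) ha
    exact hs'.2 (hS2s s hs hs'.1)

end Star

end Part2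

section Part3

section Prob
variable {ι : Type*}

/-- the event `A` only depends on the coordinates in `S` -/
def Dep (S : Finset ι) (A : Set (ι → Bool)) : Prop :=
  ∀ ω ω', (∀ i ∈ S, ω i = ω' i) → ω ∈ A → ω' ∈ A

lemma Dep.mono {S T : Finset ι} {A : Set (ι → Bool)} (h : Dep S A) (hST : S ⊆ T) : Dep T A :=
  fun ω ω' hω => h ω ω' (fun i hi => hω i (hST hi))

lemma Dep.compl {S : Finset ι} {A : Set (ι → Bool)} (h : Dep S A) : Dep S Aᶜ :=
  fun ω ω' hω hA hA' => hA (h ω' ω (fun i hi => (hω i hi).symm) hA')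

lemma Dep.inter {S : Finset ι} {A B : Set (ι → Bool)} (h : Dep S A) (h' : Dep S B) :
    Dep S (A ∩ B) := fun ω ω' hω hA => ⟨h ω ω' hω hA.1, h' ω ω' hω hA.2⟩

lemma Dep.union {S : Finset ι} {A B : Set (ι → Bool)} (h : Dep S A) (h' : Dep S B) :
    Dep S (A ∪ B) := fun ω ω' hω hA => hA.imp (h ω ω' hω) (h' ω ω' hω)

lemma Dep.diff {S : Finset ι} {A B : Set (ι → Bool)} (h : Dep S A) (h' : Dep S B) :
    Dep S (A \ B) := h.inter h'.compl

lemma Dep.eq_preimage {S : Finset ι} {A : Set (ι → Bool)} (h : Dep S A) :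
    A = (fun (ω : ι → Bool) (i : S) => ω i) ⁻¹'
      ((fun (ω : ι → Bool) (i : S) => ω i) '' A) := by
  ext ω
  constructor
  · intro hω; exact ⟨ω, hω, rfl⟩
  · rintro ⟨ω', hω', he⟩
    exact h ω' ω (fun i hi => congrFun he ⟨i, hi⟩) hω'

lemma Dep.measurableSet {S : Finset ι} {A : Set (ι → Bool)} (h : Dep S A) : MeasurableSet A := by
  rw [h.eq_preimage]
  have : Measurable (fun (ω : ι → Bool) (i : S) => ω i) := by fun_prop
  exact this (Set.toFinite _).measurableSet

lemma cyl_dep (s : Finset ι) (f : ι → Bool) : Dep s {ω | ∀ i ∈ s, ω i = f i} :=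
  fun _ _ h hω i hi => (h i hi).symm.trans (hω i hi)

/-- the coordinates are independent -/
def IndC (μ : Measure (ι → Bool)) : Prop :=
  ProbabilityTheory.iIndepFun (fun (i : ι) (ω : ι → Bool) => ω i) μ

lemma Dep.indep {μ : Measure (ι → Bool)} (hμ : IndC μ) {S T : Finset ι} (hST : Disjoint S T)
    {A B : Set (ι → Bool)} (hA : Dep S A) (hB : Dep T B) : μ (A ∩ B) = μ A * μ B := by
  have h := ProbabilityTheory.iIndepFun.indepFun_finset S T hST hμ (fun i => by fun_prop)
  have := h.measure_inter_preimage_eq_mul _ _ (Set.toFinite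
      ((fun (ω : ι → Bool) (i : S) => ω i) '' A)).measurableSet
    (Set.toFinite ((fun (ω : ι → Bool) (i : T) => ω i) '' B)).measurableSet
  rwa [← hA.eq_preimage, ← hB.eq_preimage] at this

lemma Dep.iInter {J : Type*} {T : J → Finset ι} {A : J → Set (ι → Bool)} [DecidableEq ι]
    (D : Finset J) (hA : ∀ j ∈ D, Dep (T j) (A j)) : Dep (D.biUnion T) (⋂ j ∈ D, A j) := by
  intro ω ω' h hω
  simp only [Set.mem_iInter] at *
  intro j hj
  exact hA j hj ω ω' (fun i hi => h i (Finset.mem_biUnion.2 ⟨j, hj, hi⟩)) (hω j hj)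

lemma Dep.prod {μ : Measure (ι → Bool)} [IsProbabilityMeasure μ] (hμ : IndC μ) {J : Type*}
    {T : J → Finset ι}
    {A : J → Set (ι → Bool)} (D : Finset J) (hA : ∀ j ∈ D, Dep (T j) (A j))
    (hd : ∀ j ∈ D, ∀ j' ∈ D, j ≠ j' → Disjoint (T j) (T j')) :
    μ (⋂ j ∈ D, A j) = ∏ j ∈ D, μ (A j) := by
  classical
  induction D using Finset.induction_on with
  | empty => simp
  | insert a D ha ih =>
    rw [Finset.set_biInter_insert, Finset.prod_insert ha,
      Dep.indep hμ (T := D.biUnion T) _ (hA a (by simp))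
        (Dep.iInter D (fun j hj => hA j (by simp [hj]))),
      ih (fun j hj => hA j (by simp [hj]))
        (fun j hj j' hj' => hd j (by simp [hj]) j' (by simp [hj']))]
    rw [Finset.disjoint_biUnion_right]
    intro j hj
    exact hd a (by simp) j (by simp [hj]) (fun h => ha (h ▸ hj))

/-- Bernoulli measure on `Bool` (parameter clamped to the unit interval) -/
noncomputable def bern (p : ℝ) : Measure Bool :=
  ENNReal.ofReal (max 0 (min 1 p)) • Measure.dirac true +
    ENNReal.ofReal (1 - max 0 (min 1 p)) • Measure.dirac false

instance (p : ℝ) : IsProbabilityMeasure (bern p) := by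
  constructor
  simp only [bern, Measure.coe_add, Measure.coe_smul, Pi.add_apply, Pi.smul_apply,
    measure_univ, smul_eq_mul, mul_one]
  rw [← ENNReal.ofReal_add (by positivity) (by simp)]
  simp

lemma bern_singleton {p : ℝ} (h0 : 0 ≤ p) (h1 : p ≤ 1) (b : Bool) :
    bern p {b} = ENNReal.ofReal (if b then p else 1 - p) := by
  have : max 0 (min 1 p) = p := by simp [h0, h1]
  simp only [bern, this]
  cases b <;> simp

/-- product Bernoulli measure -/
noncomputable def BP (p : ι → ℝ) : Measure (ι → Bool) := Measure.infinitePi (fun i => bern (p i))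

instance (p : ι → ℝ) : IsProbabilityMeasure (BP p) := by unfold BP; infer_instance

lemma BP_ind (p : ι → ℝ) : IndC (BP p) := by
  exact ProbabilityTheory.iIndepFun_infinitePi (X := fun i x => x) (fun i => measurable_id)

lemma BP_cyl {p : ι → ℝ} (s : Finset ι) (f : ι → Bool) :
    BP p {ω | ∀ i ∈ s, ω i = f i} = ∏ i ∈ s, bern (p i) {f i} := by
  have : {ω : ι → Bool | ∀ i ∈ s, ω i = f i} = Set.pi s (fun i => {f i}) := by
    ext ω; simp [Set.mem_pi]
  rw [this, BP, Measure.infinitePi_pi]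
  intro i _
  exact measurableSet_singleton _

lemma BP_unique {p : ι → ℝ} (μ : Measure (ι → Bool))
    (h : ∀ (s : Finset ι) (f : ι → Bool), μ {ω | ∀ i ∈ s, ω i = f i} = ∏ i ∈ s, bern (p i) {f i}) :
    μ = BP p := by
  classical
  apply Measure.eq_infinitePi
  intro s t _
  have key : ∀ s u : Finset ι, Disjoint s u → ∀ f : ι → Bool,
      μ (Set.pi s t ∩ {ω | ∀ i ∈ u, ω i = f i}) =
        (∏ i ∈ s, bern (p i) (t i)) * ∏ i ∈ u, bern (p i) {f i} := by
    intro s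
    induction s using Finset.induction_on with
    | empty => intro u _ f; simp [h u f]
    | insert a s ha ih =>
      intro u hu f
      rw [Finset.disjoint_insert_left] at hu
      have e : ∀ b : Bool, b ∈ t a → (Set.pi (↑(insert a s)) t ∩ {ω | ∀ i ∈ u, ω i = f i}) ∩
          {ω | ω a = b} = Set.pi s t ∩
            {ω : ι → Bool | ∀ i ∈ insert a u, ω i = Function.update f a b i} := by
        intro b hb
        ext ω
        simp only [Set.mem_inter_iff, Set.mem_pi, Finset.coe_insert, Set.mem_insert_iff,
          Finset.mem_coe, forall_eq_or_imp, Finset.mem_insert, Function.update_self,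
          Set.mem_ofPred_eq]
        constructor
        · rintro ⟨⟨⟨h1, h2⟩, h3⟩, h4⟩
          refine ⟨h2, h4, fun i hi => ?_⟩
          have : i ≠ a := fun h => hu.1 (h ▸ hi)
          simpa [this] using h3 i hi
        · rintro ⟨h2, h4, h3⟩
          refine ⟨⟨⟨h4 ▸ hb, h2⟩, fun i hi => ?_⟩, h4⟩
          have : i ≠ a := fun h => hu.1 (h ▸ hi)
          simpa [this] using h3 i hi
      have e' : ∀ b : Bool, b ∉ t a → (Set.pi (↑(insert a s)) t ∩ {ω | ∀ i ∈ u, ω i = f i}) ∩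
          {ω : ι → Bool | ω a = b} = ∅ := by
        intro b hb
        ext ω
        simp only [Set.mem_inter_iff, Set.mem_pi, Finset.coe_insert, Set.mem_insert_iff,
          Finset.mem_coe, forall_eq_or_imp, Set.mem_ofPred_eq, Set.mem_empty_iff_false, iff_false]
        rintro ⟨⟨⟨h1, -⟩, -⟩, h4⟩
        exact hb (h4 ▸ h1)
      have m : ∀ b : Bool, μ ((Set.pi (↑(insert a s)) t ∩ {ω | ∀ i ∈ u, ω i = f i}) ∩
          {ω | ω a = b}) = (∏ i ∈ s, bern (p i) (t i)) * (∏ i ∈ u, bern (p i) {f i}) *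
            (if b ∈ t a then bern (p a) {b} else 0) := by
        intro b
        split_ifs with hb
        · rw [e b hb, ih (insert a u) (by
            rw [Finset.disjoint_insert_right]; exact ⟨ha, hu.2⟩) _, Finset.prod_insert hu.1]
          rw [Function.update_self]
          have : ∏ i ∈ u, bern (p i) {Function.update f a b i} = ∏ i ∈ u, bern (p i) {f i} := by
            refine Finset.prod_congr rfl fun i hi => ?_
            have : i ≠ a := fun h => hu.1 (h ▸ hi)
            simp [this]
          rw [this]; ring
        · rw [e' b hb]; simp
      have split : ∀ X : Set (ι → Bool), μ X = μ (X ∩ {ω | ω a = true}) +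
          μ (X ∩ {ω | ω a = false}) := by
        intro X
        have hm : MeasurableSet {ω : ι → Bool | ω a = true} := by
          have : Measurable (fun ω : ι → Bool => ω a) := by fun_prop
          exact this (measurableSet_singleton true)
        have : {ω : ι → Bool | ω a = false} = {ω : ι → Bool | ω a = true}ᶜ := by
          ext ω; simp
        rw [this, ← Set.sdiff_eq, measure_inter_add_sdiff X hm]
      rw [split, m true, m false, ← mul_add, Finset.prod_insert ha]
      have : (if true ∈ t a then bern (p a) {true} else 0) +
          (if false ∈ t a then bern (p a) {false} else 0) = bern (p a) (t a) := by
        have hs : bern (p a) (t a) = ∑ b : Bool, if b ∈ t a then bern (p a) {b} else 0 := by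
          rw [← Finset.sum_filter, ← measure_biUnion_finset]
          · congr 1; ext b; simp
          · intro b _ b' _ hbb
            simpa using hbb
          · intro b _; exact measurableSet_singleton b
        rw [hs]; simp
      rw [this]; ring
  have := key s ∅ (by simp) (fun _ => true)
  simpa using this

lemma BP_reindex {κ : Type*} (σ : ι → κ) (hσ : Function.Injective σ) (p : κ → ℝ) :
    (BP p).map (fun ω i => ω (σ i)) = BP (fun i => p (σ i)) := by
  classical
  apply BP_unique
  intro s f
  rw [Measure.map_apply (by fun_prop)
    (cyl_dep s f).measurableSet]
  by_cases hs : s.Nonempty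
  · obtain ⟨i0, _⟩ := hs
    have : Nonempty ι := ⟨i0⟩
    have := BP_cyl (p := p) (s.image σ) (fun k => f (Function.invFun σ k))
    simp only [Finset.mem_image, forall_exists_index, and_imp, forall_apply_eq_imp_iff₂,
      Function.leftInverse_invFun hσ _] at this
    rw [Finset.prod_image (fun _ _ _ _ h => hσ h)] at this
    simpa [Function.leftInverse_invFun hσ _] using this
  · rw [Finset.not_nonempty_iff_eq_empty] at hs
    subst hs
    simp

/-- combining the two layers -/
lemma BP_combine (h : Bool → Bool → Bool) (p : ι × Bool → ℝ) (q : ι → ℝ)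
    (hq : ∀ i b, BP p {ω | h (ω (i, false)) (ω (i, true)) = b} = bern (q i) {b}) :
    (BP p).map (fun ω i => h (ω (i, false)) (ω (i, true))) = BP q := by
  classical
  apply BP_unique
  intro s f
  have hm : Measurable (fun (ω : ι × Bool → Bool) (i : ι) => h (ω (i, false)) (ω (i, true))) := by
    rw [measurable_pi_iff]
    intro i
    have h1 : Measurable (fun x : Bool × Bool => h x.1 x.2) := measurable_of_finite _
    have h2 : Measurable (fun ω : ι × Bool → Bool => (ω (i, false), ω (i, true))) := by fun_prop
    exact h1.comp h2
  rw [Measure.map_apply hm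
    (cyl_dep s f).measurableSet]
  have e : (fun (ω : ι × Bool → Bool) (i : ι) => h (ω (i, false)) (ω (i, true))) ⁻¹'
      {ω | ∀ i ∈ s, ω i = f i} = ⋂ i ∈ s, {ω | h (ω (i, false)) (ω (i, true)) = f i} := by
    ext ω; simp
  rw [e, Dep.prod (BP_ind p) (T := fun i => {(i, false), (i, true)})]
  · exact Finset.prod_congr rfl fun i _ => hq i _
  · intro i _ ω ω' hω hA
    simp only [Set.mem_ofPred_eq] at *
    rw [← hω (i, false) (by simp), ← hω (i, true) (by simp)]; exact hA
  · intro i _ j _ hij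
    simp [Ne.symm hij]

lemma BP_pair (p : ι × Bool → ℝ) (i : ι) (b b' : Bool) :
    BP p {ω | ω (i, false) = b ∧ ω (i, true) = b'} =
      bern (p (i, false)) {b} * bern (p (i, true)) {b'} := by
  classical
  have := BP_cyl (p := p) {(i, false), (i, true)} (fun k => if k.2 then b' else b)
  simp only [Finset.mem_insert, Finset.mem_singleton, forall_eq_or_imp, forall_eq,
    Bool.false_eq_true, if_false, if_true] at this
  rw [this, Finset.prod_pair (by simp)]
  simp

lemma pair_dep [DecidableEq ι] (i : ι) (P : Bool → Bool → Prop) :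
    Dep {(i, false), (i, true)} {ω : ι × Bool → Bool | P (ω (i, false)) (ω (i, true))} := by
  intro ω ω' hω hA
  simp only [Set.mem_ofPred_eq] at *
  rw [← hω (i, false) (by simp), ← hω (i, true) (by simp)]; exact hA

lemma BP_and {a b : ℝ} (ha : 0 ≤ a) (ha1 : a ≤ 1) (hb : 0 ≤ b) (hb1 : b ≤ 1) :
    (BP (fun k : ι × Bool => if k.2 then b else a)).map
      (fun ω i => ω (i, false) && ω (i, true)) = BP (fun _ => a * b) := by
  classical
  apply BP_combine
  intro i c
  have h1 := BP_pair (fun k : ι × Bool => if k.2 then b else a) i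
  simp only [Bool.false_eq_true, if_false, if_true, bern_singleton ha ha1,
    bern_singleton hb hb1] at h1
  have ht : BP (fun k : ι × Bool => if k.2 then b else a)
      {ω | (ω (i, false) && ω (i, true)) = true} = ENNReal.ofReal (a * b) := by
    have := h1 true true
    simp only [if_true] at this
    rw [ENNReal.ofReal_mul ha, ← this]
    congr 1; ext ω; simp
  have hab : a * b ≤ 1 := mul_le_one₀ ha1 hb hb1
  rw [bern_singleton (by positivity) hab]
  cases c with
  | true => simpa using ht
  | false =>
    have hc : {ω : ι × Bool → Bool | (ω (i, false) && ω (i, true)) = false} =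
        {ω | (ω (i, false) && ω (i, true)) = true}ᶜ := by ext ω; simp
    rw [hc, prob_compl_eq_one_sub (pair_dep i (fun x y => (x && y) = true)).measurableSet, ht]
    simp only [Bool.false_eq_true, if_false]
    rw [ENNReal.ofReal_sub _ (by positivity), ENNReal.ofReal_one]

lemma BP_or {a b : ℝ} (ha : 0 ≤ a) (ha1 : a ≤ 1) (hb : 0 ≤ b) (hb1 : b ≤ 1) :
    (BP (fun k : ι × Bool => if k.2 then b else a)).map
      (fun ω i => ω (i, false) || ω (i, true)) = BP (fun _ => 1 - (1 - a) * (1 - b)) := by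
  classical
  apply BP_combine
  intro i c
  have h1 := BP_pair (fun k : ι × Bool => if k.2 then b else a) i
  simp only [Bool.false_eq_true, if_false, if_true, bern_singleton ha ha1,
    bern_singleton hb hb1] at h1
  have ht : BP (fun k : ι × Bool => if k.2 then b else a)
      {ω | (ω (i, false) || ω (i, true)) = false} = ENNReal.ofReal ((1 - a) * (1 - b)) := by
    have := h1 false false
    simp only [Bool.false_eq_true, if_false] at this
    rw [ENNReal.ofReal_mul (by linarith), ← this]
    congr 1; ext ω; simp
  have hab : (1 - a) * (1 - b) ≤ 1 := mul_le_one₀ (by linarith) (by linarith) (by linarith)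
  have hab0 : 0 ≤ (1 - a) * (1 - b) := mul_nonneg (by linarith) (by linarith)
  rw [bern_singleton (by linarith) (by linarith)]
  cases c with
  | false => simpa using ht
  | true =>
    have hc : {ω : ι × Bool → Bool | (ω (i, false) || ω (i, true)) = true} =
        {ω | (ω (i, false) || ω (i, true)) = false}ᶜ := by
      ext ω
      simp only [Set.mem_ofPred_eq, Set.mem_compl_iff]
      cases ω (i, false) <;> cases ω (i, true) <;> simp
    rw [hc, prob_compl_eq_one_sub (pair_dep i (fun x y => (x || y) = false)).measurableSet, ht]
    simp only [if_true]
    rw [ENNReal.ofReal_sub _ hab0, ENNReal.ofReal_one]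

end Prob

lemma P_eq_BP {d : ℕ} (F : BernoulliFamily d) {p : ℝ} (h0 : 0 ≤ p) (h1 : p ≤ 1) :
    F.P p = BP (fun _ => p) := by
  apply BP_unique
  intro s f
  rw [F.iid p h0 h1]
  exact Finset.prod_congr rfl fun i _ => (bern_singleton h0 h1 _).symm

/-- events that eventually fail almost surely have vanishing probability -/
lemma ev_tendsto {Ω : Type*} [MeasurableSpace Ω] (μ : Measure Ω) [IsProbabilityMeasure μ]
    (A : ℕ → Set Ω) (hA : ∀ n, MeasurableSet (A n)) (h : ∀ᵐ ω ∂μ, ∀ᶠ n in atTop, ω ∉ A n) :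
    Tendsto (fun n => μ (A n)) atTop (𝓝 0) := by
  have := tendsto_measure_of_ae_tendsto_indicator_of_isFiniteMeasure (A := ∅) (As := A) atTop
    (μ := μ) MeasurableSet.empty hA (by
      filter_upwards [h] with ω hω
      filter_upwards [hω] with n hn
      simp [hn])
  simpa using this

end Part3

section Part4

section Counting
variable {d : ℕ}

/-- the sup-ball as a finset -/
noncomputable def bxF (c : V d) (n : ℕ) : Finset (V d) := Fintype.piFinset (fun k => Finset.Icc (c k - n) (c k + n))

lemma mem_bxF {c x : V d} {n : ℕ} : x ∈ bxF c n ↔ x ∈ bx c n := by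
  simp only [bxF, Fintype.mem_piFinset, Finset.mem_Icc, bx, Set.mem_ofPred_eq, abs_le]
  refine forall_congr' fun k => ?_
  constructor <;> intro h <;> constructor <;> linarith [h.1, h.2]

lemma coe_bxF (c : V d) (n : ℕ) : (bxF c n : Set (V d)) = bx c n := by
  ext x; exact mem_bxF

lemma card_bxF (c : V d) (n : ℕ) : (bxF c n).card = (2 * n + 1) ^ d := by
  rw [bxF, Fintype.card_piFinset]
  simp only [Int.card_Icc]
  rw [Finset.prod_congr rfl (g := fun _ => 2 * n + 1) (fun k _ => by omega)]
  simp

lemma mem_bxF_one {x y : V d} : y ∈ bxF x 1 ↔ nb y x := by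
  rw [mem_bxF]; simp [bx, nb]

/-- end point and range of walks of length `m` -/
noncomputable def walkSet (x : V d) : ℕ → Finset (V d × Finset (V d))
  | 0 => {(x, {x})}
  | m + 1 => (walkSet x m).biUnion (fun yS => (bxF yS.1 1).image (fun z => (z, insert z yS.2)))

lemma card_walkSet (x : V d) (m : ℕ) : (walkSet x m).card ≤ (3 ^ d) ^ m := by
  induction m with
  | zero => simp [walkSet]
  | succ m ih =>
    rw [walkSet, pow_succ]
    refine (Finset.card_biUnion_le_card_mul _ _ (3 ^ d) ?_).trans (Nat.mul_le_mul_right _ ih)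
    intro yS _
    refine Finset.card_image_le.trans ?_
    rw [card_bxF]

lemma mem_walkSet (f : ℕ → V d) (m : ℕ) (hf : ∀ i < m, nb (f i) (f (i + 1))) :
    (f m, (Finset.range (m + 1)).image f) ∈ walkSet (f 0) m := by
  induction m with
  | zero => simp [walkSet]
  | succ m ih =>
    rw [walkSet, Finset.mem_biUnion]
    refine ⟨_, ih (fun i hi => hf i (by omega)), ?_⟩
    rw [Finset.mem_image]
    refine ⟨f (m + 1), mem_bxF_one.2 (hf m (by omega)).symm, ?_⟩
    rw [Finset.range_add_one (n := m + 1), Finset.image_insert]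

lemma exists_walk {C : Finset (V d)} (hC : SConn (C : Set (V d))) {x : V d} (hx : x ∈ C) (k : ℕ)
    (hk : k + 1 ≤ C.card) : ∃ S ⊆ C, S.card = k + 1 ∧ ∃ f : ℕ → V d, f 0 = x ∧
      (∀ i < 2 * k, nb (f i) (f (i + 1))) ∧ (Finset.range (2 * k + 1)).image f = S := by
  induction k with
  | zero =>
    refine ⟨{x}, by simpa using hx, by simp, fun _ => x, rfl, by simp, by simp⟩
  | succ k ih =>
    obtain ⟨S, hSC, hS, f, f0, hf, hfS⟩ := ih (by omega)
    obtain ⟨w, hw, hwS⟩ : ∃ w ∈ C, w ∉ S := by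
      by_contra h
      push Not at h
      have := Finset.card_le_card (show C ⊆ S from fun w hw => h w hw)
      omega
    have hxS : x ∈ S := by rw [← hfS, ← f0]; exact Finset.mem_image_of_mem _ (by simp)
    obtain ⟨y, z, hy, hyz, hz, hzS⟩ := (hC x hx w hw).exit (A := (S : Set (V d))) hxS hwS
    have hyS : y ∈ S := hy.right.2
    rw [← hfS, Finset.mem_image] at hyS
    obtain ⟨a, ha, rfl⟩ := hyS
    rw [Finset.mem_range] at ha
    refine ⟨insert z S, ?_, ?_, fun i => if i ≤ a then f i else if i = a + 1 then z else f (i - 2),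
      ?_, ?_, ?_⟩
    · rw [Finset.insert_subset_iff]; exact ⟨hz, hSC⟩
    · rw [Finset.card_insert_of_notMem hzS, hS]
    · simp [f0]
    · intro i hi
      rcases lt_trichotomy i a with h | h | h
      · have h1 : i ≤ a := by omega
        have h2 : i + 1 ≤ a := by omega
        simp only [h1, h2, if_true]; exact hf i (by omega)
      · subst h; simp [hyz]
      · have h1 : ¬ i ≤ a := by omega
        have h2 : ¬ i + 1 ≤ a := by omega
        have h3 : ¬ i + 1 = a + 1 := by omega
        by_cases h4 : i = a + 1
        · subst h4
          simp only [h1, h2, if_false, if_true, h3]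
          have : a + 1 + 1 - 2 = a := by omega
          rw [this]; exact hyz.symm
        · simp only [h1, h2, h3, h4, if_false]
          have := hf (i - 2) (by omega)
          rwa [show i - 2 + 1 = i + 1 - 2 by omega] at this
    · ext v
      rw [Finset.mem_image, Finset.mem_insert, ← hfS, Finset.mem_image]
      constructor
      · rintro ⟨i, hi, rfl⟩
        rw [Finset.mem_range] at hi
        by_cases h1 : i ≤ a
        · right; exact ⟨i, by simp; omega, by simp [h1]⟩
        · by_cases h4 : i = a + 1
          · left; simp [h4]
          · right; exact ⟨i - 2, by simp; omega, by simp [h1, h4]⟩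
      · rintro (rfl | ⟨i, hi, rfl⟩)
        · exact ⟨a + 1, by simp; omega, by simp⟩
        · rw [Finset.mem_range] at hi
          by_cases h1 : i ≤ a
          · exact ⟨i, by simp; omega, by simp [h1]⟩
          · refine ⟨i + 2, by simp; omega, ?_⟩
            have h2 : ¬ i + 2 ≤ a := by omega
            have h3 : ¬ i + 2 = a + 1 := by omega
            simp [h2, h3]

/-- a finset containing all star-connected sets of size `n` through `x` -/
noncomputable def animals (x : V d) (n : ℕ) : Finset (Finset (V d)) :=
  (walkSet x (2 * (n - 1))).image Prod.snd

lemma card_animals (x : V d) (n : ℕ) : (animals x n).card ≤ (9 ^ d) ^ n := by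
  refine Finset.card_image_le.trans ((card_walkSet x _).trans ?_)
  rw [show (9 : ℕ) = 3 ^ 2 by norm_num, ← pow_mul, ← pow_mul, ← pow_mul]
  apply Nat.pow_le_pow_right (by norm_num)
  have : d * (2 * (n - 1)) ≤ d * (2 * n) := Nat.mul_le_mul_left _ (by omega)
  nlinarith

lemma mem_animals {C : Finset (V d)} (hC : SConn (C : Set (V d))) {x : V d} (hx : x ∈ C) :
    C ∈ animals x C.card := by
  have hpos : 1 ≤ C.card := Finset.card_pos.2 ⟨x, hx⟩
  obtain ⟨S, hS, hc, f, f0, hf, hfS⟩ := exists_walk hC hx (C.card - 1) (by omega)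
  have : S = C := Finset.eq_of_subset_of_card_le hS (by omega)
  subst this
  rw [animals, Finset.mem_image]
  refine ⟨_, f0 ▸ mem_walkSet f _ hf, hfS⟩

end Counting

section Sparse
variable {d : ℕ} {Ω : Type*} [MeasurableSpace Ω]

/-- product type bound on the probability that given sites are all bad -/
def Sparse (μ : Measure Ω) (bad : V d → Set Ω) (ξ : ℝ≥0∞) : Prop :=
  ∀ D : Finset (V d), μ (⋂ i ∈ D, bad i) ≤ ξ ^ D.card

lemma sparse_of_dep {ι : Type*} {μ : Measure (ι → Bool)} [IsProbabilityMeasure μ] (hμ : IndC μ)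
    {bad : V d → Set (ι → Bool)} {T : V d → Finset ι} (hdep : ∀ i, Dep (T i) (bad i)) (k0 : ℕ)
    (hT : ∀ i j : V d, (∃ k, (k0 : ℤ) < |i k - j k|) → Disjoint (T i) (T j)) {ξ : ℝ≥0∞} (hξ : ξ ≤ 1)
    (hb : ∀ i, μ (bad i) ≤ ξ ^ ((k0 + 1) ^ d)) : Sparse μ bad ξ := by
  classical
  intro D
  let g : V d → (Fin d → Fin (k0 + 1)) := fun i k =>
    ⟨(i k % ((k0 : ℤ) + 1)).toNat, by
      have h1 := Int.emod_nonneg (i k) (show ((k0 : ℤ) + 1) ≠ 0 by omega)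
      have h2 := Int.emod_lt_of_pos (i k) (show 0 < ((k0 : ℤ) + 1) by omega)
      omega⟩
  obtain ⟨y, hy⟩ := Finite.exists_max (fun y => (D.filter (fun i => g i = y)).card)
  set D' := D.filter (fun i => g i = y) with hD'
  have hcard : D.card ≤ D'.card * (k0 + 1) ^ d := by
    have := Finset.card_le_mul_card_image (f := g) D D'.card (fun a _ => hy a)
    refine this.trans (Nat.mul_le_mul_left _ ?_)
    refine (Finset.card_le_univ _).trans ?_
    simp
  have hsep : ∀ i ∈ D', ∀ j ∈ D', i ≠ j → Disjoint (T i) (T j) := by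
    intro i hi j hj hij
    apply hT
    have hg : g i = g j := by
      rw [hD', Finset.mem_filter] at hi hj; rw [hi.2, hj.2]
    obtain ⟨k, hk⟩ : ∃ k, i k ≠ j k := by
      by_contra h; push Not at h; exact hij (funext h)
    refine ⟨k, ?_⟩
    have h1 := congrArg Fin.val (congrFun hg k)
    simp only [g] at h1
    have h2 := Int.emod_nonneg (i k) (show ((k0 : ℤ) + 1) ≠ 0 by omega)
    have h3 := Int.emod_nonneg (j k) (show ((k0 : ℤ) + 1) ≠ 0 by omega)
    have h4 : i k % ((k0 : ℤ) + 1) = j k % ((k0 : ℤ) + 1) := by omega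
    have h5 : ((k0 : ℤ) + 1) ∣ (i k - j k) := Int.ModEq.dvd (Int.ModEq.symm h4)
    have h6 := Int.le_of_dvd (abs_pos.2 (sub_ne_zero.2 hk)) ((dvd_abs _ _).2 h5)
    omega
  calc μ (⋂ i ∈ D, bad i) ≤ μ (⋂ i ∈ D', bad i) := by
        apply measure_mono
        apply Set.biInter_subset_biInter_left
        intro i hi
        exact (Finset.mem_filter.1 hi).1
    _ = ∏ i ∈ D', μ (bad i) := Dep.prod hμ D' (fun j _ => hdep j) hsep
    _ ≤ ∏ _i ∈ D', ξ ^ ((k0 + 1) ^ d) := Finset.prod_le_prod' (fun i _ => hb i)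
    _ = ξ ^ (D'.card * (k0 + 1) ^ d) := by
        rw [Finset.prod_const, ← pow_mul, mul_comm]
    _ ≤ ξ ^ D.card := pow_le_pow_right_of_le_one' hξ hcard

lemma peierls {μ : Measure Ω} {bad : V d → Set Ω} {ξ : ℝ≥0∞} (h : Sparse μ bad ξ)
    (x : V d) (n : ℕ) :
    μ {ω | ∃ C : Finset (V d), SConn (C : Set (V d)) ∧ x ∈ C ∧ C.card = n ∧ ∀ i ∈ C, ω ∈ bad i} ≤
      (9 ^ d * ξ) ^ n := by
  have hsub : {ω | ∃ C : Finset (V d), SConn (C : Set (V d)) ∧ x ∈ C ∧ C.card = n ∧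
      ∀ i ∈ C, ω ∈ bad i} ⊆ ⋃ C ∈ (animals x n).filter (fun C => C.card = n), ⋂ i ∈ C, bad i := by
    rintro ω ⟨C, hC, hx, rfl, hb⟩
    simp only [Set.mem_iUnion]
    refine ⟨C, Finset.mem_filter.2 ⟨mem_animals hC hx, rfl⟩, ?_⟩
    simpa using hb
  calc _ ≤ _ := measure_mono hsub
    _ ≤ ∑ C ∈ (animals x n).filter (fun C => C.card = n), μ (⋂ i ∈ C, bad i) :=
        measure_biUnion_finset_le _ _
    _ ≤ ∑ C ∈ (animals x n).filter (fun C => C.card = n), ξ ^ n := by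
        refine Finset.sum_le_sum fun C hC => ?_
        rw [← (Finset.mem_filter.1 hC).2]; exact h C
    _ = (((animals x n).filter (fun C => C.card = n)).card : ℝ≥0∞) * ξ ^ n := by simp
    _ ≤ (9 ^ d * ξ) ^ n := by
        rw [mul_pow]
        gcongr
        have := (Finset.card_filter_le (animals x n) (fun C => C.card = n)).trans (card_animals x n)
        exact_mod_cast this

/-- large total size of big bad disjoint clusters touching `U` -/
def bigSum (ω : Ω) (bad : V d → Set Ω) (K : ℕ) (D0 U : Finset (V d)) (t : ℕ) : Prop :=
  ∃ 𝒟 : Finset (Finset (V d)), (∀ C ∈ 𝒟, SConn (C : Set (V d)) ∧ K < C.card ∧ (∀ i ∈ C, ω ∈ bad i) ∧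
    Disjoint C D0 ∧ ∃ x ∈ U, x ∈ C) ∧ (∀ C ∈ 𝒟, ∀ C' ∈ 𝒟, C ≠ C' → Disjoint C C') ∧
    t ≤ ∑ C ∈ 𝒟, C.card

lemma bigSum_bound {μ : Measure Ω} {bad : V d → Set Ω} {ξ : ℝ≥0∞} (h : Sparse μ bad ξ)
    (K : ℕ) (U : Finset (V d)) : ∀ (D0 : Finset (V d)) (t : ℕ),
    μ ((⋂ i ∈ D0, bad i) ∩ {ω | bigSum ω bad K D0 U t}) ≤
      ξ ^ D0.card * (1 + ∑' n : ℕ, (2 * 9 ^ d * ξ) ^ (n + K + 1)) ^ U.card * (2⁻¹) ^ t := by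
  classical
  induction U using Finset.induction_on with
  | empty =>
    intro D0 t
    rcases Nat.eq_zero_or_pos t with rfl | ht
    · simp only [Finset.card_empty, pow_zero, mul_one]
      exact (measure_mono Set.inter_subset_left).trans (h D0)
    · have : {ω | bigSum ω bad K D0 ∅ t} = ∅ := by
        ext ω
        simp only [Set.mem_ofPred_eq, Set.mem_empty_iff_false, iff_false]
        rintro ⟨𝒟, h1, -, h3⟩
        have : 𝒟 = ∅ := by
          by_contra hne
          obtain ⟨C, hC⟩ := Finset.nonempty_iff_ne_empty.2 hne
          obtain ⟨-, -, -, -, x, hx, -⟩ := h1 C hC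
          simp at hx
        subst this
        simp at h3; omega
      rw [this]; simp
  | insert x U hx ih =>
    intro D0 t
    set Θ : ℝ≥0∞ := 1 + ∑' n : ℕ, (2 * 9 ^ d * ξ) ^ (n + K + 1) with hΘ
    let AN : ℕ → Finset (Finset (V d)) := fun n =>
      (animals x (n + K + 1)).filter (fun C => C.card = n + K + 1 ∧ Disjoint C D0)
    have hsub : (⋂ i ∈ D0, bad i) ∩ {ω | bigSum ω bad K D0 (insert x U) t} ⊆
        ((⋂ i ∈ D0, bad i) ∩ {ω | bigSum ω bad K D0 U t}) ∪
        ⋃ n : ℕ, ⋃ C ∈ AN n, (⋂ i ∈ D0 ∪ C, bad i) ∩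
            {ω | bigSum ω bad K (D0 ∪ C) U (t - (n + K + 1))} := by
      rintro ω ⟨hω, 𝒟, h1, h2, h3⟩
      by_cases hxC : ∃ C ∈ 𝒟, x ∈ C
      · obtain ⟨C, hC, hxC⟩ := hxC
        right
        obtain ⟨g1, g2, g3, g4, -⟩ := h1 C hC
        obtain ⟨n, hn⟩ : ∃ n, C.card = n + K + 1 := ⟨C.card - K - 1, by omega⟩
        simp only [Set.mem_iUnion]
        refine ⟨n, C, ?_, ?_, 𝒟.erase C, ?_, ?_, ?_⟩
        · rw [Finset.mem_filter]
          exact ⟨hn ▸ mem_animals g1 hxC, hn, g4⟩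
        · simp only [Set.mem_iInter, Finset.mem_union] at hω ⊢
          rintro i (hi | hi)
          · exact hω i hi
          · exact g3 i hi
        · intro C' hC'
          rw [Finset.mem_erase] at hC'
          obtain ⟨f1, f2, f3, f4, y, hy, hyC⟩ := h1 C' hC'.2
          have hdis := h2 C' hC'.2 C hC hC'.1
          refine ⟨f1, f2, f3, ?_, y, ?_, hyC⟩
          · rw [Finset.disjoint_union_right]; exact ⟨f4, hdis⟩
          · rcases Finset.mem_insert.1 hy with rfl | hy
            · exact absurd hxC (Finset.disjoint_left.1 hdis hyC)
            · exact hy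
        · intro C1 hC1 C2 hC2
          exact h2 C1 (Finset.mem_of_mem_erase hC1) C2 (Finset.mem_of_mem_erase hC2)
        · have := Finset.add_sum_erase 𝒟 Finset.card hC
          omega
      · left
        push Not at hxC
        refine ⟨hω, 𝒟, ?_, h2, h3⟩
        intro C hC
        obtain ⟨f1, f2, f3, f4, y, hy, hyC⟩ := h1 C hC
        refine ⟨f1, f2, f3, f4, y, ?_, hyC⟩
        rcases Finset.mem_insert.1 hy with rfl | hy
        · exact absurd hyC (hxC C hC)
        · exact hy
    refine (measure_mono hsub).trans ((measure_union_le _ _).trans ?_)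
    have hn : ∀ n, μ (⋃ C ∈ AN n, (⋂ i ∈ D0 ∪ C, bad i) ∩
            {ω | bigSum ω bad K (D0 ∪ C) U (t - (n + K + 1))}) ≤
        (ξ ^ D0.card * Θ ^ U.card * 2⁻¹ ^ t) * (2 * 9 ^ d * ξ) ^ (n + K + 1) := by
      intro n
      refine (measure_biUnion_finset_le _ _).trans ?_
      calc _ ≤ ∑ C ∈ AN n, ξ ^ D0.card * ξ ^ (n + K + 1) * Θ ^ U.card *
                (2⁻¹ ^ t * 2 ^ (n + K + 1)) := by
            refine Finset.sum_le_sum fun C hC => ?_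
            rw [Finset.mem_filter] at hC
            refine (ih (D0 ∪ C) _).trans ?_
            rw [Finset.card_union_of_disjoint hC.2.2.symm, hC.2.1, pow_add ξ]
            gcongr
            rcases le_total t (n + K + 1) with htn | htn
            · rw [Nat.sub_eq_zero_of_le htn, pow_zero]
              calc (1 : ℝ≥0∞) = 2⁻¹ ^ t * 2 ^ t := by
                    rw [← mul_pow, ENNReal.inv_mul_cancel (by simp) (by simp), one_pow]
                _ ≤ _ := by gcongr; norm_num
            · obtain ⟨s, rfl⟩ := Nat.exists_eq_add_of_le htn
              rw [Nat.add_sub_cancel_left, pow_add (2⁻¹ : ℝ≥0∞) (n + K + 1) s, mul_right_comm, ← mul_pow,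
                ENNReal.inv_mul_cancel (by simp) (by simp), one_pow, one_mul]
        _ = ((AN n).card : ℝ≥0∞) * (ξ ^ D0.card * ξ ^ (n + K + 1) * Θ ^ U.card *
                (2⁻¹ ^ t * 2 ^ (n + K + 1))) := by simp
        _ ≤ ((9 ^ d) ^ (n + K + 1)) * (ξ ^ D0.card * ξ ^ (n + K + 1) * Θ ^ U.card *
                (2⁻¹ ^ t * 2 ^ (n + K + 1))) := by
            gcongr
            have := (Finset.card_filter_le (animals x (n + K + 1))
              (fun C => C.card = n + K + 1 ∧ Disjoint C D0)).trans (card_animals x _)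
            exact_mod_cast this
        _ = _ := by rw [mul_pow, mul_pow]; ring
    calc _ ≤ ξ ^ D0.card * Θ ^ U.card * 2⁻¹ ^ t + ∑' n : ℕ,
          (ξ ^ D0.card * Θ ^ U.card * 2⁻¹ ^ t) * (2 * 9 ^ d * ξ) ^ (n + K + 1) :=
          add_le_add (ih D0 t) ((measure_iUnion_le _).trans (ENNReal.tsum_le_tsum hn))
      _ = _ := by
          rw [ENNReal.tsum_mul_left, Finset.card_insert_of_notMem hx, pow_succ, hΘ]
          ring

end Sparse

end Part4

section Part5

section Basics
variable {d : ℕ}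

/-- open connection inside a set -/
abbrev Lk (ω : Config d) (S : Set (V d)) (x y : V d) : Prop := LinkR (edgeOpen ω) S x y

lemma edgeOpen_symm (ω : Config d) (x y : V d) (h : edgeOpen ω x y) : edgeOpen ω y x := by
  unfold edgeOpen at *; rwa [Sym2.eq_swap]

lemma Lk.symm' {ω : Config d} {S : Set (V d)} {x y : V d} (h : Lk ω S x y) : Lk ω S y x :=
  LinkR.symm (edgeOpen_symm ω) h

lemma edgeOpen_dist {ω : Config d} {x y : V d} (h : edgeOpen ω x y) : dist1 x y = 1 := h.1

lemma dist1_comm (x y : V d) : dist1 x y = dist1 y x := by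
  unfold dist1
  exact Finset.sum_congr rfl fun i _ => by rw [← Int.natAbs_neg, neg_sub]

lemma abs_le_dist1 (x y : V d) (k : Fin d) : |x k - y k| ≤ (dist1 x y : ℤ) := by
  have : (x k - y k).natAbs ≤ dist1 x y :=
    Finset.single_le_sum (f := fun i => (x i - y i).natAbs) (fun i _ => Nat.zero_le _)
      (Finset.mem_univ k)
  rw [Int.abs_eq_natAbs]
  exact_mod_cast this

lemma dist1_le_of_bx {x y : V d} {n : ℕ} (h : y ∈ bx x n) : dist1 x y ≤ d * n := by
  unfold dist1
  calc _ ≤ ∑ _i : Fin d, n := Finset.sum_le_sum fun i _ => by have := h i; rw [abs_le] at this; omega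
    _ = d * n := by simp

lemma edgeOpen_nb {ω : Config d} {x y : V d} (h : edgeOpen ω x y) : nb x y := by
  intro k
  have := abs_le_dist1 x y k
  rw [edgeOpen_dist h] at this
  simpa using this

lemma mem_bx_self (c : V d) (n : ℕ) : c ∈ bx c n := fun k => by simp

lemma bx_mono (c : V d) {m n : ℕ} (h : m ≤ n) : bx c m ⊆ bx c n := fun x hx k =>
  (hx k).trans (by exact_mod_cast h)

lemma bx_trans {x y z : V d} {m n : ℕ} (h : y ∈ bx x m) (h' : z ∈ bx y n) : z ∈ bx x (m + n) := by
  intro k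
  have h1 := h k
  have h2 := h' k
  rw [abs_le] at *
  push_cast
  constructor <;> linarith [h1.1, h1.2, h2.1, h2.2]

lemma bx_symm {x y : V d} {m : ℕ} (h : y ∈ bx x m) : x ∈ bx y m := fun k => by
  rw [abs_sub_comm]; exact h k

lemma bx_subset {x y : V d} {m n l : ℕ} (h : y ∈ bx x m) (hl : m + n ≤ l) : bx y n ⊆ bx x l :=
  fun _ hz => bx_mono x hl (bx_trans h hz)

lemma path_bx {ω : Config d} {n : ℕ} {f : ℕ → V d} (hf : IsOpenPath ω n f) {i : ℕ} (hi : i ≤ n) :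
    f i ∈ bx (f 0) i := by
  induction i with
  | zero => exact mem_bx_self _ _
  | succ i ih =>
    refine bx_trans (ih (by omega)) ?_
    have := edgeOpen_nb (hf i (by omega))
    intro k
    rw [abs_sub_comm]; simpa using this k

lemma connected_iff_path {ω : Config d} {x y : V d} :
    Connected ω x y ↔ ∃ (n : ℕ) (f : ℕ → V d), IsOpenPath ω n f ∧ f 0 = x ∧ f n = y := by
  unfold Connected chemDist
  constructor
  · intro h
    by_contra hne
    apply h
    have : {r : ℝ≥0∞ | ∃ (n : ℕ) (f : ℕ → V d), IsOpenPath ω n f ∧ f 0 = x ∧ f n = y ∧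
        r = (n : ℝ≥0∞)} = ∅ := by
      ext r
      simp only [Set.mem_ofPred_eq, Set.mem_empty_iff_false, iff_false]
      rintro ⟨n, f, h1, h2, h3, -⟩
      exact hne ⟨n, f, h1, h2, h3⟩
    rw [this, sInf_empty]
  · rintro ⟨n, f, h1, h2, h3⟩ h
    have : sInf {r : ℝ≥0∞ | ∃ (n : ℕ) (f : ℕ → V d), IsOpenPath ω n f ∧ f 0 = x ∧ f n = y ∧
        r = (n : ℝ≥0∞)} ≤ n := sInf_le ⟨n, f, h1, h2, h3, rfl⟩
    rw [h] at this
    simp at this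

lemma connected_iff {ω : Config d} {x y : V d} : Connected ω x y ↔ Lk ω Set.univ x y := by
  rw [connected_iff_path]
  constructor
  · rintro ⟨n, f, h1, rfl, rfl⟩
    exact LinkR.of_path n f h1 (fun _ _ => trivial)
  · intro h
    obtain ⟨n, f, h1, -, h2, h3⟩ := h.path
    exact ⟨n, f, h1, h2, h3⟩

lemma chemDist_le {ω : Config d} {n : ℕ} {f : ℕ → V d} (h : IsOpenPath ω n f) :
    chemDist ω (f 0) (f n) ≤ n := sInf_le ⟨n, f, h, rfl, rfl, rfl⟩

lemma exists_geodesic {ω : Config d} {x y : V d} (h : Connected ω x y) :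
    ∃ (n : ℕ) (f : ℕ → V d), IsOpenPath ω n f ∧ f 0 = x ∧ f n = y ∧ chemDist ω x y = n := by
  classical
  rw [connected_iff_path] at h
  obtain ⟨f, h1, h2, h3⟩ := Nat.find_spec h
  refine ⟨Nat.find h, f, h1, h2, h3, le_antisymm (sInf_le ⟨_, f, h1, h2, h3, rfl⟩) ?_⟩
  refine le_sInf ?_
  rintro r ⟨m, g, g1, g2, g3, rfl⟩
  exact_mod_cast Nat.find_min' h ⟨g, g1, g2, g3⟩

/-- connected by a path of at most `a` edges -/
def distLe (ω : Config d) (x y : V d) (a : ℝ) : Prop :=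
  ∃ (n : ℕ) (f : ℕ → V d), (n : ℝ) ≤ a ∧ IsOpenPath ω n f ∧ f 0 = x ∧ f n = y

lemma distLe_of_toReal {ω : Config d} {x y : V d} {a : ℝ} (h : Connected ω x y)
    (ha : (chemDist ω x y).toReal ≤ a) : distLe ω x y a := by
  obtain ⟨n, f, h1, h2, h3, h4⟩ := exists_geodesic h
  rw [h4] at ha
  exact ⟨n, f, by simpa using ha, h1, h2, h3⟩

lemma toReal_le_of_distLe {ω : Config d} {x y : V d} {a : ℝ} (h : distLe ω x y a) :
    (chemDist ω x y).toReal ≤ a := by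
  obtain ⟨n, f, h0, h1, rfl, rfl⟩ := h
  refine le_trans ?_ h0
  have := ENNReal.toReal_mono (by simp) (chemDist_le h1)
  simpa using this

lemma distLe.connected {ω : Config d} {x y : V d} {a : ℝ} (h : distLe ω x y a) :
    Connected ω x y := by
  obtain ⟨n, f, -, h1, h2, h3⟩ := h
  exact connected_iff_path.2 ⟨n, f, h1, h2, h3⟩

lemma distLe.lk {ω : Config d} {x y : V d} {a : ℝ} (h : distLe ω x y a) {N : ℕ} (hN : a ≤ N) :
    Lk ω (bx x N) x y := by
  obtain ⟨n, f, h0, h1, rfl, rfl⟩ := h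
  have hn : n ≤ N := by exact_mod_cast h0.trans hN
  exact LinkR.of_path n f h1 (fun i hi => bx_mono _ (hi.trans hn) (path_bx h1 hi))

/-- edges inside a finite set of vertices -/
def edgesIn (S : Finset (V d)) : Finset (Edge d) :=
  Finset.subtype (fun e => sym2dist1 e = 1) S.sym2

lemma mem_edgesIn {S : Finset (V d)} {e : Edge d} : e ∈ edgesIn S ↔ e.1 ∈ S.sym2 := by
  unfold edgesIn
  exact Finset.mem_subtype

lemma edgeOpen_congr {ω ω' : Config d} {S : Finset (V d)} (h : ∀ e ∈ edgesIn S, ω e = ω' e)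
    {x y : V d} (hx : x ∈ S) (hy : y ∈ S) (ho : edgeOpen ω x y) : edgeOpen ω' x y := by
  obtain ⟨h1, h2⟩ := ho
  refine ⟨h1, ?_⟩
  exact (h _ (mem_edgesIn.2 (by simp [hx, hy]))).symm.trans h2

lemma lk_dep (S : Finset (V d)) (x y : V d) : Dep (edgesIn S) {ω : Config d | Lk ω S x y} :=
  fun _ _ h hω => LinkR.monoR (fun _ ha _ hb hab => edgeOpen_congr h ha hb hab) hω

lemma distLe_dep (x y : V d) (a : ℝ) :
    Dep (edgesIn (bxF x ⌊a⌋₊)) {ω : Config d | distLe ω x y a} := by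
  rintro ω ω' h ⟨n, f, h0, h1, rfl, rfl⟩
  refine ⟨n, f, h0, fun i hi => ?_, rfl, rfl⟩
  have hn : n ≤ ⌊a⌋₊ := Nat.le_floor h0
  refine edgeOpen_congr h ?_ ?_ (h1 i hi)
  · exact mem_bxF.2 (bx_mono _ (by omega) (path_bx h1 hi.le))
  · exact mem_bxF.2 (bx_mono _ (by omega) (path_bx h1 hi))

lemma lk_univ_box {ω : Config d} {x y : V d} (c : V d) (h : Lk ω Set.univ x y) :
    ∃ N, ∀ n, N ≤ n → Lk ω (bx c n) x y := by
  obtain ⟨m, f, h1, -, rfl, rfl⟩ := h.path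
  refine ⟨dist1 c (f 0) + m, fun n hn => LinkR.of_path m f h1 (fun i hi => ?_)⟩
  have h0 : f 0 ∈ bx c (dist1 c (f 0)) := fun k => by
    rw [abs_sub_comm]; exact abs_le_dist1 _ _ k
  exact bx_mono c (by omega) (bx_trans h0 (path_bx h1 hi))

lemma measurable_connected (x y : V d) : MeasurableSet {ω : Config d | Connected ω x y} := by
  have : {ω : Config d | Connected ω x y} = ⋃ N : ℕ, {ω : Config d | Lk ω (bxF 0 N : Finset (V d)) x y} := by
    ext ω
    simp only [Set.mem_ofPred_eq, Set.mem_iUnion, connected_iff]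
    constructor
    · intro h
      obtain ⟨N, hN⟩ := lk_univ_box 0 h
      exact ⟨N, by rw [coe_bxF]; exact hN N le_rfl⟩
    · rintro ⟨N, hN⟩; exact hN.mono (Set.subset_univ _)
  rw [this]
  exact MeasurableSet.iUnion fun N => (lk_dep _ _ _).measurableSet

/-- the cluster of `x` leaves the sup-ball of radius `R` around `x` -/
def Large (ω : Config d) (R : ℕ) (x : V d) : Prop :=
  ∃ y, y ∉ bx x R ∧ Lk ω (bx x (R + 1)) x y

lemma large_dep (R : ℕ) (x : V d) :
    Dep (edgesIn (bxF x (R + 1))) {ω : Config d | Large ω R x} := by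
  rintro ω ω' h ⟨y, hy, hl⟩
  refine ⟨y, hy, ?_⟩
  have := lk_dep (bxF x (R + 1)) x y ω ω' h
  simp only [Set.mem_ofPred_eq, coe_bxF] at this
  exact this hl

lemma large_of_lk {ω : Config d} {S : Set (V d)} {R : ℕ} {x y : V d} (h : Lk ω S x y)
    (hy : y ∉ bx x R) : Large ω R x := by
  obtain ⟨a, b, h1, h2, h3, h4⟩ := h.exit (mem_bx_self x R) hy
  refine ⟨b, h4, (h1.mono fun z hz => bx_mono x (by omega) hz.2).tail h2 ?_⟩
  refine bx_trans h1.right.2 ?_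
  have := (edgeOpen_nb h2).symm
  intro k
  simpa using this k

lemma Large.anti {ω : Config d} {R R' : ℕ} {x : V d} (h : Large ω R x) (hR : R' ≤ R) :
    Large ω R' x := by
  obtain ⟨y, hy, hl⟩ := h
  exact large_of_lk hl (fun h => hy (bx_mono x hR h))

lemma bx_finite (c : V d) (n : ℕ) : (bx c n).Finite := by
  rw [← coe_bxF]; exact (bxF c n).finite_toSet

lemma infinite_iff {ω : Config d} {x : V d} : InInfiniteCluster ω x ↔ ∀ R, Large ω R x := by
  unfold InInfiniteCluster
  constructor
  · intro h R
    obtain ⟨y, hy, hyR⟩ := h.exists_notMem_finite (bx_finite x R)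
    exact large_of_lk (connected_iff.1 hy) hyR
  · intro h hfin
    have : ∃ R, cluster ω x ⊆ bx x R := by
      refine ⟨hfin.toFinset.sup (fun y => dist1 y x), fun y hy k => ?_⟩
      refine (abs_le_dist1 y x k).trans ?_
      exact_mod_cast Finset.le_sup (f := fun y => dist1 y x) (hfin.mem_toFinset.2 hy)
    obtain ⟨R, hR⟩ := this
    obtain ⟨y, hy, hl⟩ := h R
    exact hy (hR (connected_iff.2 (hl.mono (Set.subset_univ _))))

lemma measurable_infinite (x : V d) : MeasurableSet {ω : Config d | InInfiniteCluster ω x} := by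
  have : {ω : Config d | InInfiniteCluster ω x} = ⋂ R : ℕ, {ω : Config d | Large ω R x} := by
    ext ω; simp [infinite_iff]
  rw [this]
  exact MeasurableSet.iInter fun N => (large_dep _ _).measurableSet

lemma infinite_mono {ω ω' : Config d} (h : ∀ e, ω e = true → ω' e = true) {x : V d}
    (hx : InInfiniteCluster ω x) : InInfiniteCluster ω' x := by
  rw [infinite_iff] at *
  intro R
  obtain ⟨y, hy, hl⟩ := hx R
  exact ⟨y, hy, hl.monoR (fun a _ b _ hab => ⟨hab.1, h _ hab.2⟩)⟩

/-! translations -/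

/-- translation of edges -/
def trE (v : V d) (e : Edge d) : Edge d := ⟨Sym2.map (fun x => x + v) e.1, by
  obtain ⟨e, he⟩ := e
  induction e using Sym2.ind with
  | _ x y =>
    simp only [Sym2.map_mk, sym2dist1, Sym2.lift_mk, dist1, Pi.add_apply, add_sub_add_right_eq_sub] at *
    exact he⟩

lemma trE_inj (v : V d) : Function.Injective (trE v) := by
  intro e e' h
  have h1 : Sym2.map (fun x => x + v) e.1 = Sym2.map (fun x => x + v) e'.1 := congrArg Subtype.val h
  exact Subtype.ext (Sym2.map.injective (add_left_injective v) h1)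

/-- translated configuration -/
def tr (v : V d) (ω : Config d) : Config d := fun e => ω (trE v e)

lemma edgeOpen_tr (v : V d) (ω : Config d) (x y : V d) :
    edgeOpen (tr v ω) x y ↔ edgeOpen ω (x + v) (y + v) := by
  unfold edgeOpen openE tr trE
  have : sym2dist1 s(x, y) = sym2dist1 s(x + v, y + v) := by
    simp [sym2dist1, dist1]
  constructor
  · rintro ⟨h1, h2⟩
    exact ⟨this ▸ h1, h2⟩
  · rintro ⟨h1, h2⟩
    exact ⟨this.symm ▸ h1, h2⟩

lemma tr_tr (u v : V d) (ω : Config d) : tr u (tr v ω) = tr (u + v) ω := by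
  funext e
  unfold tr
  congr 1
  apply Subtype.ext
  simp only [trE, Sym2.map_map]
  congr 1
  funext x; simp [add_assoc]

lemma tr_zero (ω : Config d) : tr 0 ω = ω := by
  funext e
  unfold tr
  congr 1
  apply Subtype.ext
  simp [trE]

lemma tr_iterate (v : V d) (n : ℕ) (ω : Config d) : (tr v)^[n] ω = tr (n • v) ω := by
  induction n with
  | zero => simp [tr_zero]
  | succ n ih => rw [Function.iterate_succ_apply', ih, tr_tr, succ_nsmul']

lemma tr_mp (p : ℝ) (v : V d) : MeasurePreserving (tr v) (BP (fun _ : Edge d => p)) (BP (fun _ => p)) :=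
  ⟨by unfold tr; fun_prop, BP_reindex (trE v) (trE_inj v) (fun _ => p)⟩

lemma lk_tr {v : V d} {ω : Config d} {S : Set (V d)} {x y : V d} (h : Lk (tr v ω) S x y) :
    Lk ω ((fun z => z + v) '' S) (x + v) (y + v) :=
  LinkR.map (fun z => z + v) (fun _ ha => Set.mem_image_of_mem _ ha)
    (fun _ _ hab => (edgeOpen_tr v ω _ _).1 hab) h

lemma bx_add (c v : V d) (n : ℕ) : (fun z => z + v) '' bx c n = bx (c + v) n := by
  ext z
  constructor
  · rintro ⟨w, hw, rfl⟩ k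
    simpa using hw k
  · intro hz
    refine ⟨z - v, fun k => ?_, by simp⟩
    have := hz k
    simp only [Pi.add_apply] at this
    simpa [sub_sub, add_comm] using this

lemma mem_bx_add (c v x : V d) (n : ℕ) : x + v ∈ bx (c + v) n ↔ x ∈ bx c n := by
  simp [bx]

lemma lk_tr_bx {v : V d} {ω : Config d} {c : V d} {n : ℕ} {x y : V d} :
    Lk (tr v ω) (bx c n) x y ↔ Lk ω (bx (c + v) n) (x + v) (y + v) := by
  constructor
  · intro h
    have := lk_tr h
    rwa [bx_add] at this
  · intro h
    have : Lk (tr (-v) (tr v ω)) (bx (c + v) n) (x + v) (y + v) := by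
      rw [tr_tr]; simpa [tr_zero] using h
    have := lk_tr this
    rw [bx_add] at this
    simpa using this

lemma large_tr {v : V d} {ω : Config d} {R : ℕ} {x : V d} :
    Large (tr v ω) R x ↔ Large ω R (x + v) := by
  constructor
  · rintro ⟨y, hy, h⟩
    exact ⟨y + v, by rwa [mem_bx_add], lk_tr_bx.1 h⟩
  · rintro ⟨y, hy, h⟩
    refine ⟨y - v, ?_, lk_tr_bx.2 (by simpa using h)⟩
    rw [← mem_bx_add x v]; simpa using hy

lemma infinite_tr {v : V d} {ω : Config d} {x : V d} :
    InInfiniteCluster (tr v ω) x ↔ InInfiniteCluster ω (x + v) := by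
  simp only [infinite_iff, large_tr]

lemma distLe_tr {v : V d} {ω : Config d} {x y : V d} {a : ℝ} (h : distLe (tr v ω) x y a) :
    distLe ω (x + v) (y + v) a := by
  obtain ⟨n, f, h0, h1, rfl, rfl⟩ := h
  exact ⟨n, fun i => f i + v, h0, fun i hi => (edgeOpen_tr v ω _ _).1 (h1 i hi), rfl, rfl⟩

/-! regularized points -/

lemma dist1_eq_zero {x y : V d} (h : dist1 x y = 0) : x = y := by
  funext k
  have := abs_le_dist1 x y k
  rw [h] at this
  have := abs_nonpos_iff.1 this
  omega

lemma dist1_self (x : V d) : dist1 x x = 0 := by simp [dist1]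

lemma regPoint_spec {ω : Config d} (x : V d) {y : V d} (hy : InInfiniteCluster ω y) :
    InInfiniteCluster ω (regPoint ω x) ∧
      ∀ z, InInfiniteCluster ω z → dist1 x (regPoint ω x) ≤ dist1 x z := by
  classical
  have hne : {y | InInfiniteCluster ω y}.Nonempty := ⟨y, hy⟩
  have h : ∃ y : V d, InInfiniteCluster ω y ∧
      ∀ z : V d, InInfiniteCluster ω z → dist1 x y ≤ dist1 x z := by
    let m := Function.argminOn (fun z => dist1 x z) {y | InInfiniteCluster ω y} hne
    exact ⟨m, Function.argminOn_mem _ _ hne, fun z hz => Function.argminOn_le _ _ hz⟩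
  unfold regPoint
  rw [dif_pos h]
  exact h.choose_spec

lemma regPoint_self {ω : Config d} {x : V d} (hx : InInfiniteCluster ω x) : regPoint ω x = x := by
  have := (regPoint_spec x hx).2 x hx
  rw [dist1_self] at this
  exact (dist1_eq_zero (by omega)).symm

lemma regPoint_none {ω : Config d} {x : V d} (h : ∀ y, ¬ InInfiniteCluster ω y) :
    regPoint ω x = x := by
  unfold regPoint
  rw [dif_neg]
  rintro ⟨y, hy, -⟩
  exact h y hy

end Basics

end Part5

section Part6

section Facts
variable {d : ℕ}

/-- Bernoulli percolation measure -/
noncomputable abbrev PB (d : ℕ) (p : ℝ) : Measure (Config d) := BP (fun _ : Edge d => p)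

lemma toReal_pos_connected {ω : Config d} {x y : V d} (h : 0 < (chemDist ω x y).toReal) :
    Connected ω x y := by
  intro h'
  rw [h'] at h
  simp at h

lemma exists_vec_ne_zero (hd : 2 ≤ d) : ∃ v : V d, v ≠ 0 := by
  refine ⟨fun _ => 1, fun h => ?_⟩
  have := congrFun h ⟨0, by omega⟩
  simp at this

lemma nsmul_inj {v : V d} (hv : v ≠ 0) : Function.Injective (fun n : ℕ => n • v) := by
  intro a b hab
  obtain ⟨k, hk⟩ : ∃ k, v k ≠ 0 := by
    by_contra h; push Not at h; exact hv (funext h)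
  have := congrFun hab k
  simp only [Pi.smul_apply, nsmul_eq_mul] at this
  exact_mod_cast mul_right_cancel₀ hk this

lemma eventually_pos {f : ℕ → ℝ} {t : ℝ} (ht : 0 < t)
    (h : Tendsto (fun n : ℕ => f n / n) atTop (𝓝 t)) : ∀ᶠ n in atTop, 0 < f n := by
  filter_upwards [h.eventually_const_lt ht] with n hn
  by_contra hf
  push Not at hf
  exact absurd hn (not_lt.2 (div_nonpos_of_nonpos_of_nonneg hf (Nat.cast_nonneg n)))

variable {p : ℝ} {t : V d → ℝ}

/-- F1 : existence of an infinite cluster -/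
lemma exists_infinite (hd : 2 ≤ d) (ht : ASTimeConstant (PB d p) t) (hpos : ∀ x ≠ 0, 0 < t x) :
    ∀ᵐ ω ∂(PB d p), ∃ y, InInfiniteCluster ω y := by
  obtain ⟨v, hv⟩ := exists_vec_ne_zero hd
  filter_upwards [ht v] with ω hω
  by_contra hno
  push Not at hno
  simp only [DReg, regPoint_none hno] at hω
  obtain ⟨N, hN⟩ := eventually_atTop.1 (eventually_pos (hpos v hv) hω)
  apply hno 0
  have hsub : (fun n : ℕ => n • v) '' Set.Ici N ⊆ cluster ω 0 := by
    rintro _ ⟨n, hn, rfl⟩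
    exact toReal_pos_connected (hN n hn)
  exact ((Set.Ici_infinite N).image (nsmul_inj hv).injOn).mono hsub

lemma infinite_prob (p : ℝ) (x : V d) : PB d p {ω | InInfiniteCluster ω x} =
    PB d p {ω | InInfiniteCluster ω 0} := by
  rw [← (tr_mp p x).measure_preimage (measurable_infinite 0).nullMeasurableSet]
  congr 1; ext ω
  simp [infinite_tr]

lemma theta_pos (hd : 2 ≤ d) (ht : ASTimeConstant (PB d p) t) (hpos : ∀ x ≠ 0, 0 < t x) :
    0 < PB d p {ω | InInfiniteCluster ω 0} := by
  rw [pos_iff_ne_zero]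
  intro h0
  have : PB d p (⋃ y : V d, {ω | InInfiniteCluster ω y}) = 0 := by
    rw [measure_iUnion_null_iff]
    intro y; rw [infinite_prob, h0]
  have h1 : PB d p (⋃ y : V d, {ω | InInfiniteCluster ω y}) = 1 := by
    rw [← measure_univ (μ := PB d p)]
    apply measure_congr
    filter_upwards [exists_infinite hd ht hpos] with ω hω
    exact propext ⟨fun _ => trivial, fun _ => Set.mem_iUnion.2 hω⟩
  rw [h1] at this
  simp at this

lemma ae_tr {q : Config d → Prop} (v : V d) (h : ∀ᵐ ω ∂(PB d p), q ω) :
    ∀ᵐ ω ∂(PB d p), q (tr v ω) :=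
  (tr_mp p v).quasiMeasurePreserving.ae h

/-- F4 : uniqueness of the infinite cluster -/
lemma unique_infinite (ht : ASTimeConstant (PB d p) t) (hpos : ∀ x ≠ 0, 0 < t x) :
    ∀ᵐ ω ∂(PB d p), ∀ u v, InInfiniteCluster ω u → InInfiniteCluster ω v → Connected ω u v := by
  have h0 : ∀ v : V d, v ≠ 0 → ∀ᵐ ω ∂(PB d p), InInfiniteCluster ω 0 → InInfiniteCluster ω v →
      Connected ω 0 v := by
    intro v hv
    have hrec := (tr_mp p v).conservative.ae_mem_imp_frequently_image_mem
      (measurable_infinite (0 : V d)).nullMeasurableSet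
    filter_upwards [ht v, ae_tr v (ht v), hrec] with ω h1 h2 h3 hi0 hiv
    have e1 := eventually_pos (hpos v hv) h1
    have e2 := eventually_pos (hpos v hv) h2
    have h3' := h3 hi0
    obtain ⟨N1, hN1⟩ := eventually_atTop.1 e1
    obtain ⟨N2, hN2⟩ := eventually_atTop.1 e2
    obtain ⟨n, hn, hinf⟩ := (frequently_atTop.1 h3') (max N1 (N2 + 1))
    rw [tr_iterate] at hinf
    simp only [Set.mem_ofPred_eq, infinite_tr, zero_add] at hinf
    have c1 := hN1 n ((le_max_left _ _).trans hn)
    have hn2 : N2 + 1 ≤ n := (le_max_right _ _).trans hn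
    obtain ⟨m, rfl⟩ : ∃ m, n = m + 1 := ⟨n - 1, by omega⟩
    have c2 := hN2 m (by omega)
    unfold DReg at c1 c2
    rw [regPoint_self hi0, regPoint_self hinf] at c1
    rw [regPoint_self (infinite_tr.2 (by simpa using hiv)),
      regPoint_self (infinite_tr.2 (by rwa [succ_nsmul] at hinf))] at c2
    have c1' := connected_iff.1 (toReal_pos_connected c1)
    have c2' := lk_tr (connected_iff.1 (toReal_pos_connected c2))
    rw [connected_iff]
    refine c1'.trans ?_
    rw [succ_nsmul]
    simpa using LinkR.mono (Set.subset_univ _) c2'.symm'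
  rw [ae_all_iff]; intro u
  rw [ae_all_iff]; intro v
  by_cases huv : u = v
  · subst huv
    refine Eventually.of_forall fun ω _ _ => connected_iff.2 (LinkR.refl trivial)
  · filter_upwards [ae_tr u (h0 (v - u) (sub_ne_zero.2 (Ne.symm huv)))] with ω h hu hv
    have := h (infinite_tr.2 (by simpa using hu)) (infinite_tr.2 (by simpa using hv))
    have := lk_tr (connected_iff.1 this)
    rw [connected_iff]
    simpa using this.mono (Set.subset_univ _)

/-- F2 upper bound -/
lemma upper_tendsto (ht : ASTimeConstant (PB d p) t) (x : V d) (hx : 0 < t x) {δ : ℝ} (hδ : 0 < δ) :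
    Tendsto (fun n : ℕ => PB d p {ω | InInfiniteCluster ω 0 ∧ InInfiniteCluster ω (n • x) ∧
      ¬ distLe ω 0 (n • x) (n * (t x + δ))}) atTop (𝓝 0) := by
  apply ev_tendsto
  · intro n
    exact (measurable_infinite _).inter ((measurable_infinite _).inter
      (distLe_dep _ _ _).measurableSet.compl)
  · filter_upwards [ht x] with ω hω
    filter_upwards [eventually_pos hx hω, hω.eventually_lt_const (show t x < t x + δ by linarith),
      eventually_gt_atTop 0] with n h1 h2 h3
    rintro ⟨i1, i2, i3⟩
    apply i3
    unfold DReg at h1 h2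
    rw [regPoint_self i1, regPoint_self i2] at h1 h2
    have : (0 : ℝ) < n := by exact_mod_cast h3
    rw [div_lt_iff₀ this] at h2
    exact distLe_of_toReal (toReal_pos_connected h1) (by linarith)

/-- F2 lower bound -/
lemma lower_tendsto (ht : ASTimeConstant (PB d p) t) (x : V d) {δ : ℝ} (hδ : 0 < δ) :
    Tendsto (fun n : ℕ => PB d p {ω | InInfiniteCluster ω 0 ∧ InInfiniteCluster ω (n • x) ∧
      distLe ω 0 (n • x) (n * (t x - δ))}) atTop (𝓝 0) := by
  apply ev_tendsto
  · intro n
    exact (measurable_infinite _).inter ((measurable_infinite _).inter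
      (distLe_dep _ _ _).measurableSet)
  · filter_upwards [ht x] with ω hω
    filter_upwards [hω.eventually_const_lt (show t x - δ < t x by linarith),
      eventually_gt_atTop 0] with n h2 h3
    rintro ⟨i1, i2, i3⟩
    unfold DReg at h2
    rw [regPoint_self i1, regPoint_self i2] at h2
    have : (0 : ℝ) < n := by exact_mod_cast h3
    rw [lt_div_iff₀ this] at h2
    have := toReal_le_of_distLe i3
    linarith

/-- second moment type bound -/
lemma second_moment {Ω : Type*} [MeasurableSpace Ω] (μ : Measure Ω) [IsProbabilityMeasure μ]
    (A : ℕ → Set Ω) (hA : ∀ k, MeasurableSet (A k)) (θ : ℝ) (hθ : 0 < θ) (hAθ : ∀ k, θ ≤ μ.real (A k)) (m : ℕ)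
    (hm : 2 ≤ m * θ) : ∃ j k, j < k ∧ 1 / (m : ℝ) ^ 2 ≤ μ.real (A j ∩ A k) := by
  by_contra hcon
  push Not at hcon
  have hm0 : 0 < m := by
    rcases Nat.eq_zero_or_pos m with rfl | h
    · simp at hm; linarith
    · exact h
  have hmR : (0 : ℝ) < m := by exact_mod_cast hm0
  let B : ℕ → Set Ω := fun k => A k \ ⋃ j ∈ Finset.range k, A j
  have hB : ∀ k, MeasurableSet (B k) := fun k =>
    (hA k).diff (Finset.measurableSet_biUnion _ fun j _ => hA j)
  have hdis : ∀ j k, j < k → Disjoint (B j) (B k) := by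
    intro j k hjk
    rw [Set.disjoint_left]
    rintro ω ⟨h1, -⟩ ⟨-, h2⟩
    apply h2
    simp only [Set.mem_iUnion, Finset.mem_range]
    exact ⟨j, hjk, h1⟩
  have hBk : ∀ k ∈ Finset.range m, θ - k * (1 / (m : ℝ) ^ 2) ≤ μ.real (B k) := by
    intro k hk
    have h1 : μ.real (A k) ≤ μ.real (B k) + μ.real (⋃ j ∈ Finset.range k, A j ∩ A k) := by
      refine (measureReal_mono ?_).trans (measureReal_union_le _ _)
      intro ω hω
      by_cases h : ω ∈ ⋃ j ∈ Finset.range k, A j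
      · right
        simp only [Set.mem_iUnion] at h ⊢
        obtain ⟨j, hj, h⟩ := h
        exact ⟨j, hj, h, hω⟩
      · left; exact ⟨hω, h⟩
    have h2 : μ.real (⋃ j ∈ Finset.range k, A j ∩ A k) ≤ k * (1 / (m : ℝ) ^ 2) := by
      refine (measureReal_biUnion_finset_le _ _).trans ?_
      calc _ ≤ ∑ j ∈ Finset.range k, 1 / (m : ℝ) ^ 2 :=
            Finset.sum_le_sum fun j hj => (hcon j k (Finset.mem_range.1 hj)).le
        _ = _ := by simp
    linarith [hAθ k]
  have hsum : ∑ k ∈ Finset.range m, μ.real (B k) ≤ 1 := by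
    rw [← measureReal_biUnion_finset]
    · exact measureReal_le_one
    · intro i _ j _ hij
      rcases lt_or_gt_of_ne hij with h | h
      · exact hdis i j h
      · exact (hdis j i h).symm
    · intro k _; exact hB k
  have h3 : ∑ k ∈ Finset.range m, (θ - 1 / m) ≤ ∑ k ∈ Finset.range m, μ.real (B k) := by
    refine Finset.sum_le_sum fun k hk => le_trans ?_ (hBk k hk)
    have : (k : ℝ) ≤ m := by exact_mod_cast (Finset.mem_range.1 hk).le
    have : (k : ℝ) * (1 / (m : ℝ) ^ 2) ≤ m * (1 / (m : ℝ) ^ 2) := by gcongr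
    have e : (m : ℝ) * (1 / (m : ℝ) ^ 2) = 1 / m := by field_simp
    linarith
  have h4 : ∑ k ∈ Finset.range m, (θ - 1 / (m : ℝ)) = m * θ - 1 := by
    simp only [Finset.sum_const, Finset.card_range, nsmul_eq_mul]
    field_simp
  -- strictness
  have h5 : ∑ k ∈ Finset.range m, (θ - 1 / (m : ℝ)) < ∑ k ∈ Finset.range m, μ.real (B k) := by
    refine Finset.sum_lt_sum (fun k hk => le_trans ?_ (hBk k hk)) ⟨0, by simpa using hm0, ?_⟩
    · have : (k : ℝ) ≤ m := by exact_mod_cast (Finset.mem_range.1 hk).le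
      have : (k : ℝ) * (1 / (m : ℝ) ^ 2) ≤ m * (1 / (m : ℝ) ^ 2) := by gcongr
      have e : (m : ℝ) * (1 / (m : ℝ) ^ 2) = 1 / m := by field_simp
      linarith
    · have := hBk 0 (by simpa using hm0)
      have hp : 0 < 1 / (m : ℝ) := by positivity
      simp at this
      linarith
  linarith

/-- infinitely many `n` such that `0` and `n x` both lie in the infinite cluster with a
probability bounded below -/
lemma two_point (p θ : ℝ) (hθ : 0 < θ) (h : θ ≤ (PB d p).real {ω | InInfiniteCluster ω 0}) (x : V d)
    (m : ℕ) (hm : 2 ≤ m * θ) (n0 : ℕ) (hn0 : 1 ≤ n0) : ∃ n, n0 ≤ n ∧ 1 / (m : ℝ) ^ 2 ≤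
      (PB d p).real {ω | InInfiniteCluster ω 0 ∧ InInfiniteCluster ω (n • x)} := by
  obtain ⟨j, k, hjk, h2⟩ := second_moment (PB d p)
    (fun k => {ω | InInfiniteCluster ω ((k * n0) • x)}) (fun k => measurable_infinite _) θ hθ
    (fun k => by
      rw [Measure.real, infinite_prob]; exact h) m hm
  obtain ⟨i, rfl⟩ := Nat.exists_eq_add_of_lt hjk
  refine ⟨(i + 1) * n0, Nat.le_mul_of_pos_left _ (by omega), h2.trans (le_of_eq ?_)⟩
  have hm : MeasurableSet {ω : Config d | InInfiniteCluster ω 0 ∧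
      InInfiniteCluster ω (((i + 1) * n0) • x)} :=
    (measurable_infinite _).inter (measurable_infinite _)
  rw [Measure.real, Measure.real, ← (tr_mp p ((j * n0) • x)).measure_preimage hm.nullMeasurableSet]
  congr 2; ext ω
  simp only [Set.mem_inter_iff, Set.mem_ofPred_eq, Set.mem_preimage, infinite_tr, zero_add]
  rw [← add_nsmul]
  have : (i + 1) * n0 + j * n0 = (j + i + 1) * n0 := by ring
  rw [this]

end Facts

end Part6

section Part7

variable {d : ℕ}

def ctr (L : ℕ) (i : V d) : V d := fun k => (L : ℤ) * i k

lemma ctr_zero (L : ℕ) : ctr L (0 : V d) = 0 := by funext k; simp [ctr]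

lemma ctr_add (L : ℕ) (i j : V d) : ctr L (i + j) = ctr L i + ctr L j := by
  funext k; simp [ctr, mul_add]

lemma ctr_smul (L : ℕ) (i : V d) : ctr L i = L • i := by
  funext k; simp [ctr]

lemma ctr_nb {L : ℕ} {i j : V d} (h : nb i j) : ctr L j ∈ bx (ctr L i) L := by
  intro k
  have := h k
  simp only [ctr, ← mul_sub, abs_mul, Nat.abs_cast]
  rw [abs_sub_comm] at this
  have hL : (0 : ℤ) ≤ L := by positivity
  nlinarith

lemma large_agree {ω ω' : Config d} {S : Finset (V d)} (h : ∀ e ∈ edgesIn S, ω e = ω' e) {R : ℕ} {x : V d}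
    (hx : bx x (R + 1) ⊆ S) : Large ω R x → Large ω' R x := by
  rintro ⟨y, hy, hl⟩
  exact ⟨y, hy, hl.monoR fun a ha b hb hab => edgeOpen_congr h (hx ha) (hx hb) hab⟩

lemma lk_agree {ω ω' : Config d} {S : Finset (V d)} (h : ∀ e ∈ edgesIn S, ω e = ω' e) {A : Set (V d)}
    (hA : A ⊆ S) {x y : V d} (hl : Lk ω A x y) : Lk ω' A x y :=
  hl.monoR fun _ ha _ hb hab => edgeOpen_congr h (hA ha) (hA hb) hab

/-- good sites at scale `L = 2 r + 1` -/
structure Good (r C s : ℕ) (a : Config d) (i : V d) : Prop where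
  ex : ∃ u ∈ bx (ctr (2 * r + 1) i) s, Large a r u
  uniq : ∀ u ∈ bx (ctr (2 * r + 1) i) s, ∀ v ∈ bx (ctr (2 * r + 1) i) s, Large a r u → Large a r v →
    Lk a (bx (ctr (2 * r + 1) i) (C * (2 * r + 1))) u v
  adj : ∀ j, nb i j → ∃ u ∈ bx (ctr (2 * r + 1) i) s, ∃ v ∈ bx (ctr (2 * r + 1) j) s, Large a r u ∧
    Large a r v ∧ Lk a (bx (ctr (2 * r + 1) i) (C * (2 * r + 1))) u v

lemma Good.agree {r C s : ℕ} {a a' : Config d} {i : V d} (hs : s ≤ r) (hC : 3 ≤ C)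
    (h : ∀ e ∈ edgesIn (bxF (ctr (2 * r + 1) i) (C * (2 * r + 1))), a e = a' e) (hg : Good r C s a i) :
    Good r C s a' i := by
  set c := ctr (2 * r + 1) i
  have hCL : 3 * (2 * r + 1) ≤ C * (2 * r + 1) := Nat.mul_le_mul_right _ hC
  have h' : ∀ e ∈ edgesIn (bxF c (C * (2 * r + 1))), a' e = a e := fun e he => (h e he).symm
  have hb : ∀ j, nb i j → ∀ u ∈ bx (ctr (2 * r + 1) j) s, bx u (r + 1) ⊆ (bxF c (C * (2 * r + 1)) : Set (V d)) := by
    intro j hj u hu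
    rw [coe_bxF]
    exact bx_subset (bx_trans (ctr_nb hj) hu) (by omega)
  have h0 : bx c (C * (2 * r + 1)) ⊆ (bxF c (C * (2 * r + 1)) : Set (V d)) := by rw [coe_bxF]
  refine ⟨?_, ?_, ?_⟩
  · obtain ⟨u, hu, hl⟩ := hg.ex
    exact ⟨u, hu, large_agree h (hb i (nb_refl _) u hu) hl⟩
  · intro u hu v hv hlu hlv
    exact lk_agree h h0 (hg.uniq u hu v hv (large_agree h' (hb i (nb_refl _) u hu) hlu)
      (large_agree h' (hb i (nb_refl _) v hv) hlv))
  · intro j hj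
    obtain ⟨u, hu, v, hv, h1, h2, h3⟩ := hg.adj j hj
    exact ⟨u, hu, v, hv, large_agree h (hb i (nb_refl _) u hu) h1, large_agree h (hb j hj v hv) h2,
      lk_agree h h0 h3⟩

lemma good_dep {r C s : ℕ} (hs : s ≤ r) (hC : 3 ≤ C) (i : V d) :
    Dep (edgesIn (bxF (ctr (2 * r + 1) i) (C * (2 * r + 1)))) {a : Config d | ¬ Good r C s a i} :=
  fun _ _ h hg hg' => hg (hg'.agree hs hC fun e he => (h e he).symm)

lemma good_tr {r C s : ℕ} {a : Config d} {i : V d} (h : Good r C s (tr (ctr (2 * r + 1) i) a) 0) :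
    Good r C s a i := by
  set c := ctr (2 * r + 1) i with hc
  have e0 : ctr (2 * r + 1) (0 : V d) = 0 := ctr_zero _
  have key : ∀ j : V d, ∀ u, u ∈ bx (ctr (2 * r + 1) j) s → u - c ∈ bx (ctr (2 * r + 1) (j - i)) s := by
    intro j u hu
    rw [← mem_bx_add _ c, sub_add_cancel, hc, ← ctr_add, sub_add_cancel]; exact hu
  have key' : ∀ j : V d, ∀ u, u ∈ bx (ctr (2 * r + 1) j) s → u + c ∈ bx (ctr (2 * r + 1) (j + i)) s := by
    intro j u hu
    rw [ctr_add, mem_bx_add]; exact hu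
  have hl : ∀ u, Large (tr c a) r u → Large a r (u + c) := fun u h => large_tr.1 h
  have hl' : ∀ u, Large a r u → Large (tr c a) r (u - c) := fun u h => large_tr.2 (by simpa using h)
  refine ⟨?_, ?_, ?_⟩
  · obtain ⟨u, hu, h1⟩ := h.ex
    exact ⟨u + c, by simpa using key' 0 u hu, hl u h1⟩
  · intro u hu v hv h1 h2
    have := h.uniq (u - c) (by simpa using key i u hu) (v - c) (by simpa using key i v hv) (hl' u h1) (hl' v h2)
    rw [lk_tr_bx] at this
    simpa [e0] using this
  · intro j hj
    obtain ⟨u, hu, v, hv, h1, h2, h3⟩ := h.adj (j - i) (fun k => by simpa [abs_sub_comm] using hj k)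
    refine ⟨u + c, by simpa using key' 0 u hu, v + c, by simpa using key' _ v hv, hl u h1, hl v h2, ?_⟩
    rw [lk_tr_bx] at h3
    simpa [e0] using h3

lemma bad_le (p : ℝ) {r C s : ℕ} (hs : s ≤ r) (hC : 3 ≤ C) (i : V d) :
    PB d p {a | ¬ Good r C s a i} ≤ PB d p {a | ¬ Good r C s a 0} := by
  rw [← (tr_mp p (ctr (2 * r + 1) i)).measure_preimage
    (good_dep hs hC 0).measurableSet.nullMeasurableSet]
  exact measure_mono fun a ha h => ha (good_tr h)

section
variable {p : ℝ} {t : V d → ℝ}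

lemma no_inf_tendsto (hd : 2 ≤ d) (ht : ASTimeConstant (PB d p) t) (hpos : ∀ x ≠ 0, 0 < t x) :
    Tendsto (fun n : ℕ => PB d p {ω | ∀ y ∈ bx 0 n, ¬ InInfiniteCluster ω y}) atTop (𝓝 0) := by
  apply ev_tendsto
  · intro n
    have : {ω : Config d | ∀ y ∈ bx 0 n, ¬ InInfiniteCluster ω y} =
        ⋂ y ∈ bx (0 : V d) n, {ω | InInfiniteCluster ω y}ᶜ := by ext; simp
    rw [this]
    exact MeasurableSet.biInter (Set.to_countable _) fun y _ => (measurable_infinite y).compl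
  · filter_upwards [exists_infinite hd ht hpos] with ω ⟨y, hy⟩
    filter_upwards [eventually_ge_atTop (dist1 y 0)] with n hn h
    refine h y (fun k => ?_) hy
    exact (abs_le_dist1 y 0 k).trans (by exact_mod_cast hn)

lemma no_inf_tr (n : ℕ) (c : V d) : PB d p {ω | ∀ y ∈ bx c n, ¬ InInfiniteCluster ω y} ≤
    PB d p {ω | ∀ y ∈ bx 0 n, ¬ InInfiniteCluster ω y} := by
  have hm : MeasurableSet {ω : Config d | ∀ y ∈ bx 0 n, ¬ InInfiniteCluster ω y} := by
    have : {ω : Config d | ∀ y ∈ bx 0 n, ¬ InInfiniteCluster ω y} =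
        ⋂ y ∈ bx (0 : V d) n, {ω | InInfiniteCluster ω y}ᶜ := by ext; simp
    rw [this]
    exact MeasurableSet.biInter (Set.to_countable _) fun y _ => (measurable_infinite y).compl
  rw [← (tr_mp p c).measure_preimage hm.nullMeasurableSet]
  refine measure_mono fun ω hω y hy h => hω (y + c) ?_ (infinite_tr.1 h)
  have := (mem_bx_add 0 c y n).2 hy
  simpa using this

lemma uniq_tendsto (ht : ASTimeConstant (PB d p) t) (hpos : ∀ x ≠ 0, 0 < t x) (s C : ℕ) (hC : 1 ≤ C) :
    Tendsto (fun r : ℕ => PB d p {a | ¬ ∀ u ∈ bx (0 : V d) s, ∀ v ∈ bx (0 : V d) s, Large a r u → Large a r v →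
      Lk a (bx 0 (C * (2 * r + 1))) u v}) atTop (𝓝 0) := by
  apply ev_tendsto
  · intro r
    have : {a : Config d | ¬ ∀ u ∈ bx (0 : V d) s, ∀ v ∈ bx (0 : V d) s, Large a r u → Large a r v →
      Lk a (bx 0 (C * (2 * r + 1))) u v} = (⋂ u ∈ bx (0 : V d) s, ⋂ v ∈ bx (0 : V d) s,
        ({a | Large a r u}ᶜ ∪ ({a | Large a r v}ᶜ ∪ {a | Lk a (bxF 0 (C * (2 * r + 1)) : Finset (V d)) u v})))ᶜ := by
      ext a
      simp only [coe_bxF, Set.mem_compl_iff, Set.mem_iInter, Set.mem_union, Set.mem_ofPred_eq, ← imp_iff_not_or]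
    rw [this]
    exact (MeasurableSet.biInter (Set.to_countable _) fun u _ => MeasurableSet.biInter (Set.to_countable _)
      fun v _ => (large_dep r u).measurableSet.compl.union ((large_dep r v).measurableSet.compl.union
        (lk_dep _ u v).measurableSet)).compl
  · filter_upwards [unique_infinite ht hpos] with a ha
    have h1 : ∀ u ∈ bx (0 : V d) s, ∀ᶠ r : ℕ in atTop, Large a r u → InInfiniteCluster a u := by
      intro u _
      by_cases hu : InInfiniteCluster a u
      · exact Eventually.of_forall fun _ _ => hu
      · rw [infinite_iff] at hu
        push Not at hu
        obtain ⟨R, hR⟩ := hu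
        filter_upwards [eventually_ge_atTop R] with r hr h
        exact absurd (h.anti hr) hR
    have h2 : ∀ u ∈ bx (0 : V d) s, ∀ v ∈ bx (0 : V d) s, ∀ᶠ r : ℕ in atTop, InInfiniteCluster a u →
        InInfiniteCluster a v → Lk a (bx 0 (C * (2 * r + 1))) u v := by
      intro u _ v _
      by_cases hu : InInfiniteCluster a u ∧ InInfiniteCluster a v
      · obtain ⟨N, hN⟩ := lk_univ_box 0 (connected_iff.1 (ha u v hu.1 hu.2))
        filter_upwards [eventually_ge_atTop N] with r hr _ _
        exact hN _ (by nlinarith)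
      · exact Eventually.of_forall fun _ h h' => absurd ⟨h, h'⟩ hu
    have h1' := (eventually_all_finite (bx_finite (0 : V d) s)).2 h1
    have h2' := (eventually_all_finite (bx_finite (0 : V d) s)).2 fun u hu =>
      (eventually_all_finite (bx_finite (0 : V d) s)).2 (h2 u hu)
    filter_upwards [h1', h2'] with r hr hr' hn
    exact hn fun u hu v hv hlu hlv => hr' u hu v hv (hr u hu hlu) (hr v hv hlv)

lemma adj_tendsto (ht : ASTimeConstant (PB d p) t) (hpos : ∀ x ≠ 0, 0 < t x) (s : ℕ) (δ : V d) (C : ℕ)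
    (hC : t δ + 2 ≤ C) :
    Tendsto (fun r : ℕ => PB d p {a | (∃ y ∈ bx (0 : V d) s, InInfiniteCluster a y) ∧
      (∃ y ∈ bx (ctr (2 * r + 1) δ) s, InInfiniteCluster a y) ∧
      ¬ ∃ u ∈ bx (0 : V d) (d * s), ∃ v ∈ bx (ctr (2 * r + 1) δ) (d * s), Large a r u ∧ Large a r v ∧
        Lk a (bx 0 (C * (2 * r + 1))) u v}) atTop (𝓝 0) := by
  apply ev_tendsto
  · intro r
    have h1 : ∀ c : V d, MeasurableSet {a : Config d | ∃ y ∈ bx c s, InInfiniteCluster a y} := by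
      intro c
      have : {a : Config d | ∃ y ∈ bx c s, InInfiniteCluster a y} =
        ⋃ y ∈ bx c s, {a | InInfiniteCluster a y} := by ext; simp
      rw [this]
      exact MeasurableSet.biUnion (Set.to_countable _) fun y _ => measurable_infinite y
    refine (h1 0).inter ((h1 _).inter (MeasurableSet.compl ?_))
    have : {a : Config d | ∃ u ∈ bx (0 : V d) (d * s), ∃ v ∈ bx (ctr (2 * r + 1) δ) (d * s), Large a r u ∧ Large a r v ∧
        Lk a (bx 0 (C * (2 * r + 1))) u v} = ⋃ u ∈ bx (0 : V d) (d * s), ⋃ v ∈ bx (ctr (2 * r + 1) δ) (d * s),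
        ({a | Large a r u} ∩ ({a | Large a r v} ∩ {a | Lk a (bxF 0 (C * (2 * r + 1)) : Finset (V d)) u v})) := by
      ext a
      simp only [coe_bxF, Set.mem_iUnion, Set.mem_inter_iff, Set.mem_ofPred_eq, exists_prop]
    refine (congrArg MeasurableSet this).mpr ?_
    exact MeasurableSet.biUnion (Set.to_countable _) fun u _ => MeasurableSet.biUnion (Set.to_countable _)
      fun v _ => (large_dep r u).measurableSet.inter ((large_dep r v).measurableSet.inter
        (lk_dep _ u v).measurableSet)
  · have hsub : Tendsto (fun r : ℕ => 2 * r + 1) atTop atTop :=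
      tendsto_atTop_mono (fun r => by simp only [id]; omega) tendsto_id
    filter_upwards [unique_infinite ht hpos, ht δ] with a ha hta
    have h1 := (hta.comp hsub).eventually_lt_const (lt_add_one (t δ))
    filter_upwards [h1, eventually_ge_atTop (d * s)] with r hr hrs ⟨⟨y, hy, hyi⟩, ⟨z, hz, hzi⟩, hn⟩
    simp only [Function.comp] at hr
    have hL : (0 : ℝ) < ((2 * r + 1 : ℕ) : ℝ) := by positivity
    rw [div_lt_iff₀ hL] at hr
    rw [← ctr_smul] at hr
    unfold DReg at hr
    have r0 := regPoint_spec 0 hyi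
    have r1 := regPoint_spec (ctr (2 * r + 1) δ) hyi
    have near : ∀ c y : V d, y ∈ bx c s → InInfiniteCluster a y → regPoint a c ∈ bx c (d * s) := by
      intro c y hy hyi k
      have h2 := (regPoint_spec c hyi).2 y hyi
      have h3 := dist1_le_of_bx hy
      rw [abs_sub_comm]
      exact (abs_le_dist1 c _ k).trans (by exact_mod_cast h2.trans h3)
    have hconn := ha _ _ r0.1 r1.1
    have hdl := distLe_of_toReal hconn hr.le
    refine hn ⟨_, near 0 y hy hyi, _, near _ z hz hzi, infinite_iff.1 r0.1 r, infinite_iff.1 r1.1 r, ?_⟩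
    have hN : (t δ + 1) * ((2 * r + 1 : ℕ) : ℝ) ≤ (((C - 1) * (2 * r + 1) : ℕ) : ℝ) := by
      have hC1 : 1 ≤ C := by
        by_contra h
        have : C = 0 := by omega
        subst this
        by_cases hδ : δ = 0
        · have : (0:ℝ) ≤ t δ := by
            refine ge_of_tendsto hta (Eventually.of_forall fun n => ?_)
            exact div_nonneg ENNReal.toReal_nonneg (Nat.cast_nonneg n)
          norm_num at hC; linarith
        · have := hpos δ hδ
          norm_num at hC; linarith
      push_cast [hC1]
      apply mul_le_mul_of_nonneg_right _ (by positivity)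
      linarith
    refine (hdl.lk hN).mono (bx_subset (near 0 y hy hyi) ?_)
    rcases C with _ | C
    · have : (t δ + 1) * ((2 * r + 1 : ℕ) : ℝ) ≤ 0 := by simpa using hN
      have h3 : (0 : ℝ) ≤ (chemDist a (regPoint a 0) (regPoint a (ctr (2 * r + 1) δ))).toReal :=
        ENNReal.toReal_nonneg
      linarith
    · simp only [Nat.add_sub_cancel]
      have : (C + 1) * (2 * r + 1) = C * (2 * r + 1) + (2 * r + 1) := by ring
      omega

/-- the main estimate for `r`-good sites -/
lemma good_prob (hd : 2 ≤ d) (ht : ASTimeConstant (PB d p) t) (hpos : ∀ x ≠ 0, 0 < t x) :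
    ∃ C : ℕ, 3 ≤ C ∧ ∀ η : ℝ≥0∞, 0 < η → ∃ s r, s < r ∧ ∀ i, PB d p {a | ¬ Good r C s a i} ≤ η := by
  obtain ⟨T, hT⟩ : ∃ T : ℕ, ∀ δ ∈ bxF (0 : V d) 1, t δ + 2 ≤ T := by
    obtain ⟨T, hT⟩ := exists_nat_ge (∑ δ ∈ bxF (0 : V d) 1, |t δ + 2|)
    exact ⟨T, fun δ hδ => ((le_abs_self _).trans (Finset.single_le_sum
      (f := fun δ => |t δ + 2|) (fun _ _ => abs_nonneg _) hδ)).trans hT⟩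
  refine ⟨max 3 T, le_max_left _ _, fun η hη => ?_⟩
  set C := max 3 T
  set k : ℕ := 1 + 1 + 3 * 3 ^ d with hk
  have hη' : 0 < η / (k : ℝ≥0∞) := ENNReal.div_pos hη.ne' (by simp)
  obtain ⟨s', hs'⟩ := ((no_inf_tendsto hd ht hpos).eventually_lt_const hη').exists
  set s := d * s' with hs
  have hss : s' ≤ s := by rw [hs]; nlinarith
  have e1 := (uniq_tendsto ht hpos s C (by omega)).eventually_lt_const hη'
  have e2 : ∀ᶠ r : ℕ in atTop, ∀ δ ∈ bxF (0 : V d) 1, _ := (Filter.eventually_all_finset (bxF (0 : V d) 1)).2 fun δ hδ =>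
    (adj_tendsto ht hpos s' δ C ((hT δ hδ).trans (by exact_mod_cast le_max_right _ _))).eventually_lt_const hη'
  obtain ⟨r, hr1, hr2, hr3⟩ := (e1.and (e2.and (eventually_gt_atTop s))).exists
  refine ⟨s, r, hr3, fun i => (bad_le p hr3.le (le_max_left _ _) i).trans ?_⟩
  set N : V d → Set (Config d) := fun c => {ω | ∀ y ∈ bx c s', ¬ InInfiniteCluster ω y} with hNdef
  have hN : ∀ c, PB d p (N c) ≤ η / k := fun c => (no_inf_tr s' c).trans hs'.le
  have hsub : {a : Config d | ¬ Good r C s a 0} ⊆ (N 0 ∪ {a | ¬ ∀ u ∈ bx (0 : V d) s, ∀ v ∈ bx (0 : V d) s, Large a r u → Large a r v →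
      Lk a (bx 0 (C * (2 * r + 1))) u v}) ∪ ⋃ δ ∈ bxF (0 : V d) 1, (N 0 ∪ N (ctr (2 * r + 1) δ) ∪
        {a | (∃ y ∈ bx (0 : V d) s', InInfiniteCluster a y) ∧
      (∃ y ∈ bx (ctr (2 * r + 1) δ) s', InInfiniteCluster a y) ∧
      ¬ ∃ u ∈ bx (0 : V d) (d * s'), ∃ v ∈ bx (ctr (2 * r + 1) δ) (d * s'), Large a r u ∧ Large a r v ∧
        Lk a (bx 0 (C * (2 * r + 1))) u v}) := by
    intro a ha
    by_contra hcon
    simp only [Set.mem_union, Set.mem_iUnion, not_or] at hcon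
    obtain ⟨⟨hc1, hc2⟩, hc3⟩ := hcon
    apply ha
    rw [Set.mem_ofPred_eq, not_not] at hc2
    have hinf : ∀ c, a ∉ N c → ∃ y ∈ bx c s', InInfiniteCluster a y := by
      intro c hc
      by_contra h
      push Not at h
      exact hc h
    refine ⟨?_, ?_, ?_⟩
    · obtain ⟨y, hy, hyi⟩ := hinf 0 hc1
      rw [ctr_zero]
      exact ⟨y, bx_mono _ hss hy, infinite_iff.1 hyi r⟩
    · rw [ctr_zero]; exact hc2
    · intro j hj
      rw [ctr_zero]
      have h3 : _ := not_or.1 (fun h => hc3 ⟨j, mem_bxF_one.2 hj.symm, h⟩)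
      have h4 := h3.2
      by_contra hno
      exact h4 ⟨hinf _ (not_or.1 h3.1).1, hinf _ (not_or.1 h3.1).2, fun h => hno h⟩
  refine (measure_mono hsub).trans ?_
  calc _ ≤ (η / k + η / k) + ∑ δ ∈ bxF (0 : V d) 1, (η / k + η / k + η / k) := by
        refine (measure_union_le _ _).trans (add_le_add ((measure_union_le _ _).trans
          (add_le_add (hN 0) hr1.le)) ((measure_biUnion_finset_le _ _).trans (Finset.sum_le_sum fun δ hδ => ?_)))
        exact (measure_union_le _ _).trans (add_le_add ((measure_union_le _ _).trans
          (add_le_add (hN 0) (hN _))) (hr2 δ hδ).le)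
    _ = k * (η / k) := by
        rw [Finset.sum_const, card_bxF, hk]
        simp only [nsmul_eq_mul]
        push_cast
        ring
    _ ≤ η := by
        rw [ENNReal.mul_div_cancel (by simp [hk]) (ENNReal.natCast_ne_top k)]
end

end Part7

section Part8

section explore
variable {ι : Type*}

lemma explore {μ : Measure (ι → Bool)} [IsProbabilityMeasure μ] (hμ : IndC μ) {J κ : Type*}
    (M0 : Finset J) (E : J → Finset ι) (N : J → Set (ι → Bool)) (hN : ∀ j, Dep (E j) (N j))
    (hE : ∀ i ∈ M0, ∀ j ∈ M0, i ≠ j → Disjoint (E i) (E j)) {e : ℝ≥0∞} (hNe : ∀ j, μ (N j) ≤ e)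
    (hN0 : ∀ j, μ (N j) ≠ 0) (he : e ≤ 1) {S0 : Finset ι} {B : Set (ι → Bool)} (hB : Dep S0 B)
    (hS0 : ∀ j ∈ M0, Disjoint S0 (E j)) (K : Finset κ) (A : κ → Set (ι → Bool)) (T : κ → Finset J)
    (S : κ → Finset ι) (hA : ∀ k ∈ K, Dep (S k) (A k)) (hAB : ∀ k ∈ K, A k ⊆ B)
    (hdisj : ∀ k ∈ K, ∀ l ∈ K, k ≠ l → Disjoint (A k) (A l)) (hT : ∀ k ∈ K, T k ⊆ M0)
    (hS : ∀ k ∈ K, ∀ j ∈ M0, j ∉ T k → Disjoint (S k) (E j)) (m : ℕ) (hm : ∀ k ∈ K, m ≤ (T k).card) :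
    μ (⋃ k ∈ K, A k ∩ ⋂ j ∈ T k, N j) ≤ e ^ m * μ B := by
  classical
  have hprod : ∀ D ⊆ M0, μ (⋂ j ∈ D, N j) = ∏ j ∈ D, μ (N j) := fun D hD =>
    Dep.prod hμ D (fun j _ => hN j) (fun j hj j' hj' h => hE j (hD hj) j' (hD hj') h)
  have hdisjU : ∀ D1 ⊆ M0, ∀ D2 ⊆ M0, Disjoint D1 D2 → Disjoint (D1.biUnion E) (D2.biUnion E) := by
    intro D1 h1 D2 h2 h
    rw [Finset.disjoint_biUnion_left]
    intro i hi
    rw [Finset.disjoint_biUnion_right]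
    intro j hj
    exact hE i (h1 hi) j (h2 hj) (fun hij => Finset.disjoint_left.1 h hi (hij ▸ hj))
  -- one state
  have hone : ∀ k ∈ K, μ (A k ∩ ⋂ j ∈ T k, N j) * ∏ j ∈ M0, μ (N j) ≤
      e ^ m * μ (A k ∩ ⋂ j ∈ M0, N j) := by
    intro k hk
    have h1 : μ ((A k ∩ ⋂ j ∈ T k, N j) ∩ ⋂ j ∈ M0 \ T k, N j) =
        μ (A k ∩ ⋂ j ∈ T k, N j) * ∏ j ∈ M0 \ T k, μ (N j) := by
      rw [← hprod _ Finset.sdiff_subset]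
      refine Dep.indep hμ (S := S k ∪ (T k).biUnion E) (T := (M0 \ T k).biUnion E) ?_ ?_ ?_
      · rw [Finset.disjoint_union_left]
        refine ⟨?_, hdisjU _ (hT k hk) _ Finset.sdiff_subset Finset.disjoint_sdiff⟩
        rw [Finset.disjoint_biUnion_right]
        intro j hj
        rw [Finset.mem_sdiff] at hj
        exact hS k hk j hj.1 hj.2
      · exact ((hA k hk).mono Finset.subset_union_left).inter
          ((Dep.iInter _ fun j _ => hN j).mono Finset.subset_union_right)
      · exact Dep.iInter _ fun j _ => hN j
    have h2 : (A k ∩ ⋂ j ∈ T k, N j) ∩ ⋂ j ∈ M0 \ T k, N j = A k ∩ ⋂ j ∈ M0, N j := by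
      ext ω
      simp only [Set.mem_inter_iff, Set.mem_iInter, Finset.mem_sdiff]
      constructor
      · rintro ⟨⟨h1, h2⟩, h3⟩
        exact ⟨h1, fun j hj => by
          by_cases h : j ∈ T k
          · exact h2 j h
          · exact h3 j ⟨hj, h⟩⟩
      · rintro ⟨h1, h2⟩
        exact ⟨⟨h1, fun j hj => h2 j (hT k hk hj)⟩, fun j hj => h2 j hj.1⟩
    rw [h2] at h1
    rw [h1, ← Finset.prod_sdiff (hT k hk)]
    have h3 : ∏ j ∈ T k, μ (N j) ≤ e ^ m :=
      (Finset.prod_le_pow_card _ _ _ fun j _ => hNe j).trans (pow_le_pow_right_of_le_one' he (hm k hk))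
    calc _ = (∏ j ∈ T k, μ (N j)) * (μ (A k ∩ ⋂ j ∈ T k, N j) * ∏ j ∈ M0 \ T k, μ (N j)) := by ring
      _ ≤ _ := by gcongr
  have hsum : μ (⋃ k ∈ K, A k ∩ ⋂ j ∈ T k, N j) * ∏ j ∈ M0, μ (N j) ≤
      (e ^ m * μ B) * ∏ j ∈ M0, μ (N j) := by
    calc _ ≤ (∑ k ∈ K, μ (A k ∩ ⋂ j ∈ T k, N j)) * ∏ j ∈ M0, μ (N j) := by
          gcongr; exact measure_biUnion_finset_le _ _
      _ = ∑ k ∈ K, μ (A k ∩ ⋂ j ∈ T k, N j) * ∏ j ∈ M0, μ (N j) := Finset.sum_mul _ _ _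
      _ ≤ ∑ k ∈ K, e ^ m * μ (A k ∩ ⋂ j ∈ M0, N j) := Finset.sum_le_sum hone
      _ = e ^ m * ∑ k ∈ K, μ (A k ∩ ⋂ j ∈ M0, N j) := (Finset.mul_sum _ _ _).symm
      _ = e ^ m * μ (⋃ k ∈ K, A k ∩ ⋂ j ∈ M0, N j) := by
          rw [measure_biUnion_finset]
          · intro k hk l hl hkl
            exact (hdisj k hk l hl hkl).mono Set.inter_subset_left Set.inter_subset_left
          · intro k hk
            exact (hA k hk).measurableSet.inter (Dep.iInter _ fun j _ => hN j).measurableSet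
      _ ≤ e ^ m * μ (B ∩ ⋂ j ∈ M0, N j) := by
          gcongr
          exact Set.iUnion₂_subset fun k hk => Set.inter_subset_inter_left _ (hAB k hk)
      _ = e ^ m * (μ B * ∏ j ∈ M0, μ (N j)) := by
          rw [← hprod _ subset_rfl, ← Dep.indep hμ (S := S0) (T := M0.biUnion E) _ hB
            (Dep.iInter _ fun j _ => hN j)]
          rw [Finset.disjoint_biUnion_right]
          exact hS0
      _ = _ := by ring
  refine (ENNReal.mul_le_mul_iff_left ?_ ?_).1 hsum
  · exact Finset.prod_ne_zero_iff.2 fun j _ => hN0 j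
  · exact ENNReal.prod_ne_top fun j _ => measure_ne_top _ _
end explore

variable {d : ℕ}

/-- site containing a vertex -/
def site (r : ℕ) (v : V d) : V d := fun k => (v k + r) / ((2 * r + 1 : ℕ) : ℤ)

lemma site_mem (r : ℕ) (v : V d) : v ∈ bx (ctr (2 * r + 1) (site r v)) r := by
  intro k
  simp only [ctr, site]
  have h1 := Int.emod_add_mul_ediv (v k + r) ((2 * r + 1 : ℕ) : ℤ)
  have h2 := Int.emod_nonneg (v k + r) (b := ((2 * r + 1 : ℕ) : ℤ)) (by positivity)
  have h3 := Int.emod_lt_of_pos (v k + r) (b := ((2 * r + 1 : ℕ) : ℤ)) (by positivity)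
  rw [abs_le]
  push_cast at *
  constructor <;> linarith

lemma bx_site_unique {r : ℕ} {v : V d} {i j : V d} (hi : v ∈ bx (ctr (2 * r + 1) i) r)
    (hj : v ∈ bx (ctr (2 * r + 1) j) r) : i = j := by
  funext k
  have h1 := hi k
  have h2 := hj k
  simp only [ctr, abs_le] at h1 h2
  push_cast at *
  rcases lt_trichotomy (i k) (j k) with h | h | h
  · nlinarith
  · exact h
  · nlinarith

lemma site_nb {r : ℕ} {u v : V d} (h : nb u v) : nb (site r u) (site r v) := by
  intro k
  have h1 := site_mem r u k
  have h2 := site_mem r v k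
  have h3 := h k
  simp only [ctr, abs_le] at *
  push_cast at *
  constructor <;> by_contra hc <;> push Not at hc <;> nlinarith

/-- a box with all edges open is connected -/
lemma box_conn {ω : Config d} {c : V d} {r : ℕ} (h : ∀ e ∈ edgesIn (bxF c r), ω e = true) {u v : V d}
    (hu : u ∈ bx c r) (hv : v ∈ bx c r) : Lk ω (bx c r) u v := by
  classical
  induction hn : dist1 u v using Nat.strong_induction_on generalizing u with
  | _ n ih =>
    by_cases huv : u = v
    · subst huv; exact LinkR.refl hu
    obtain ⟨k, hk⟩ := Function.ne_iff.1 huv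
    set w : V d := Function.update u k (u k + Int.sign (v k - u k)) with hw
    have hsg : (u k < v k ∧ Int.sign (v k - u k) = 1) ∨ (v k < u k ∧ Int.sign (v k - u k) = -1) := by
      rcases lt_or_gt_of_ne hk with h | h
      · exact Or.inl ⟨h, Int.sign_eq_one_of_pos (by linarith)⟩
      · exact Or.inr ⟨h, Int.sign_eq_neg_one_of_neg (by linarith)⟩
    have hwb : w ∈ bx c r := by
      intro l
      by_cases hl : l = k
      · subst hl
        have h1 := hu l
        have h2 := hv l
        simp only [hw, Function.update_self, abs_le] at *
        rcases hsg with ⟨h3, h4⟩ | ⟨h3, h4⟩ <;> rw [h4] <;> constructor <;> linarith [h1.1, h1.2, h2.1, h2.2]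
      · simp only [hw, Function.update_of_ne hl]; exact hu l
    have hd1 : dist1 u w = 1 := by
      unfold dist1
      rw [Finset.sum_eq_single k]
      · simp only [hw, Function.update_self]
        rcases hsg with ⟨h3, h4⟩ | ⟨h3, h4⟩ <;> rw [h4] <;> omega
      · intro l _ hl; simp [hw, Function.update_of_ne hl]
      · simp
    have hdec : dist1 w v < dist1 u v := by
      unfold dist1
      apply Finset.sum_lt_sum
      · intro l _
        by_cases hl : l = k
        · subst hl
          simp only [hw, Function.update_self]
          rcases hsg with ⟨h3, h4⟩ | ⟨h3, h4⟩ <;> rw [h4] <;> omega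
        · simp [hw, Function.update_of_ne hl]
      · refine ⟨k, Finset.mem_univ _, ?_⟩
        simp only [hw, Function.update_self]
        rcases hsg with ⟨h3, h4⟩ | ⟨h3, h4⟩ <;> rw [h4] <;> omega
    have hopen : edgeOpen ω u w := by
      refine ⟨hd1, h _ (mem_edgesIn.2 ?_)⟩
      simp [mem_bxF, hu, hwb]
    exact (LinkR.single hopen hu hwb).trans (ih _ (hn ▸ hdec) hwb rfl)

lemma good_chain {r C s : ℕ} {a : Config d} {M : Set (V d)} (hM : ∀ i ∈ M, Good r C s a i) {i j : V d}
    (hij : LinkR nb M i j) {u v : V d} (hu : u ∈ bx (ctr (2 * r + 1) i) s)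
    (hv : v ∈ bx (ctr (2 * r + 1) j) s) (hlu : Large a r u) (hlv : Large a r v) {A : Set (V d)}
    (hA : ∀ i ∈ M, bx (ctr (2 * r + 1) i) (C * (2 * r + 1)) ⊆ A) : Lk a A u v := by
  have key : ∀ v ∈ bx (ctr (2 * r + 1) j) s, Large a r v → Lk a A u v := by
    refine hij.induct (P := fun j => ∀ v ∈ bx (ctr (2 * r + 1) j) s, Large a r v → Lk a A u v) ?_ ?_
    · intro v hv hlv
      exact ((hM i hij.left).uniq u hu v hv hlu hlv).mono (hA i hij.left)
    · intro b b' hb ih hbb hb' v hv hlv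
      obtain ⟨y, hy, z, hz, hly, hlz, hyz⟩ := (hM b hb.right).adj b' hbb
      exact ((ih y hy hly).trans (hyz.mono (hA b hb.right))).trans
        (((hM b' hb').uniq z hz v hv hlz hlv).mono (hA b' hb'))
  exact key v hv hlv

/-- crossing of a window by a sequence with small steps -/
lemma crossing (h : ℕ → ℤ) (n : ℕ) (hs : ∀ i < n, |h (i + 1) - h i| ≤ 1) (α β : ℤ) (hαβ : α ≤ β)
    (h0 : h 0 ≤ α) (hn : β ≤ h n) : ∃ a b, a ≤ b ∧ b ≤ n ∧ h a = α ∧ h b = β ∧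
      ∀ i, a ≤ i → i ≤ b → α ≤ h i ∧ h i ≤ β := by
  classical
  have hex : ∃ b, β ≤ h b := ⟨n, hn⟩
  set b := Nat.find hex with hb
  have hb1 : β ≤ h b := Nat.find_spec hex
  have hbn : b ≤ n := Nat.find_min' hex hn
  have hbm : ∀ i < b, h i < β := fun i hi => not_le.1 (Nat.find_min hex hi)
  have hb2 : h b = β := by
    rcases Nat.eq_zero_or_pos b with h' | h'
    · rw [h'] at hb1 ⊢; omega
    · have h1 := hbm (b - 1) (by omega)
      have h2 := hs (b - 1) (by omega)
      rw [Nat.sub_add_cancel h', abs_le] at h2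
      omega
  have hex2 : ∃ c, c ≤ b ∧ h (b - c) ≤ α := ⟨b, le_rfl, by simpa using h0⟩
  set c := Nat.find hex2 with hc
  obtain ⟨hc1, hc2⟩ := Nat.find_spec hex2
  have hcm : ∀ i < c, α < h (b - i) := fun i hi => by
    have := Nat.find_min hex2 hi
    push Not at this
    exact this (by omega)
  refine ⟨b - c, b, by omega, hbn, ?_, hb2, fun i hi hib => ⟨?_, ?_⟩⟩
  · rcases Nat.eq_zero_or_pos c with h' | h'
    · rw [← hc] at hc2
      rw [h'] at hc2 ⊢
      simp only [Nat.sub_zero] at hc2 ⊢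
      omega
    · have h1 := hcm (c - 1) (by omega)
      have h2 := hs (b - c) (by omega)
      rw [show b - c + 1 = b - (c - 1) by omega, abs_le] at h2
      rw [← hc] at hc2
      omega
  · by_cases h' : i = b - c
    · subst h'
      rcases Nat.eq_zero_or_pos c with h' | h'
      · rw [h', Nat.sub_zero, hb2]; exact hαβ
      · have h1 := hcm (c - 1) (by omega)
        have h2 := hs (b - c) (by omega)
        rw [show b - c + 1 = b - (c - 1) by omega, abs_le] at h2
        omega
    · have := hcm (b - i) (by omega)
      rw [show b - (b - i) = i by omega] at this
      exact this.le
  · rcases hib.lt_or_eq with h' | h'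
    · exact (hbm i h').le
    · rw [h', hb2]

lemma sconn_path (g : ℕ → V d) (a b : ℕ) (hg : ∀ i, a ≤ i → i < b → nb (g i) (g (i + 1))) :
    SConn (g '' {i | a ≤ i ∧ i ≤ b}) := by
  have key : ∀ i j, a ≤ i → i ≤ j → j ≤ b → LinkR nb (g '' {i | a ≤ i ∧ i ≤ b}) (g i) (g j) := by
    intro i j h1 h2 h3
    exact LinkR.of_subpath g i j h2 (fun l hl hl' => hg l (by omega) (by omega))
      (fun l hl hl' => ⟨l, ⟨by omega, by omega⟩, rfl⟩)
  rintro _ ⟨i, ⟨hi1, hi2⟩, rfl⟩ _ ⟨j, ⟨hj1, hj2⟩, rfl⟩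
  rcases le_total i j with h | h
  · exact key i j hi1 h hj2
  · exact (key j i hj1 h hi2).symm nb_symm

lemma sconn_diam {S : Finset (V d)} (hS : SConn (S : Set (V d))) {x y : V d} (hx : x ∈ S) (hy : y ∈ S) :
    y ∈ bx x (S.card - 1) := by
  obtain ⟨n, f, hn, h1, -, rfl, rfl⟩ := LinkR.short_path (hS x hx y hy)
  have : ∀ i ≤ n, f i ∈ bx (f 0) i := by
    intro i hi
    induction i with
    | zero => exact mem_bx_self _ _
    | succ i ih =>
      exact bx_trans (ih (by omega)) (fun k => by simpa using (h1 i (by omega)).symm k)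
  exact bx_mono _ (by omega) (this n le_rfl)

/-- many sites of the main cluster are touched -/
lemma many_windows {M : Set (V d)} {Λ : Set (V d)} {l : ℕ}
    (hM : ∀ Γ ⊆ Λ, SConn Γ → (∃ x ∈ Γ, ∃ y ∈ Γ, ∃ k, (2 * l : ℤ) < |x k - y k|) → (Γ ∩ M).Nonempty)
    (g : ℕ → V d) (n : ℕ) (hg : ∀ i < n, nb (g i) (g (i + 1))) (hΛ : ∀ i ≤ n, g i ∈ Λ) (k : Fin d) (m : ℕ)
    (hm : (m * (2 * l + 2) : ℤ) ≤ |g n k - g 0 k|) :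
    ∃ D : Finset (V d), D.card = m ∧ ∀ z ∈ D, z ∈ M ∧ ∃ i ≤ n, g i = z := by
  classical
  set h : ℕ → ℤ := fun i => |g i k - g 0 k| with hh
  have hstep : ∀ i < n, |h (i + 1) - h i| ≤ 1 := by
    intro i hi
    have h1 := (hg i hi).symm k
    have h2 := abs_abs_sub_abs_le (g (i + 1) k - g 0 k) (g i k - g 0 k)
    rw [sub_sub_sub_cancel_right] at h2
    exact h2.trans h1
  have key : ∀ j : Fin m, ∃ z, z ∈ M ∧ (∃ i ≤ n, g i = z) ∧ (j * (2 * l + 2) : ℤ) ≤ |z k - g 0 k| ∧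
      |z k - g 0 k| ≤ (j * (2 * l + 2) + (2 * l + 1) : ℤ) := by
    intro j
    have hjm : ((j : ℕ) + 1 : ℤ) ≤ m := by exact_mod_cast j.2
    have hb : (j * (2 * l + 2) + (2 * l + 1) : ℤ) ≤ h n := by
      refine le_trans ?_ hm
      nlinarith
    obtain ⟨a, b, hab, hbn, ha, hb', hw⟩ := crossing h n hstep (j * (2 * l + 2))
      (j * (2 * l + 2) + (2 * l + 1)) (by linarith [(Nat.cast_nonneg l : (0 : ℤ) ≤ l)])
      (by simp only [hh, sub_self, abs_zero]; positivity) hb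
    obtain ⟨z, ⟨i, ⟨hi1, hi2⟩, rfl⟩, hz⟩ := hM (g '' {i | a ≤ i ∧ i ≤ b})
      (by rintro _ ⟨i, hi, rfl⟩; exact hΛ i (hi.2.trans hbn))
      (sconn_path g a b fun i _ hi => hg i (by omega))
      ⟨g b, ⟨b, ⟨hab, le_rfl⟩, rfl⟩, g a, ⟨a, ⟨le_rfl, hab⟩, rfl⟩, k, by
        have h1 := abs_sub_abs_le_abs_sub (g b k - g 0 k) (g a k - g 0 k)
        rw [sub_sub_sub_cancel_right] at h1
        simp only [hh] at ha hb'
        linarith⟩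
    exact ⟨g i, hz, ⟨i, by omega, rfl⟩, (hw i hi1 hi2).1, (hw i hi1 hi2).2⟩
  choose z hz1 hz2 hz3 hz4 using key
  have hinj : Function.Injective z := by
    intro i j hij
    have h1 := hz3 i
    have h2 := hz4 i
    have h3 := hz3 j
    have h4 := hz4 j
    rw [hij] at h1 h2
    have hl : (0 : ℤ) ≤ l := by positivity
    apply Fin.ext
    rcases lt_trichotomy (i : ℕ) (j : ℕ) with h | h | h
    · have : ((i : ℕ) : ℤ) + 1 ≤ (j : ℕ) := by exact_mod_cast h
      nlinarith
    · exact h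
    · have : ((j : ℕ) : ℤ) + 1 ≤ (i : ℕ) := by exact_mod_cast h
      nlinarith
  refine ⟨Finset.univ.image z, ?_, ?_⟩
  · rw [Finset.card_image_of_injective _ hinj, Finset.card_univ, Fintype.card_fin]
  · intro y hy
    obtain ⟨j, -, rfl⟩ := Finset.mem_image.1 hy
    exact ⟨hz1 j, hz2 j⟩

end Part8

section Part9

variable {d : ℕ}

structure RGood (R C : ℕ) (ω : Config d) (J : V d) : Prop where
  ex : ∃ x ∈ bx (ctr R J) R, Large ω R x
  uniq : ∀ x ∈ bx (ctr R J) (3 * R), ∀ y ∈ bx (ctr R J) (3 * R), Large ω R x → Large ω R y →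
    Lk ω (bx (ctr R J) (C * R)) x y

lemma RGood.agree {R C : ℕ} {a a' : Config d} {i : V d} (hR : 1 ≤ R) (hC : 5 ≤ C)
    (h : ∀ e ∈ edgesIn (bxF (ctr R i) (C * R)), a e = a' e) (hg : RGood R C a i) :
    RGood R C a' i := by
  set c := ctr R i
  have hCL : 5 * R ≤ C * R := Nat.mul_le_mul_right _ hC
  have h' : ∀ e ∈ edgesIn (bxF c (C * R)), a' e = a e := fun e he => (h e he).symm
  have hb : ∀ u ∈ bx c (3 * R), bx u (R + 1) ⊆ (bxF c (C * R) : Set (V d)) := by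
    intro u hu
    rw [coe_bxF]
    exact bx_subset hu (by omega)
  have h0 : bx c (C * R) ⊆ (bxF c (C * R) : Set (V d)) := by rw [coe_bxF]
  refine ⟨?_, ?_⟩
  · obtain ⟨u, hu, hl⟩ := hg.ex
    exact ⟨u, hu, large_agree h (hb u (bx_mono _ (by omega) hu)) hl⟩
  · intro u hu v hv hlu hlv
    exact lk_agree h h0 (hg.uniq u hu v hv (large_agree h' (hb u hu) hlu)
      (large_agree h' (hb v hv) hlv))

lemma rgood_dep {R C : ℕ} (hR : 1 ≤ R) (hC : 5 ≤ C) (i : V d) :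
    Dep (edgesIn (bxF (ctr R i) (C * R))) {a : Config d | ¬ RGood R C a i} :=
  fun _ _ h hg hg' => hg (hg'.agree hR hC fun e he => (h e he).symm)

lemma rgood_tr {R C : ℕ} {a : Config d} {i : V d} (h : RGood R C (tr (ctr R i) a) 0) :
    RGood R C a i := by
  set c := ctr R i with hc
  have e0 : ctr R (0 : V d) = 0 := ctr_zero _
  have key : ∀ n u, u ∈ bx c n → u - c ∈ bx (ctr R (0 : V d)) n := by
    intro n u hu
    rw [← mem_bx_add _ c, sub_add_cancel, e0, zero_add]; exact hu
  have hl' : ∀ u, Large a R u → Large (tr c a) R (u - c) := fun u h => large_tr.2 (by simpa using h)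
  refine ⟨?_, ?_⟩
  · obtain ⟨u, hu, h1⟩ := h.ex
    refine ⟨u + c, ?_, large_tr.1 h1⟩
    rw [← mem_bx_add _ c, e0, zero_add] at hu
    exact hu
  · intro u hu v hv h1 h2
    have := h.uniq (u - c) (key _ u hu) (v - c) (key _ v hv) (hl' u h1) (hl' v h2)
    rw [lk_tr_bx] at this
    simpa [e0] using this

lemma rbad_le (p : ℝ) {R C : ℕ} (hR : 1 ≤ R) (hC : 5 ≤ C) (i : V d) :
    PB d p {a | ¬ RGood R C a i} ≤ PB d p {a | ¬ RGood R C a 0} := by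
  rw [← (tr_mp p (ctr R i)).measure_preimage
    (rgood_dep hR hC 0).measurableSet.nullMeasurableSet]
  exact measure_mono fun a ha h => ha (rgood_tr h)

open Classical in
noncomputable def clF (ω : Config d) (x : V d) (R : ℕ) : Finset (V d) :=
  (bxF x (R + 1)).filter fun v => Lk ω (bx x (R + 1)) x v

lemma mem_clF {ω : Config d} {x v : V d} {R : ℕ} : v ∈ clF ω x R ↔ Lk ω (bx x (R + 1)) x v := by
  classical
  simp only [clF, Finset.mem_filter, mem_bxF]
  exact ⟨fun h => h.2, fun h => ⟨h.right, h⟩⟩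

open Classical in
noncomputable def TT (r : ℕ) (M D : Finset (V d)) : Finset (V d) :=
  M.filter fun i => ∃ v ∈ D, site r v = i

/-- properties of the main cluster -/
def MP (l N : ℕ) (B M : Finset (V d)) : Prop :=
  (M : Set (V d)) ⊆ bx 0 N \ (B : Set (V d)) ∧ (∀ i ∈ M, ∀ j ∈ M, LinkR nb (bx 0 N \ (B : Set (V d))) i j) ∧
    ∀ Γ ⊆ bx (0 : V d) N, SConn Γ → (∃ x ∈ Γ, ∃ y ∈ Γ, ∃ k, (2 * l : ℤ) < |x k - y k|) →
      (Γ ∩ (M : Set (V d))).Nonempty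

open Classical in
noncomputable def Mfun (l N : ℕ) (B : Finset (V d)) : Finset (V d) :=
  if h : ∃ M, MP l N B M then h.choose else ∅

lemma Mfun_spec (hd : 2 ≤ d) {l N : ℕ} (hN : l + 2 ≤ N) {B : Finset (V d)}
    (hB : ∀ S : Finset (V d), S ⊆ B → SConn (S : Set (V d)) → S.card ≤ l) : MP l N B (Mfun l N B) := by
  classical
  have hex : ∃ M, MP l N B M := by
    obtain ⟨M, h1, h2, h3⟩ := main_cluster hd 0 N l hN (B : Set (V d)) (by
      intro S hS hSc x hx y hy
      have hfin : S.Finite := (B.finite_toSet).subset (hS.trans Set.inter_subset_left)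
      lift S to Finset (V d) using hfin
      have := hB S (by exact_mod_cast hS.trans Set.inter_subset_left) hSc
      exact bx_mono _ (by omega) (sconn_diam hSc hx hy))
    have hfin : M.Finite := (bx_finite 0 N).subset (h1.trans Set.sdiff_subset)
    lift M to Finset (V d) using hfin
    exact ⟨M, h1, fun i hi j hj => h2 i hi j hj, h3⟩
  unfold Mfun
  rw [dif_pos hex]
  exact hex.choose_spec

lemma touch {r l R N : ℕ} (hl : 1 ≤ l) (hR : R = 4 * l ^ 2 * (2 * r + 1)) (hN : N = 40 * l ^ 2) {B M : Finset (V d)}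
    (hM : MP l N B M) {ω : Config d} {x : V d} (hx : x ∈ bx 0 (3 * R)) (hL : Large ω R x) :
    l ≤ (TT r M (clF ω x R)).card := by
  classical
  obtain ⟨y, hy, hlk⟩ := hL
  obtain ⟨n, f, h1, h2, rfl, rfl⟩ := hlk.path
  have hyk : ∃ k, (R : ℤ) < |f n k - f 0 k| := by
    simp only [bx, Set.mem_ofPred_eq, not_forall, not_le] at hy
    exact hy
  obtain ⟨k, hk⟩ := hyk
  have hl2 : (l : ℤ) ≤ (l : ℤ) ^ 2 := by
    have : l ≤ l ^ 2 := by nlinarith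
    exact_mod_cast this
  have hl1 : (1 : ℤ) ≤ l := by exact_mod_cast hl
  have hRz : (R : ℤ) = 4 * (l : ℤ) ^ 2 * (2 * r + 1) := by rw [hR]; push_cast; ring
  have hNz : (N : ℤ) = 40 * (l : ℤ) ^ 2 := by rw [hN]; push_cast; ring
  have hr : (0 : ℤ) ≤ r := by positivity
  obtain ⟨D, hD, hD'⟩ := many_windows hM.2.2 (fun i => site r (f i)) n
    (fun i hi => site_nb (edgeOpen_nb (h1 i hi))) (by
      intro i hi k'
      have h3 := site_mem r (f i) k'
      have h4 := h2 i hi k'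
      have h5 := hx k'
      simp only [ctr, Pi.zero_apply, sub_zero] at *
      rw [abs_le] at *
      push_cast at *
      rw [hRz] at h4 h5
      rw [hNz]
      constructor <;> by_contra hc <;> push Not at hc <;> nlinarith) k l (by
      have h3 := site_mem r (f n) k
      have h4 := site_mem r (f 0) k
      simp only [ctr] at h3 h4
      have : 4 * (l : ℤ) ^ 2 ≤ |site r (f n) k - site r (f 0) k| := by
        by_contra hc
        push Not at hc
        rw [hRz] at hk
        have hc' := abs_le.1 (Int.le_sub_one_of_lt hc)
        rw [abs_le] at h3 h4
        push_cast at *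
        rcases lt_abs.1 hk with h | h <;> nlinarith
      refine le_trans ?_ this
      nlinarith)
  rw [← hD]
  apply Finset.card_le_card
  intro z hz
  obtain ⟨hz1, i, hi, rfl⟩ := hD' z hz
  unfold TT
  rw [Finset.mem_filter]
  refine ⟨hz1, f i, mem_clF.2 ?_, rfl⟩
  exact LinkR.of_path i f (fun j hj => h1 j (by omega)) (fun j hj => h2 j (by omega))

lemma rgood_of (hd : 2 ≤ d) {r s C l R N : ℕ} (hs : s ≤ r) (hC : 1 ≤ C) (hl : 3 ≤ l) (hR : R = 4 * l ^ 2 * (2 * r + 1)) (hN : N = 40 * l ^ 2)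
    {B M : Finset (V d)} (hM : MP l N B M) {a ω : Config d} (haω : ∀ e, a e = true → ω e = true)
    (hgood : ∀ i ∈ bx 0 N, i ∉ B → Good r C s a i)
    (hH : ∀ x ∈ bx 0 (3 * R), Large ω R x → ∃ i ∈ TT r M (clF ω x R),
      ∀ e ∈ edgesIn (bxF (ctr (2 * r + 1) i) r), ω e = true) : RGood R (10 + C) ω 0 := by
  have hl2 : l ≤ l ^ 2 := by nlinarith
  have hl22 : 1 ≤ l ^ 2 := by nlinarith
  have hNR : N * (2 * r + 1) = 10 * R := by rw [hN, hR]; ring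
  have hLR : 2 * r + 1 ≤ R := by rw [hR]; nlinarith
  have hbig : ∀ i ∈ bx (0 : V d) N, ctr (2 * r + 1) i ∈ bx 0 (10 * R) := by
    intro i hi k
    have := hi k
    simp only [ctr, Pi.zero_apply, sub_zero, abs_mul, Nat.abs_cast] at *
    rw [← hNR]
    push_cast
    have : (0 : ℤ) ≤ 2 * r + 1 := by positivity
    nlinarith
  have hA : ∀ i ∈ bx 0 N \ (B : Set (V d)), bx (ctr (2 * r + 1) i) (C * (2 * r + 1)) ⊆ bx 0 ((10 + C) * R) := by
    intro i hi
    refine bx_subset (hbig i hi.1) ?_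
    nlinarith
  have hgood' : ∀ i ∈ bx 0 N \ (B : Set (V d)), Good r C s a i := fun i hi => hgood i hi.1 (by simpa using hi.2)
  have chain : ∀ i ∈ M, ∀ j ∈ M, ∀ u ∈ bx (ctr (2 * r + 1) i) s, ∀ v ∈ bx (ctr (2 * r + 1) j) s,
      Large a r u → Large a r v → Lk ω (bx 0 ((10 + C) * R)) u v := by
    intro i hi j hj u hu v hv hlu hlv
    exact (good_chain hgood' (hM.2.1 i hi j hj) hu hv hlu hlv hA).monoR
      fun x _ y _ h => ⟨h.1, haω _ h.2⟩
  have hgM : ∀ i ∈ M, Good r C s a i := fun i hi => hgood' i (hM.1 hi)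
  constructor
  · rw [ctr_zero]
    -- horizontal segments
    have seg : ∀ α : ℕ, α + (2 * l + 1) ≤ N → ∃ i ∈ M, (α : ℤ) ≤ i ⟨0, by omega⟩ ∧ i ⟨0, by omega⟩ ≤ α + (2 * l + 1) ∧
        ∀ k, k ≠ ⟨0, by omega⟩ → i k = 0 := by
      intro α hα
      set g : ℕ → V d := fun t k => if k = ⟨0, by omega⟩ then (t : ℤ) else 0 with hg
      obtain ⟨z, ⟨t, ⟨ht1, ht2⟩, rfl⟩, hz⟩ := hM.2.2 (g '' {i | α ≤ i ∧ i ≤ α + (2 * l + 1)}) (by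
        rintro _ ⟨t, ⟨ht1, ht2⟩, rfl⟩ k
        simp only [hg, Pi.zero_apply, sub_zero]
        split_ifs
        · rw [Nat.abs_cast]; exact_mod_cast ht2.trans hα
        · simp)
        (sconn_path g _ _ fun t _ _ k => by simp only [hg]; split_ifs <;> simp)
        ⟨g (α + (2 * l + 1)), ⟨_, ⟨by omega, le_rfl⟩, rfl⟩, g α, ⟨_, ⟨le_rfl, by omega⟩, rfl⟩, ⟨0, by omega⟩, by
          simp only [hg, if_true]
          rw [abs_of_nonneg] <;> push_cast <;> linarith⟩
      refine ⟨g t, hz, ?_, ?_, ?_⟩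
      · simp only [hg, if_true]; exact_mod_cast ht1
      · simp only [hg, if_true]; exact_mod_cast ht2
      · intro k hk; simp only [hg, if_neg hk]
    obtain ⟨i, hi, hi1, hi2, hi3⟩ := seg 0 (by rw [hN]; omega)
    obtain ⟨j, hj, hj1, hj2, hj3⟩ := seg (8 * l ^ 2) (by rw [hN]; omega)
    obtain ⟨u, hu, hlu⟩ := (hgM i hi).ex
    obtain ⟨v, hv, hlv⟩ := (hgM j hj).ex
    have hlz : (l : ℤ) * 3 ≤ (l : ℤ) ^ 2 := by
      have : l * 3 ≤ l ^ 2 := by nlinarith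
      exact_mod_cast this
    have hl3 : (3 : ℤ) ≤ l := by exact_mod_cast hl
    have hRz : (R : ℤ) = 4 * (l : ℤ) ^ 2 * (2 * r + 1) := by rw [hR]; push_cast; ring
    have hsr : (s : ℤ) ≤ r := by exact_mod_cast hs
    have hs0 : (0 : ℤ) ≤ s := by positivity
    refine ⟨u, ?_, large_of_lk (chain i hi j hj u hu v hv hlu hlv) ?_⟩
    · intro k
      have h1 := hu k
      simp only [ctr, Pi.zero_apply, sub_zero] at *
      by_cases hk : k = ⟨0, by omega⟩
      · rw [← hk] at hi1 hi2
        rw [hRz]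
        rw [abs_le] at *
        push_cast at *
        constructor <;> nlinarith
      · rw [hi3 k hk] at h1
        rw [hRz]
        rw [abs_le] at *
        push_cast at *
        constructor <;> nlinarith
    · intro hcon
      have h1 := hcon ⟨0, by omega⟩
      have h2 := hu ⟨0, by omega⟩
      have h3 := hv ⟨0, by omega⟩
      simp only [ctr] at h2 h3
      rw [hRz] at h1
      rw [abs_le] at *
      push_cast at *
      nlinarith
  · rw [ctr_zero]
    have hook : ∀ x ∈ bx (0 : V d) (3 * R), Large ω R x → ∃ i ∈ M, ∃ u ∈ bx (ctr (2 * r + 1) i) s, Large a r u ∧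
        Lk ω (bx 0 ((10 + C) * R)) x u := by
      intro x hx hL
      obtain ⟨i, hi, hH⟩ := hH x hx hL
      unfold TT at hi
      classical
      rw [Finset.mem_filter] at hi
      obtain ⟨hiM, v, hv, rfl⟩ := hi
      obtain ⟨u, hu, hlu⟩ := (hgM _ hiM).ex
      refine ⟨_, hiM, u, hu, hlu, ?_⟩
      have h1 := mem_clF.1 hv
      have h2 := box_conn hH (site_mem r v) (bx_mono _ hs hu)
      refine (h1.mono (bx_subset hx ?_)).trans (h2.mono (bx_subset (hbig _ (hM.1 hiM).1) ?_))
      · nlinarith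
      · nlinarith
    intro x hx y hy hlx hly
    obtain ⟨i, hi, u, hu, hlu, hxu⟩ := hook x hx hlx
    obtain ⟨j, hj, v, hv, hlv, hyv⟩ := hook y hy hly
    exact (hxu.trans (chain i hi j hj u hu v hv hlu hlv)).trans hyv.symm'

end Part9

section Part10

variable {d : ℕ}

abbrev Cfg2 (d : ℕ) := Edge d × Bool → Bool

def cfgA (ω : Cfg2 d) : Config d := fun e => ω (e, false)

def cfgO (ω : Cfg2 d) : Config d := fun e => ω (e, false) || ω (e, true)

open Classical in
noncomputable def badSet (r C s N : ℕ) (a : Config d) : Finset (V d) :=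
  (bxF 0 N).filter fun i => ¬ Good r C s a i

lemma mem_badSet {r C s N : ℕ} {a : Config d} {i : V d} :
    i ∈ badSet r C s N a ↔ i ∈ bx 0 N ∧ ¬ Good r C s a i := by
  classical
  simp only [badSet, Finset.mem_filter, mem_bxF]

open Classical in
noncomputable def bigE (r C N : ℕ) : Finset (Edge d × Bool) :=
  ((bxF (0 : V d) N).biUnion fun i => edgesIn (bxF (ctr (2 * r + 1) i) (C * (2 * r + 1)))).image
    fun e => (e, false)

lemma badSet_dep {r C s N : ℕ} (hs : s ≤ r) (hC : 3 ≤ C) (B0 : Finset (V d)) :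
    Dep (bigE r C N) {ω : Cfg2 d | badSet r C s N (cfgA ω) = B0} := by
  classical
  intro ω ω' h hω
  simp only [Set.mem_ofPred_eq] at hω ⊢
  rw [← hω]
  ext i
  rw [mem_badSet, mem_badSet]
  refine and_congr_right fun hi => ?_
  have key : ∀ e ∈ edgesIn (bxF (ctr (2 * r + 1) i) (C * (2 * r + 1))), cfgA ω e = cfgA ω' e := by
    intro e he
    refine h (e, false) ?_
    unfold bigE
    exact Finset.mem_image.2 ⟨e, Finset.mem_biUnion.2 ⟨i, mem_bxF.2 hi, he⟩, rfl⟩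
  exact not_congr ⟨fun hg => hg.agree hs hC fun e he => (key e he).symm, fun hg => hg.agree hs hC key⟩

def touches (C0 : Finset (V d)) (e : Edge d) : Prop := ∃ v ∈ e.1, v ∈ C0

lemma touches_left {C0 : Finset (V d)} {x y : V d} (h : sym2dist1 s(x, y) = 1) (hx : x ∈ C0) :
    touches C0 (⟨s(x, y), h⟩ : Edge d) := ⟨x, Sym2.mem_mk_left x y, hx⟩

lemma clF_dep {ω ω' : Config d} {x : V d} {R : ℕ}
    (h : ∀ e ∈ edgesIn (bxF x (R + 1)), touches (clF ω x R) e → ω e = ω' e) :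
    clF ω' x R = clF ω x R := by
  have hx : x ∈ clF ω x R := mem_clF.2 (LinkR.refl (mem_bx_self _ _))
  have hmem : ∀ a b, a ∈ bx x (R + 1) → b ∈ bx x (R + 1) → ∀ hh : sym2dist1 s(a, b) = 1,
      (⟨s(a, b), hh⟩ : Edge d) ∈ edgesIn (bxF x (R + 1)) := by
    intro a b ha hb hh
    exact mem_edgesIn.2 (Finset.mk_mem_sym2_iff.2 ⟨mem_bxF.2 ha, mem_bxF.2 hb⟩)
  ext v
  constructor
  · intro hv
    refine (mem_clF.1 hv).induct (P := fun v => v ∈ clF ω x R) hx ?_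
    intro a b hla ha hab hb
    obtain ⟨hh, ho⟩ := hab
    have := h _ (hmem a b hla.right hb hh) (touches_left hh ha)
    exact mem_clF.2 ((mem_clF.1 ha).tail ⟨hh, this.trans ho⟩ hb)
  · intro hv
    refine ((mem_clF.1 hv).induct (P := fun v => v ∈ clF ω x R ∧ v ∈ clF ω' x R)
      ⟨hx, mem_clF.2 (LinkR.refl (mem_bx_self _ _))⟩ ?_).2
    rintro a b hla ⟨ha, ha'⟩ hab hb
    obtain ⟨hh, ho⟩ := hab
    have := h _ (hmem a b hla.right hb hh) (touches_left hh ha)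
    exact ⟨mem_clF.2 ((mem_clF.1 ha).tail ⟨hh, ho⟩ hb),
      mem_clF.2 ((mem_clF.1 ha').tail ⟨hh, this.symm.trans ho⟩ hb)⟩

lemma edge_box_site {r : ℕ} {e : Edge d} {i v : V d} (h : e ∈ edgesIn (bxF (ctr (2 * r + 1) i) r))
    (hv : v ∈ e.1) : site r v = i := by
  have h1 := Finset.mem_sym2_iff.1 (mem_edgesIn.1 h) v hv
  exact bx_site_unique (site_mem r v) (mem_bxF.1 h1)

lemma edge_mem (e : Edge d) : ∃ v, v ∈ e.1 := by
  obtain ⟨e, he⟩ := e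
  induction e with | _ x y => exact ⟨x, Sym2.mem_mk_left x y⟩

open Classical in
noncomputable def trueE (r : ℕ) (i : V d) : Finset (Edge d × Bool) :=
  (edgesIn (bxF (ctr (2 * r + 1) i) r)).image fun e => (e, true)

def notH (r : ℕ) (i : V d) : Set (Cfg2 d) :=
  {ω | ¬ ∀ e ∈ edgesIn (bxF (ctr (2 * r + 1) i) r), ω (e, true) = true}

lemma notH_dep (r : ℕ) (i : V d) : Dep (trueE r i) (notH r i) := by
  classical
  intro ω ω' h hω hall
  refine hω fun e he => ?_
  rw [h (e, true) (Finset.mem_image.2 ⟨e, he, rfl⟩)]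
  exact hall e he

lemma card_edgesIn_le (c : V d) (r : ℕ) : (edgesIn (bxF c r)).card ≤ Nat.choose ((2 * r + 1) ^ d + 1) 2 := by
  have h : (edgesIn (bxF c r)).card ≤ (bxF c r).sym2.card :=
    Finset.card_le_card_of_injOn (fun e => e.1) (fun e he => mem_edgesIn.1 he)
      (fun a _ b _ h => Subtype.ext h)
  rwa [Finset.card_sym2, card_bxF] at h

lemma edgesIn_nonempty (hd : 2 ≤ d) (c : V d) {r : ℕ} (hr : 1 ≤ r) : (edgesIn (bxF c r)).Nonempty := by
  classical
  set y : V d := fun k => if k = ⟨0, by omega⟩ then c k + 1 else c k with hy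
  have h1 : sym2dist1 s(c, y) = 1 := by
    change dist1 c y = 1
    unfold dist1
    rw [Finset.sum_eq_single ⟨0, by omega⟩]
    · simp [hy]
    · intro b _ hb; simp [hy, hb]
    · simp
  refine ⟨⟨s(c, y), h1⟩, mem_edgesIn.2 (Finset.mk_mem_sym2_iff.2 ⟨mem_bxF.2 (mem_bx_self _ _), mem_bxF.2 ?_⟩)⟩
  intro k
  simp only [hy]
  split_ifs
  · simp; omega
  · simp

lemma notH_prob {p1 s' : ℝ} (h0 : 0 ≤ s') (h1 : s' ≤ 1) (r : ℕ) (i : V d) :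
    BP (fun k : Edge d × Bool => if k.2 then s' else p1) (notH r i) =
      1 - ENNReal.ofReal s' ^ (edgesIn (bxF (ctr (2 * r + 1) i) r)).card := by
  classical
  have h2 : (notH r i : Set (Cfg2 d))ᶜ = {ω | ∀ k ∈ trueE r i, ω k = true} := by
    ext ω
    simp [notH, trueE]
  have h3 := BP_cyl (p := fun k : Edge d × Bool => if k.2 then s' else p1) (trueE r i) (fun _ => true)
  rw [← h2] at h3
  rw [← compl_compl (notH r i), prob_compl_eq_one_sub (notH_dep r i).compl.measurableSet, h3]
  congr 1
  unfold trueE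
  rw [Finset.prod_image (by intro a _ b _ h; exact (Prod.mk.inj h).1)]
  simp only [if_true]
  rw [Finset.prod_congr rfl fun e _ => bern_singleton h0 h1 true]
  simp

def FX (r C s N l R : ℕ) (x : V d) : Set (Cfg2 d) :=
  {ω | l ≤ (TT r (Mfun l N (badSet r C s N (cfgA ω))) (clF (cfgO ω) x R)).card ∧
    ∀ i ∈ TT r (Mfun l N (badSet r C s N (cfgA ω))) (clF (cfgO ω) x R), ω ∈ notH r i}

lemma FX_prob (hd : 2 ≤ d) {r C s N l R : ℕ} (hs : s < r) (hC : 3 ≤ C) {p1 s' s0 : ℝ} (hs0 : 0 ≤ s0) (hss : s0 ≤ s')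
    (h1 : s' < 1) (x : V d) :
    BP (fun k : Edge d × Bool => if k.2 then s' else p1) (FX r C s N l R x) ≤
      (1 - ENNReal.ofReal s0 ^ (Nat.choose ((2 * r + 1) ^ d + 1) 2)) ^ l := by
  classical
  set μ := BP (fun k : Edge d × Bool => if k.2 then s' else p1) with hμ
  set e : ℝ≥0∞ := 1 - ENNReal.ofReal s0 ^ (Nat.choose ((2 * r + 1) ^ d + 1) 2) with he
  set B : Finset (V d) → Set (Cfg2 d) := fun B0 => {ω | badSet r C s N (cfgA ω) = B0} with hB
  set K : Finset (V d) → Finset (Finset (V d)) := fun B0 =>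
    (bxF x (R + 1)).powerset.filter fun C0 => l ≤ (TT r (Mfun l N B0) C0).card with hK
  set A : Finset (V d) → Finset (V d) → Set (Cfg2 d) := fun B0 C0 => B B0 ∩ {ω | clF (cfgO ω) x R = C0} with hA
  have hSlt : ENNReal.ofReal s' < 1 := by rw [ENNReal.ofReal_lt_one]; exact h1
  have main : ∀ B0, μ (⋃ k ∈ K B0, A B0 k ∩ ⋂ j ∈ TT r (Mfun l N B0) k, notH r j) ≤ e ^ l * μ (B B0) := by
    intro B0
    have hEdis : ∀ (T : Finset (Edge d)) (j : V d), Disjoint (T.image fun e => (e, false)) (trueE r j) := by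
      intro T j
      rw [Finset.disjoint_left]
      intro k hk hk'
      obtain ⟨e1, _, rfl⟩ := Finset.mem_image.1 hk
      obtain ⟨e2, _, h⟩ := Finset.mem_image.1 hk'
      simp at h
    refine explore (BP_ind _) (Mfun l N B0) (trueE r) (notH r) (notH_dep r) ?_ ?_ ?_ tsub_le_self
      (badSet_dep hs.le hC B0) ?_ (K B0) (A B0) (fun C0 => TT r (Mfun l N B0) C0)
      (fun C0 => bigE r C N ∪ ((edgesIn (bxF x (R + 1))).image (fun e => (e, false)) ∪
        ((edgesIn (bxF x (R + 1))).filter (touches C0)).image (fun e => (e, true)))) ?_ ?_ ?_ ?_ ?_ l ?_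
    · intro i _ j _ hij
      rw [Finset.disjoint_left]
      intro k hk hk'
      obtain ⟨e1, h1, rfl⟩ := Finset.mem_image.1 hk
      obtain ⟨e2, h2, h⟩ := Finset.mem_image.1 hk'
      obtain rfl := (Prod.mk.inj h).1
      obtain ⟨v, hv⟩ := edge_mem e2
      exact hij ((edge_box_site h1 hv).symm.trans (edge_box_site h2 hv))
    · intro j
      rw [notH_prob (hs0.trans hss) h1.le]
      apply tsub_le_tsub_left
      refine le_trans (pow_le_pow_right_of_le_one' ?_ (card_edgesIn_le _ _)) (pow_le_pow_left' (ENNReal.ofReal_le_ofReal hss) _)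
      exact (ENNReal.ofReal_le_ofReal hss).trans hSlt.le
    · intro j
      rw [notH_prob (hs0.trans hss) h1.le]
      have : ENNReal.ofReal s' ^ (edgesIn (bxF (ctr (2 * r + 1) j) r)).card < 1 :=
        pow_lt_one₀ zero_le hSlt (Finset.card_ne_zero.2 (edgesIn_nonempty hd _ (by omega)))
      exact (tsub_pos_of_lt this).ne'
    · intro j _; exact hEdis _ j
    · intro C0 hC0
      refine ((badSet_dep hs.le hC B0).mono Finset.subset_union_left).inter (Dep.mono ?_ Finset.subset_union_right)
      intro ω ω' h hω
      simp only [Set.mem_ofPred_eq] at hω ⊢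
      rw [← hω]
      apply clF_dep
      intro e1 he1 ht
      have ha := h (e1, false) (Finset.mem_union_left _ (Finset.mem_image.2 ⟨e1, he1, rfl⟩))
      have hb := h (e1, true) (Finset.mem_union_right _ (Finset.mem_image.2 ⟨e1, Finset.mem_filter.2 ⟨he1, hω ▸ ht⟩, rfl⟩))
      simp only [cfgO, ha, hb]
    · intro C0 _; exact Set.inter_subset_left
    · intro C0 _ C1 _ hne
      rw [Set.disjoint_left]
      rintro ω ⟨_, h1⟩ ⟨_, h2⟩
      exact hne (h1.symm.trans h2)
    · intro C0 _; unfold TT; exact Finset.filter_subset _ _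
    · intro C0 _ j hj hjT
      rw [Finset.disjoint_union_left, Finset.disjoint_union_left]
      refine ⟨hEdis _ j, hEdis _ j, ?_⟩
      rw [Finset.disjoint_left]
      intro k hk hk'
      obtain ⟨e1, h1, rfl⟩ := Finset.mem_image.1 hk
      obtain ⟨e2, h2, h⟩ := Finset.mem_image.1 hk'
      obtain rfl := (Prod.mk.inj h).1
      obtain ⟨_, v, hv, hvC⟩ := Finset.mem_filter.1 h1
      apply hjT
      unfold TT
      exact Finset.mem_filter.2 ⟨hj, v, hvC, edge_box_site h2 hv⟩
    · intro C0 hC0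
      exact (Finset.mem_filter.1 hC0).2
  have hsub : FX r C s N l R x ⊆ ⋃ B0 ∈ (bxF (0 : V d) N).powerset,
      ⋃ k ∈ K B0, A B0 k ∩ ⋂ j ∈ TT r (Mfun l N B0) k, notH r j := by
    rintro ω ⟨h1, h2⟩
    simp only [Set.mem_iUnion]
    refine ⟨badSet r C s N (cfgA ω), ?_, clF (cfgO ω) x R, ?_, ⟨rfl, rfl⟩, ?_⟩
    · rw [Finset.mem_powerset]; intro i hi; exact mem_bxF.2 (mem_badSet.1 hi).1
    · refine Finset.mem_filter.2 ⟨?_, h1⟩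
      rw [Finset.mem_powerset]; intro i hi; exact mem_bxF.2 (mem_clF.1 hi).right
    · simp only [Set.mem_iInter]; exact h2
  calc μ (FX r C s N l R x) ≤ ∑ B0 ∈ (bxF (0 : V d) N).powerset, e ^ l * μ (B B0) :=
        (measure_mono hsub).trans ((measure_biUnion_finset_le _ _).trans (Finset.sum_le_sum fun B0 _ => main B0))
    _ = e ^ l * μ (⋃ B0 ∈ (bxF (0 : V d) N).powerset, B B0) := by
        rw [← Finset.mul_sum, measure_biUnion_finset]
        · intro B0 _ B1 _ hne
          refine Set.disjoint_left.2 ?_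
          intro ω h1 h2
          exact hne (Eq.trans (Eq.symm h1) h2)
        · intro B0 _; exact (badSet_dep hs.le hC B0).measurableSet
    _ ≤ e ^ l * 1 := by gcongr; exact prob_le_one
    _ = e ^ l := mul_one _

end Part10

section Part11

variable {d : ℕ}

lemma tend_poly (k : ℕ) {c e : ℝ≥0∞} (hc : c ≠ ⊤) (he : e < 1) :
    Tendsto (fun l : ℕ => c * (l : ℝ≥0∞) ^ k * e ^ l) atTop (𝓝 0) := by
  lift c to NNReal using hc
  lift e to NNReal using he.ne_top
  have he' : (e : ℝ) < 1 := by exact_mod_cast he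
  have h1 := (tendsto_pow_const_mul_const_pow_of_abs_lt_one (r := (e : ℝ)) k
    (by rwa [abs_of_nonneg e.coe_nonneg])).const_mul (c : ℝ)
  rw [mul_zero] at h1
  have h2 := ENNReal.tendsto_ofReal h1
  rw [ENNReal.ofReal_zero] at h2
  refine h2.congr fun l => ?_
  rw [ENNReal.ofReal_mul c.coe_nonneg, ENNReal.ofReal_mul (by positivity), ENNReal.ofReal_pow (by positivity),
    ENNReal.ofReal_pow e.coe_nonneg, ENNReal.ofReal_natCast, ENNReal.ofReal_coe_nnreal, ENNReal.ofReal_coe_nnreal, mul_assoc]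

lemma big_bad {p1 : ℝ} {r C s : ℕ} (hs : s ≤ r) (hC : 3 ≤ C)
    (hb : ∀ i, PB d p1 {a | ¬ Good r C s a i} ≤ ((2 * 9 ^ d)⁻¹ : ℝ≥0∞) ^ ((2 * C + 1) ^ d)) (N l : ℕ) :
    PB d p1 {a | ∃ S : Finset (V d), S ⊆ badSet r C s N a ∧ SConn (S : Set (V d)) ∧ l < S.card} ≤
      (((2 * N + 1) ^ d : ℕ) : ℝ≥0∞) * (((2 * N + 1) ^ d + 1 : ℕ) : ℝ≥0∞) * (2⁻¹) ^ l := by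
  classical
  have h9 : (1 : ℝ≥0∞) ≤ 2 * 9 ^ d := by
    exact_mod_cast Nat.one_le_iff_ne_zero.2 (by positivity : 2 * 9 ^ d ≠ 0)
  have hsp : Sparse (PB d p1) (fun i : V d => {a | ¬ Good r C s a i}) (2 * 9 ^ d)⁻¹ := by
    refine sparse_of_dep (BP_ind _) (good_dep hs hC) (2 * C) ?_ (ENNReal.inv_le_one.2 h9) hb
    rintro i j ⟨k, hk⟩
    rw [Finset.disjoint_left]
    intro e h1 h2
    obtain ⟨v, hv⟩ := edge_mem e
    have h3 := mem_bxF.1 (Finset.mem_sym2_iff.1 (mem_edgesIn.1 h1) v hv) k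
    have h4 := mem_bxF.1 (Finset.mem_sym2_iff.1 (mem_edgesIn.1 h2) v hv) k
    simp only [ctr] at h3 h4
    rw [abs_le] at h3 h4
    push_cast at *
    have hr : (0 : ℤ) ≤ r := by positivity
    rcases lt_abs.1 hk with h | h <;> nlinarith
  have h92 : (9 ^ d * (2 * 9 ^ d)⁻¹ : ℝ≥0∞) = 2⁻¹ := by
    rw [ENNReal.mul_inv (by simp) (by simp), mul_comm, mul_assoc, ENNReal.inv_mul_cancel (by simp) (by simp), mul_one]
  have hsub : {a | ∃ S : Finset (V d), S ⊆ badSet r C s N a ∧ SConn (S : Set (V d)) ∧ l < S.card} ⊆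
      ⋃ x ∈ bxF (0 : V d) N, ⋃ n ∈ (Finset.range ((2 * N + 1) ^ d + 1)).filter (fun n => l < n),
        {ω | ∃ C' : Finset (V d), SConn (C' : Set (V d)) ∧ x ∈ C' ∧ C'.card = n ∧
          ∀ i ∈ C', ω ∈ (fun i : V d => {a | ¬ Good r C s a i}) i} := by
    rintro a ⟨S, hS, hSc, hl⟩
    obtain ⟨x, hx⟩ := Finset.card_pos.1 (by omega : 0 < S.card)
    have hSb : S ⊆ bxF 0 N := fun i hi => mem_bxF.2 (mem_badSet.1 (hS hi)).1
    simp only [Set.mem_iUnion]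
    refine ⟨x, hSb hx, S.card, ?_, S, hSc, hx, rfl, fun i hi => (mem_badSet.1 (hS hi)).2⟩
    have := Finset.card_le_card hSb
    rw [card_bxF] at this
    simp only [Finset.mem_filter, Finset.mem_range]
    omega
  refine (measure_mono hsub).trans ((measure_biUnion_finset_le _ _).trans ?_)
  refine (Finset.sum_le_sum fun x _ => (measure_biUnion_finset_le _ _).trans
    (Finset.sum_le_sum (g := fun _ => (2⁻¹ : ℝ≥0∞) ^ l) fun n hn => ?_)).trans ?_
  · refine (peierls hsp x n).trans ?_
    rw [h92]
    exact pow_le_pow_right_of_le_one' (by simp [ENNReal.inv_le_one]) (Finset.mem_filter.1 hn).2.le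
  · rw [Finset.sum_const, Finset.sum_const, card_bxF, nsmul_eq_mul, nsmul_eq_mul, mul_assoc]
    gcongr
    exact (Finset.card_filter_le _ _).trans (by simp)

lemma rgood_prob (hd : 2 ≤ d) {p1 p0 : ℝ} {t : V d → ℝ} (ht : ASTimeConstant (PB d p1) t) (hpos : ∀ x ≠ 0, 0 < t x)
    (hp1 : 0 ≤ p1) (hp10 : p1 < p0) :
    ∃ C : ℕ, 5 ≤ C ∧ ∀ η : ℝ≥0∞, 0 < η → ∃ R, 1 ≤ R ∧ ∀ p, p0 ≤ p → p < 1 → ∀ J,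
      PB d p {a | ¬ RGood R C a J} ≤ η := by
  classical
  obtain ⟨C, hC, hG⟩ := good_prob hd ht hpos
  obtain ⟨s, r, hsr, hb⟩ := hG (((2 * 9 ^ d)⁻¹ : ℝ≥0∞) ^ ((2 * C + 1) ^ d)) (by
    apply ENNReal.pow_pos
    rw [ENNReal.inv_pos]
    exact ENNReal.mul_ne_top (by simp) (by simp))
  refine ⟨10 + C, by omega, fun η hη => ?_⟩
  set s0 : ℝ := (p0 - p1) / (1 - p1) with hs0
  set e : ℝ≥0∞ := 1 - ENNReal.ofReal s0 ^ (Nat.choose ((2 * r + 1) ^ d + 1) 2) with he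
  by_cases hp01 : p0 < 1
  swap
  · exact ⟨1, le_rfl, fun p h1 h2 => absurd (h1.trans_lt h2) hp01⟩
  have hs0pos : 0 < s0 := div_pos (by linarith) (by linarith)
  have he1 : e < 1 := by
    refine ENNReal.sub_lt_self (by simp) (by simp) ?_
    exact pow_ne_zero _ (by simpa using hs0pos)
  have hlim := (tend_poly (4 * d) (c := 2 * 81 ^ (2 * d)) (e := 2⁻¹) (ENNReal.mul_ne_top (by simp) (by simp))
      (by rw [ENNReal.inv_lt_one]; simp)).add
    (tend_poly (2 * d) (c := (25 * (2 * r + 1)) ^ d) (ENNReal.pow_ne_top (by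
      exact_mod_cast ENNReal.natCast_ne_top (25 * (2 * r + 1)))) he1)
  rw [add_zero] at hlim
  obtain ⟨l, hl, hl3⟩ := ((hlim.eventually_lt_const hη).and (eventually_ge_atTop 3)).exists
  set R := 4 * l ^ 2 * (2 * r + 1) with hR
  set N := 40 * l ^ 2 with hN
  have hl2 : 9 ≤ l ^ 2 := by nlinarith
  have hR1 : 1 ≤ R := by rw [hR]; nlinarith
  refine ⟨R, hR1, fun p hp hp' J => (rbad_le p hR1 (by omega) J).trans ?_⟩
  refine le_trans ?_ hl.le
  set s' : ℝ := (p - p1) / (1 - p1) with hs'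
  have h1p : 0 < 1 - p1 := by linarith
  have hss : s0 ≤ s' := div_le_div_of_nonneg_right (by linarith) h1p.le
  have hs'1 : s' < 1 := by rw [div_lt_one h1p]; linarith
  set ν := BP (fun k : Edge d × Bool => if k.2 then s' else p1) with hν
  have hO : ν.map cfgO = PB d p := by
    have := BP_or (ι := Edge d) (a := p1) (b := s') hp1 (by linarith) (hs0pos.le.trans hss) hs'1.le
    refine this.trans ?_
    unfold PB
    congr 1
    funext _
    rw [hs']
    field_simp
    ring
  have hA : ν.map cfgA = PB d p1 := by
    have := BP_reindex (fun e : Edge d => (e, false)) (fun a b h => (Prod.mk.inj h).1)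
      (fun k : Edge d × Bool => if k.2 then s' else p1)
    exact this
  have hmO : Measurable (cfgO : Cfg2 d → Config d) := by
    unfold cfgO; rw [measurable_pi_iff]
    intro e
    have h1 : Measurable fun ω : Cfg2 d => (ω (e, false), ω (e, true)) := by fun_prop
    exact (measurable_of_countable fun b : Bool × Bool => b.1 || b.2).comp h1
  have hmA : Measurable (cfgA : Cfg2 d → Config d) := by unfold cfgA; fun_prop
  rw [← hO, Measure.map_apply hmO (rgood_dep hR1 (by omega) 0).measurableSet]
  set E1 := {a : Config d | ∃ S : Finset (V d), S ⊆ badSet r C s N a ∧ SConn (S : Set (V d)) ∧ l < S.card} with hE1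
  have hsub : cfgO ⁻¹' {a : Config d | ¬ RGood R (10 + C) a 0} ⊆ cfgA ⁻¹' E1 ∪ ⋃ x ∈ bxF (0 : V d) (3 * R), FX r C s N l R x := by
    intro ω hω
    by_contra hcon
    simp only [Set.mem_union, not_or, Set.mem_iUnion, not_exists] at hcon
    obtain ⟨h1, h2⟩ := hcon
    apply hω
    have hB : ∀ S : Finset (V d), S ⊆ badSet r C s N (cfgA ω) → SConn (S : Set (V d)) → S.card ≤ l := by
      intro S hS hSc
      by_contra hc
      exact h1 ⟨S, hS, hSc, not_le.1 hc⟩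
    have hM := Mfun_spec hd (N := N) (by rw [hN]; nlinarith) hB
    refine rgood_of hd hsr.le (by omega) hl3 hR hN hM (a := cfgA ω) ?_ ?_ ?_
    · intro e he; simp only [cfgA, cfgO] at *; simp [he]
    · intro i hi hiB
      by_contra hg
      exact hiB (mem_badSet.2 ⟨hi, hg⟩)
    · intro x hx hL
      have h3 := touch (by omega) hR hN hM hx hL
      have h4 := h2 x (mem_bxF.2 hx)
      by_contra hc
      push Not at hc
      apply h4
      refine ⟨h3, fun i hi hall => ?_⟩
      obtain ⟨e, he, hne⟩ := hc i hi
      apply hne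
      simp only [cfgO, hall e he, Bool.or_true]
  refine (measure_mono hsub).trans ((measure_union_le _ _).trans (add_le_add ?_ ?_))
  · refine (Measure.le_map_apply hmA.aemeasurable _).trans ?_
    rw [hA]
    refine (big_bad hsr.le hC hb N l).trans ?_
    refine mul_le_mul_left ?_ _
    have h1 : (2 * N + 1) ^ d ≤ 81 ^ d * l ^ (2 * d) := by
      rw [pow_mul, ← mul_pow]
      gcongr
      rw [hN]; nlinarith
    have h2 : 1 ≤ 81 ^ d * l ^ (2 * d) := Nat.one_le_iff_ne_zero.2 (by positivity)
    have h3 : (2 * N + 1) ^ d * ((2 * N + 1) ^ d + 1) ≤ 2 * 81 ^ (2 * d) * l ^ (4 * d) := by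
      calc _ ≤ (81 ^ d * l ^ (2 * d)) * (81 ^ d * l ^ (2 * d) + 81 ^ d * l ^ (2 * d)) := by gcongr
        _ = _ := by ring
    exact_mod_cast h3
  · refine (measure_biUnion_finset_le _ _).trans ((Finset.sum_le_sum fun x _ => FX_prob hd hsr hC hs0pos.le hss hs'1 x).trans ?_)
    rw [Finset.sum_const, card_bxF, nsmul_eq_mul]
    gcongr
    have h1 : (2 * (3 * R) + 1) ^ d ≤ (25 * (2 * r + 1)) ^ d * l ^ (2 * d) := by
      rw [pow_mul, ← mul_pow]
      gcongr
      rw [hR]; nlinarith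
    exact_mod_cast h1

end Part11

section Part12

variable {d : ℕ}

def jj (R : ℕ) (v : V d) : V d := fun k => v k / (R : ℤ)

lemma jj_mem {R : ℕ} (hR : 1 ≤ R) (v : V d) : v ∈ bx (ctr R (jj R v)) R := by
  intro k
  simp only [ctr, jj]
  have hR' : (0 : ℤ) < R := by exact_mod_cast hR
  have h1 := Int.emod_add_mul_ediv (v k) R
  have h2 := Int.emod_nonneg (v k) hR'.ne'
  have h3 := Int.emod_lt_of_pos (v k) hR'
  rw [abs_le]
  constructor <;> linarith

lemma jj_nb {R : ℕ} (hR : 1 ≤ R) {u v : V d} (h : nb u v) : nb (jj R u) (jj R v) := by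
  intro k
  have hR' : (0 : ℤ) < R := by exact_mod_cast hR
  have h0 := abs_le.1 (h k)
  simp only [jj]
  have h1 : u k / (R : ℤ) ≤ v k / (R : ℤ) + 1 := by
    have := Int.ediv_le_ediv hR' (by linarith : u k ≤ v k + (R : ℤ))
    rwa [Int.add_ediv_of_dvd_right (dvd_refl _), Int.ediv_self hR'.ne'] at this
  have h2 : v k / (R : ℤ) ≤ u k / (R : ℤ) + 1 := by
    have := Int.ediv_le_ediv hR' (by linarith : v k ≤ u k + (R : ℤ))
    rwa [Int.add_ediv_of_dvd_right (dvd_refl _), Int.ediv_self hR'.ne'] at this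
  rw [abs_le]
  constructor <;> linarith

lemma open_transfer {ω U : Config d} {S : Finset (V d)} (h : ∀ e ∈ edgesIn S, U e = true → ω e = true)
    {a b : V d} (ha : a ∈ S) (hb : b ∈ S) (hab : edgeOpen U a b) : edgeOpen ω a b := by
  obtain ⟨hh, ho⟩ := hab
  exact ⟨hh, h _ (mem_edgesIn.2 (Finset.mk_mem_sym2_iff.2 ⟨ha, hb⟩)) ho⟩

lemma infinite_of_lk {ω : Config d} {S : Set (V d)} {x y : V d} (h : Lk ω S x y)
    (hy : InInfiniteCluster ω y) : InInfiniteCluster ω x := by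
  unfold InInfiniteCluster at *
  refine hy.mono fun z hz => ?_
  exact connected_iff.2 ((h.mono (Set.subset_univ _)).trans (connected_iff.1 hz))

lemma large_of_not_bad {ω U : Config d} {R m t : ℕ} {f : ℕ → V d} (hf : IsOpenPath U m f)
    (hz : InInfiniteCluster ω (f m)) (ht : t ≤ m) {J : V d} (hJ : f t ∈ bx (ctr R J) R) (hR : 1 ≤ R)
    (hop : ∀ e ∈ edgesIn (bxF (ctr R J) (3 * R)), U e = true → ω e = true) : Large ω R (f t) := by
  classical
  have hsub : bx (f t) (R + 1) ⊆ bx (ctr R J) (3 * R) := bx_subset hJ (by omega)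
  have hop' : ∀ i, i < m → f i ∈ bx (f t) (R + 1) → f (i + 1) ∈ bx (f t) (R + 1) → edgeOpen ω (f i) (f (i + 1)) :=
    fun i hi h1 h2 => open_transfer hop (mem_bxF.2 (hsub h1)) (mem_bxF.2 (hsub h2)) (hf i hi)
  by_cases hex : ∃ s, t ≤ s ∧ s ≤ m ∧ f s ∉ bx (f t) R
  · set s := Nat.find hex with hs
    obtain ⟨h1, h2, h3⟩ := Nat.find_spec hex
    have hmin : ∀ i, t ≤ i → i < s → f i ∈ bx (f t) R := by
      intro i hi his
      by_contra hc
      exact Nat.find_min hex his ⟨hi, by omega, hc⟩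
    have hne : s ≠ t := fun h => h3 (by rw [← hs, h]; exact mem_bx_self _ _)
    have hs1 : f s ∈ bx (f t) (R + 1) := by
      have h4 := hmin (s - 1) (by omega) (by omega)
      have h5 := edgeOpen_nb (hf (s - 1) (by omega))
      rw [Nat.sub_add_cancel (by omega)] at h5
      refine bx_trans h4 ?_
      exact fun k => by rw [abs_sub_comm]; exact_mod_cast h5 k
    have hin : ∀ i, t ≤ i → i ≤ s → f i ∈ bx (f t) (R + 1) := by
      intro i hi his
      rcases his.lt_or_eq with h | h
      · exact bx_mono _ (by omega) (hmin i hi h)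
      · rw [h]; exact hs1
    have : Lk ω (bx (f t) (R + 1)) (f t) (f s) :=
      LinkR.of_subpath f t s h1 (fun i hi his => hop' i (by omega) (hin i hi (by omega)) (hin _ (by omega) (by omega))) hin
    exact large_of_lk this h3
  · push Not at hex
    have hin : ∀ i, t ≤ i → i ≤ m → f i ∈ bx (f t) (R + 1) := fun i h1 h2 => bx_mono _ (by omega) (hex i h1 h2)
    have : Lk ω (bx (f t) (R + 1)) (f t) (f m) :=
      LinkR.of_subpath f t m ht (fun i hi his => hop' i (by omega) (hin i hi (by omega)) (hin _ (by omega) (by omega))) hin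
    exact infinite_iff.1 (infinite_of_lk this hz) R

lemma bdy_link {ω : Config d} {R C : ℕ} {S : Set (V d)} (hS : SConn S) (hg : ∀ J ∈ S, RGood R C ω J)
    {W : Set (V d)} (hW : ∀ J ∈ S, bx (ctr R J) (C * R) ⊆ W) {J J' u v : V d} (hJ : J ∈ S) (hJ' : J' ∈ S)
    (hu : u ∈ bx (ctr R J) R) (hv : v ∈ bx (ctr R J') R) (hlu : Large ω R u) (hlv : Large ω R v) :
    Lk ω W u v := by
  have key : ∀ v ∈ bx (ctr R J') R, Large ω R v → Lk ω W u v := by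
    refine (hS J hJ J' hJ').induct (P := fun J' => ∀ v ∈ bx (ctr R J') R, Large ω R v → Lk ω W u v) ?_ ?_
    · intro v hv hlv
      exact ((hg J hJ).uniq u (bx_mono _ (by omega) hu) v (bx_mono _ (by omega) hv) hlu hlv).mono (hW J hJ)
    · intro a b hla ha hab hb v hv hlv
      obtain ⟨x, hx, hlx⟩ := (hg a hla.right).ex
      refine (ha x hx hlx).trans (((hg a hla.right).uniq x (bx_mono _ (by omega) hx) v ?_ hlx hlv).mono
        (hW a hla.right))
      exact bx_subset (ctr_nb hab) (by omega) hv
  exact key v hv hlv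

def comp (Bd : Set (V d)) (j : V d) : Set (V d) := {y | LinkR nb Bd j y}

lemma comp_sub {Bd : Set (V d)} {j y : V d} (h : y ∈ comp Bd j) : y ∈ Bd := LinkR.right h

lemma comp_self {Bd : Set (V d)} {j : V d} (h : j ∈ Bd) : j ∈ comp Bd j := LinkR.refl h

lemma comp_eq {Bd : Set (V d)} {i j z : V d} (h : z ∈ comp Bd i) (h' : z ∈ comp Bd j) : comp Bd i = comp Bd j := by
  have h1 : LinkR nb Bd i z := h
  have h2 : LinkR nb Bd j z := h'
  have h3 : LinkR nb Bd i j := h1.trans (h2.symm nb_symm)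
  ext y
  exact ⟨fun hy => (h3.symm nb_symm).trans hy, fun hy => h3.trans hy⟩

lemma bdy_not_bad {Bd : Set (V d)} {i j s : V d} (h : s ∈ bdy (comp Bd i) j) : s ∉ Bd := by
  intro hs
  obtain ⟨h1, a, ha, hnb⟩ := h
  have : LinkR nb Bd i a := ha
  exact (LinkR.right h1) (this.tail hnb hs)

lemma bypass {ω U : Config d} {R C m : ℕ} {f : ℕ → V d} (hR : 1 ≤ R) (hf : IsOpenPath U m f)
    (hz : InInfiniteCluster ω (f m)) {Bd : Set (V d)}
    (hBd : ∀ J, J ∉ Bd → RGood R C ω J ∧ ∀ e ∈ edgesIn (bxF (ctr R J) (3 * R)), U e = true → ω e = true)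
    (hH : ∀ t < m, ¬ edgeOpen ω (f t) (f (t + 1)) → jj R (f 0) ∈ cpt (comp Bd (jj R (f t))) (jj R (f m)))
    {W : Set (V d)} (hW1 : ∀ t ≤ m, f t ∈ W)
    (hW2 : ∀ t < m, ¬ edgeOpen ω (f t) (f (t + 1)) → ∀ j ∈ bdy (comp Bd (jj R (f t))) (jj R (f m)),
      bx (ctr R j) (C * R) ⊆ W) : Lk ω W (f 0) (f m) := by
  classical
  set J : ℕ → V d := fun t => jj R (f t) with hJ
  have hJm : ∀ t, f t ∈ bx (ctr R (J t)) R := fun t => jj_mem hR _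
  have hJn : ∀ t < m, nb (J t) (J (t + 1)) := fun t ht => jj_nb hR (edgeOpen_nb (hf t ht))
  have hclo : ∀ t < m, ¬ edgeOpen ω (f t) (f (t + 1)) → J t ∈ Bd := by
    intro t ht hc
    by_contra hn
    refine hc (open_transfer (hBd _ hn).2 (mem_bxF.2 (bx_mono _ (by omega) (hJm t))) (mem_bxF.2 ?_) (hf t ht))
    refine bx_subset (m := R) (n := 1) (hJm t) (by omega) ?_
    exact fun k => by rw [abs_sub_comm]; exact_mod_cast edgeOpen_nb (hf t ht) k
  have hlarge : ∀ t ≤ m, J t ∉ Bd → Large ω R (f t) := fun t ht hn =>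
    large_of_not_bad hf hz ht (hJm t) hR (hBd _ hn).2
  have claim : ∀ k ≤ m, ∀ t, m - k ≤ t → t ≤ m → (Lk ω W (f t) (f m) ∨
      ∃ s < m, ¬ edgeOpen ω (f s) (f (s + 1)) ∧ J t ∉ cpt (comp Bd (J s)) (J m)) := by
    intro k
    induction k with
    | zero =>
      intro _ t h1 h2
      obtain rfl : t = m := by omega
      exact Or.inl (LinkR.refl (hW1 _ le_rfl))
    | succ k ih =>
      intro hk t h1 h2
      have ih' := ih (by omega)
      by_cases htk : m - k ≤ t
      · exact ih' t htk h2
      have htm : t < m := by omega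
      rcases ih' (t + 1) (by omega) (by omega) with h | ⟨s, hs, hsc, hst⟩
      · by_cases ho : edgeOpen ω (f t) (f (t + 1))
        · exact Or.inl ((LinkR.single ho (hW1 t h2) (hW1 _ (by omega))).trans h)
        · exact Or.inr ⟨t, htm, ho, fun hcp => (LinkR.right hcp) (comp_self (hclo t htm ho))⟩
      · by_cases hJt : J t ∈ cpt (comp Bd (J s)) (J m)
        swap
        · exact Or.inr ⟨s, hs, hsc, hJt⟩
        set A := comp Bd (J s) with hA
        have hAin : J (t + 1) ∈ A := by
          by_contra hn
          exact hst (LinkR.tail hJt (hJn t htm) hn)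
        have hbt : J t ∈ bdy A (J m) := ⟨hJt, _, hAin, (hJn t htm).symm⟩
        have hmA : J m ∉ A := LinkR.left (hH s hs hsc)
        set t' := Nat.findGreatest (fun u => J u ∈ A) m with ht'
        have h3 : J t' ∈ A := Nat.findGreatest_spec (P := fun u => J u ∈ A) (m := t + 1) (by omega) hAin
        have h4 : t + 1 ≤ t' := Nat.le_findGreatest (by omega) hAin
        have h5 : t' ≤ m := Nat.findGreatest_le m
        have h6 : t' ≠ m := fun h => hmA (h ▸ h3)
        have h7 : ∀ u, t' < u → u ≤ m → J u ∉ A := fun u h1 h2 => Nat.findGreatest_is_greatest h1 h2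
        have h8 : J (t' + 1) ∈ cpt A (J m) := by
          have : LinkR nb Aᶜ (J (t' + 1)) (J m) :=
            LinkR.of_subpath J (t' + 1) m (by omega) (fun i hi him => hJn i him) (fun i hi him => h7 i (by omega) him)
          exact this.symm nb_symm
        have hbt' : J (t' + 1) ∈ bdy A (J m) := ⟨h8, _, h3, hJn t' (by omega)⟩
        have hlk : Lk ω W (f t) (f (t' + 1)) := by
          refine bdy_link (sconn_bdy (sconn_comp Bd (J s)) (J m)) (fun j hj => (hBd j (bdy_not_bad hj)).1)
            (hW2 s hs hsc) hbt hbt' (hJm t) (hJm (t' + 1)) ?_ ?_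
          · exact hlarge t h2 (bdy_not_bad hbt)
          · exact hlarge (t' + 1) (by omega) (bdy_not_bad hbt')
        rcases ih' (t' + 1) (by omega) (by omega) with h | ⟨s2, hs2, hsc2, hst2⟩
        · exact Or.inl (hlk.trans h)
        · refine Or.inr ⟨s2, hs2, hsc2, fun hcon => hst2 ?_⟩
          have hdis : ∀ z ∈ A, z ∉ comp Bd (J s2) := by
            intro z hz1 hz2
            rw [← comp_eq hz1 hz2] at hst2
            exact hst2 h8
          have e1 : LinkR nb (comp Bd (J s2))ᶜ (J m) (J (t + 1)) := LinkR.tail hcon (hJn t htm) (hdis _ hAin)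
          have e2 : LinkR nb (comp Bd (J s2))ᶜ (J (t + 1)) (J t') :=
            (sconn_comp Bd (J s) _ hAin _ h3).mono fun z hz => hdis z hz
          exact (e1.trans e2).tail (hJn t' (by omega)) fun hc => bdy_not_bad hbt' (comp_sub hc)
  rcases claim m le_rfl 0 (by omega) (by omega) with h | ⟨s, hs, hsc, hst⟩
  · exact h
  · exact absurd (hH s hs hsc) hst

end Part12

section Part13

variable {d : ℕ}

/-- no bad star-connected set is close to `J` relative to its size -/
def Hp (Bd : Set (V d)) (J : V d) : Prop :=
  ∀ D : Finset (V d), SConn (D : Set (V d)) → (D : Set (V d)) ⊆ Bd → ∀ i ∈ D, i ∉ bx J D.card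

lemma exists_bx (a b : V d) : ∃ n : ℕ, a ∈ bx b n := by
  refine ⟨dist1 a b, fun k => abs_le_dist1 a b k⟩

lemma comp_finite {Bd : Set (V d)} {J : V d} (h : Hp Bd J) (j : V d) : (comp Bd j).Finite := by
  classical
  obtain ⟨n, hn⟩ := exists_bx j J
  refine (bx_finite j n).subset ?_
  intro y hy
  by_contra hyn
  obtain ⟨m, f, hf, hS, h0, hm⟩ := LinkR.path hy
  have hD := sconn_path f 0 m (fun i _ hi => hf i hi)
  have hco : (((Finset.range (m + 1)).image f : Finset (V d)) : Set (V d)) = f '' {i | 0 ≤ i ∧ i ≤ m} := by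
    ext z
    simp only [Finset.coe_image, Finset.coe_range, Set.mem_image, Set.mem_Iio, Set.mem_ofPred_eq]
    constructor
    · rintro ⟨i, hi, rfl⟩; exact ⟨i, ⟨by omega, by omega⟩, rfl⟩
    · rintro ⟨i, hi, rfl⟩; exact ⟨i, by omega, rfl⟩
  rw [← hco] at hD
  have hj : j ∈ (Finset.range (m + 1)).image f := Finset.mem_image.2 ⟨0, by simp, h0⟩
  have hy' : y ∈ (Finset.range (m + 1)).image f := Finset.mem_image.2 ⟨m, by simp, hm⟩
  have h1 := sconn_diam hD hj hy'
  have h2 : n < ((Finset.range (m + 1)).image f).card := by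
    by_contra hlt
    exact hyn (bx_mono _ (by omega) h1)
  refine h _ hD ?_ j hj (bx_mono _ h2.le hn)
  intro z hz
  obtain ⟨i, hi, rfl⟩ := Finset.mem_image.1 (Finset.mem_coe.1 hz)
  exact hS i (by simpa [Nat.lt_succ_iff] using hi)

lemma comp_cpt (hd : 2 ≤ d) {Bd : Set (V d)} {J J' : V d} (h : Hp Bd J) (h' : Hp Bd J') (j : V d) :
    J ∈ cpt (comp Bd j) J' := by
  classical
  by_cases hj : j ∈ Bd
  · have hfin := comp_finite h j
    set D := hfin.toFinset with hDdef
    have hco : (D : Set (V d)) = comp Bd j := hfin.coe_toFinset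
    have hD : SConn (D : Set (V d)) := by rw [hco]; exact sconn_comp Bd j
    have hDB : (D : Set (V d)) ⊆ Bd := by rw [hco]; exact fun y hy => comp_sub hy
    have hjD : j ∈ D := by
      have : j ∈ (D : Set (V d)) := by rw [hco]; exact comp_self hj
      exact this
    have key : ∀ K, Hp Bd K → K ∉ bx j (D.card - 1) := by
      intro K hK hmem
      exact hK D hD hDB j hjD (bx_mono _ (by omega) (bx_symm hmem))
    refine (link_compl_bx hd (key _ h') (key _ h)).mono ?_
    refine Set.compl_subset_compl.2 ?_
    intro y hy
    rw [← hco] at hy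
    exact sconn_diam hD hjD hy
  · have : comp Bd j = ∅ := by
      ext y
      simp only [Set.mem_empty_iff_false, iff_false]
      intro hy
      exact hj (LinkR.left hy)
    rw [this]
    show LinkR nb ∅ᶜ J' J
    rw [Set.compl_empty]
    exact link_univ J' J

lemma det_bound (hd : 2 ≤ d) {Ω : Type*} {w : Ω} {bad : V d → Set Ω} {ω U : Config d} {R C m : ℕ} {f : ℕ → V d}
    (hR : 1 ≤ R) (hf : IsOpenPath U m f) (hz : InInfiniteCluster ω (f m))
    (hBd : ∀ J, w ∉ bad J → RGood R C ω J ∧ ∀ e ∈ edgesIn (bxF (ctr R J) (3 * R)), U e = true → ω e = true)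
    (h0 : Hp {i | w ∈ bad i} (jj R (f 0))) (hm : Hp {i | w ∈ bad i} (jj R (f m)))
    (A U' : Finset (V d)) (K T : ℕ) (hA : ∀ t < m, ¬ edgeOpen ω (f t) (f (t + 1)) → jj R (f t) ∈ A)
    (hU' : ∀ t ≤ m, jj R (f t) ∈ U') (hT : ¬ bigSum w bad K ∅ U' T) :
    distLe ω (f 0) (f m) ((m + 3 ^ d * (2 * (C * R) + 1) ^ d * (K * A.card + T) : ℕ) : ℝ) := by
  classical
  set Bd : Set (V d) := {i | w ∈ bad i} with hBdd
  have hfin : ∀ j, (comp Bd j).Finite := comp_finite h0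
  set A' : Finset (V d) := A.filter (fun a => a ∈ Bd ∧ ∃ t < m, a = jj R (f t)) with hA'
  set 𝒟 : Finset (Finset (V d)) := A'.image (fun a => (hfin a).toFinset) with h𝒟
  set G : Finset (V d) → Finset (V d) := fun D => (D.biUnion (fun i => bxF i 1)).biUnion
    (fun j => bxF (ctr R j) (C * R)) with hG
  set W : Finset (V d) := (Finset.range (m + 1)).image f ∪ 𝒟.biUnion G with hW
  have hlk : Lk ω (W : Set (V d)) (f 0) (f m) := by
    refine bypass (Bd := Bd) hR hf hz (fun J hJ => hBd J hJ) (fun t _ _ => comp_cpt hd h0 hm _) ?_ ?_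
    · intro t ht
      refine Finset.mem_coe.2 (Finset.mem_union_left _ (Finset.mem_image.2 ⟨t, ?_, rfl⟩))
      simpa [Nat.lt_succ_iff] using ht
    · intro t ht hcl j hj y hy
      obtain ⟨hj1, a, ha, hnb⟩ := hj
      have hjB : jj R (f t) ∈ Bd := LinkR.left ha
      refine Finset.mem_coe.2 (Finset.mem_union_right _ (Finset.mem_biUnion.2
        ⟨(hfin (jj R (f t))).toFinset, ?_, ?_⟩))
      · refine Finset.mem_image.2 ⟨jj R (f t), ?_, rfl⟩
        exact Finset.mem_filter.2 ⟨hA t ht hcl, hjB, t, ht, rfl⟩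
      · refine Finset.mem_biUnion.2 ⟨j, Finset.mem_biUnion.2 ⟨a, (hfin _).mem_toFinset.2 ha, ?_⟩, mem_bxF.2 hy⟩
        exact mem_bxF_one.2 hnb.symm
  obtain ⟨n, g, hn, hg, -, hg0, hgn⟩ := LinkR.short_path hlk
  refine ⟨n, g, ?_, hg, hg0, hgn⟩
  rw [Nat.cast_le]
  have hGc : ∀ D, (G D).card ≤ 3 ^ d * (2 * (C * R) + 1) ^ d * D.card := by
    intro D
    refine (Finset.card_biUnion_le_card_mul _ _ ((2 * (C * R) + 1) ^ d) (fun j _ => (card_bxF _ _).le)).trans ?_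
    have : (D.biUnion (fun i => bxF i 1)).card ≤ D.card * 3 ^ d :=
      Finset.card_biUnion_le_card_mul _ _ _ (fun j _ => (card_bxF _ _).le)
    calc _ ≤ (D.card * 3 ^ d) * (2 * (C * R) + 1) ^ d := Nat.mul_le_mul_right _ this
      _ = _ := by ring
  have hWc : W.card ≤ (m + 1) + 3 ^ d * (2 * (C * R) + 1) ^ d * ∑ D ∈ 𝒟, D.card := by
    refine (Finset.card_union_le _ _).trans (add_le_add ?_ ?_)
    · exact Finset.card_image_le.trans (by simp)
    · refine Finset.card_biUnion_le.trans ?_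
      rw [Finset.mul_sum]
      exact Finset.sum_le_sum fun D _ => hGc D
  have hS : ∑ D ∈ 𝒟, D.card ≤ K * A.card + T := by
    rw [← Finset.sum_filter_add_sum_filter_not 𝒟 (fun D => D.card ≤ K)]
    refine add_le_add ?_ ?_
    · refine (Finset.sum_le_card_nsmul _ _ K (fun D hD => (Finset.mem_filter.1 hD).2)).trans ?_
      rw [smul_eq_mul, mul_comm]
      refine Nat.mul_le_mul_left _ ?_
      exact (Finset.card_filter_le _ _).trans (Finset.card_image_le.trans (Finset.card_filter_le _ _))
    · by_contra hlt
      have hlt := not_le.1 hlt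
      refine hT ⟨𝒟.filter (fun D => ¬ D.card ≤ K), ?_, ?_, hlt.le⟩
      · intro D hD
        obtain ⟨hD1, hD2⟩ := Finset.mem_filter.1 hD
        obtain ⟨a, ha, rfl⟩ := Finset.mem_image.1 hD1
        obtain ⟨-, haB, t, ht, rfl⟩ := Finset.mem_filter.1 ha
        refine ⟨?_, by omega, ?_, by simp, jj R (f t), hU' t ht.le, (hfin _).mem_toFinset.2 (comp_self haB)⟩
        · rw [(hfin _).coe_toFinset]; exact sconn_comp Bd _
        · intro i hi
          exact comp_sub ((hfin _).mem_toFinset.1 hi)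
      · intro D hD D' hD' hne
        obtain ⟨a, ha, rfl⟩ := Finset.mem_image.1 (Finset.mem_filter.1 hD).1
        obtain ⟨a', ha', rfl⟩ := Finset.mem_image.1 (Finset.mem_filter.1 hD').1
        rw [Finset.disjoint_left]
        intro z hz1 hz2
        apply hne
        have := comp_eq ((hfin _).mem_toFinset.1 hz1) ((hfin _).mem_toFinset.1 hz2)
        ext y
        rw [(hfin _).mem_toFinset, (hfin _).mem_toFinset, this]
  have := Nat.mul_le_mul_left (3 ^ d * (2 * (C * R) + 1) ^ d) hS
  omega

end Part13

section Part14

variable {d : ℕ} {Ω : Type*} [MeasurableSpace Ω]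

lemma two_mul_add_one_le_three_pow (n : ℕ) : 2 * (n + 1) + 1 ≤ 3 ^ (n + 1) := by
  induction n with
  | zero => norm_num
  | succ n ih => rw [pow_succ]; omega

lemma geom_half {r : ℝ≥0∞} (h : r ≤ 2⁻¹) : ∑' n : ℕ, r ^ n ≤ 2 := by
  rw [ENNReal.tsum_geometric]
  rw [← inv_inv (2 : ℝ≥0∞)]
  refine ENNReal.inv_le_inv.2 ?_
  refine ENNReal.le_sub_of_add_le_right (ne_top_of_le_ne_top (by simp) h) ?_
  calc 2⁻¹ + r ≤ 2⁻¹ + 2⁻¹ := by gcongr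
    _ = 1 := ENNReal.inv_two_add_inv_two

lemma Hp_prob {μ : Measure Ω} {bad : V d → Set Ω} {ξ : ℝ≥0∞} (h : Sparse μ bad ξ) (hξ : 27 ^ d * ξ ≤ 2⁻¹)
    (J : V d) : μ {w | ¬ Hp {i | w ∈ bad i} J} ≤ 2 * (27 ^ d * ξ) := by
  have hsub : {w | ¬ Hp {i | w ∈ bad i} J} ⊆ ⋃ n : ℕ, ⋃ i ∈ bxF J (n + 1),
      {w | ∃ C : Finset (V d), SConn (C : Set (V d)) ∧ i ∈ C ∧ C.card = n + 1 ∧ ∀ k ∈ C, w ∈ bad k} := by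
    intro w hw
    simp only [Set.mem_ofPred_eq, Hp] at hw
    push Not at hw
    obtain ⟨D, hD, hDB, i, hi, hiJ⟩ := hw
    have hpos : 0 < D.card := Finset.card_pos.2 ⟨i, hi⟩
    obtain ⟨n, hn⟩ : ∃ n, D.card = n + 1 := ⟨D.card - 1, by omega⟩
    simp only [Set.mem_iUnion]
    exact ⟨n, i, mem_bxF.2 (hn ▸ hiJ), D, hD, hi, hn, fun k hk => hDB hk⟩
  calc μ {w | ¬ Hp {i | w ∈ bad i} J} ≤ ∑' n : ℕ, (27 ^ d * ξ) ^ (n + 1) := by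
        refine (measure_mono hsub).trans ((measure_iUnion_le _).trans ?_)
        refine ENNReal.tsum_le_tsum fun n => ?_
        refine (measure_biUnion_finset_le _ _).trans ?_
        refine (Finset.sum_le_sum fun i _ => peierls h i (n + 1)).trans ?_
        rw [Finset.sum_const, card_bxF, nsmul_eq_mul]
        have h1 : (((2 * (n + 1) + 1) ^ d : ℕ) : ℝ≥0∞) ≤ ((3 : ℝ≥0∞) ^ d) ^ (n + 1) := by
          have h2 : (2 * (n + 1) + 1) ^ d ≤ (3 ^ d) ^ (n + 1) := by
            rw [← pow_mul, mul_comm d, pow_mul]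
            exact Nat.pow_le_pow_left (two_mul_add_one_le_three_pow n) _
          exact_mod_cast h2
        refine le_trans (b := ((3 : ℝ≥0∞) ^ d) ^ (n + 1) * (9 ^ d * ξ) ^ (n + 1)) (by gcongr) (le_of_eq ?_)
        rw [← mul_pow, ← mul_assoc, ← mul_pow]
        norm_num
    _ = (27 ^ d * ξ) * ∑' n : ℕ, (27 ^ d * ξ) ^ n := by
        rw [← ENNReal.tsum_mul_left]
        exact tsum_congr fun n => by rw [pow_succ, mul_comm]
    _ ≤ (27 ^ d * ξ) * 2 := by gcongr; exact geom_half hξ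
    _ = _ := mul_comm _ _

lemma one_add_pow_le (K a : ℕ) : (1 + (2⁻¹ : ℝ≥0∞) ^ K) ^ (2 ^ K * a) ≤ 4 ^ a := by
  rw [pow_mul]
  refine pow_le_pow_left' ?_ _
  have hreal : (1 + (2⁻¹ : ℝ) ^ K) ^ (2 ^ K) ≤ 4 := by
    have h1 : 1 + (2⁻¹ : ℝ) ^ K ≤ Real.exp ((2⁻¹ : ℝ) ^ K) := by
      rw [add_comm]; exact Real.add_one_le_exp _
    calc (1 + (2⁻¹ : ℝ) ^ K) ^ (2 ^ K) ≤ (Real.exp ((2⁻¹ : ℝ) ^ K)) ^ (2 ^ K) := by gcongr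
      _ = Real.exp 1 := by
        rw [← Real.exp_nat_mul]
        congr 1
        push_cast
        rw [← mul_pow]; norm_num
      _ ≤ 4 := by have := Real.exp_one_lt_d9; linarith
  have : (1 + (2⁻¹ : ℝ≥0∞) ^ K) ^ (2 ^ K) = ENNReal.ofReal ((1 + (2⁻¹ : ℝ) ^ K) ^ (2 ^ K)) := by
    rw [ENNReal.ofReal_pow (by positivity), ENNReal.ofReal_add (by norm_num) (by positivity),
      ENNReal.ofReal_pow (by positivity), ENNReal.ofReal_one, ENNReal.ofReal_inv_of_pos (by norm_num)]
    simp
  rw [this]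
  calc _ ≤ ENNReal.ofReal 4 := ENNReal.ofReal_le_ofReal hreal
    _ = 4 := by simp

/-- sites near a coarse walk -/
noncomputable def nearS (L : ℕ) (S : Finset (V d)) : Finset (V d) := by
  classical exact S.biUnion (fun g => bxF (ctr L g) (2 * L))

lemma card_image_walk {x : V d} {m : ℕ} {yS : V d × Finset (V d)} (h : yS ∈ walkSet x m) :
    yS.2.card ≤ m + 1 := by
  classical
  induction m generalizing yS with
  | zero => simp [walkSet] at h; simp [h]
  | succ m ih =>
    rw [walkSet, Finset.mem_biUnion] at h
    obtain ⟨a, ha, h⟩ := h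
    obtain ⟨z, _, rfl⟩ := Finset.mem_image.1 h
    exact (Finset.card_insert_le _ _).trans (Nat.succ_le_succ (ih ha))

lemma bigS_prob {μ : Measure Ω} {bad : V d → Set Ω} {ξ : ℝ≥0∞} (h : Sparse μ bad ξ)
    (hξ : 2 * 9 ^ d * ξ ≤ 2⁻¹) (K L m : ℕ) (hK : (4 * L + 1) ^ d ≤ 2 ^ K) (x : V d) :
    μ {w | ∃ yS ∈ walkSet x m, bigSum w bad K ∅ (nearS L yS.2) ((2 * d + 3) * (m + 1))} ≤ 2⁻¹ ^ (m + 1) := by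
  classical
  have hΘ : 1 + ∑' n : ℕ, (2 * 9 ^ d * ξ) ^ (n + K + 1) ≤ 1 + (2⁻¹ : ℝ≥0∞) ^ K := by
    gcongr
    calc ∑' n : ℕ, (2 * 9 ^ d * ξ) ^ (n + K + 1) = (2 * 9 ^ d * ξ) ^ (K + 1) * ∑' n : ℕ, (2 * 9 ^ d * ξ) ^ n := by
          rw [← ENNReal.tsum_mul_left]
          exact tsum_congr fun n => by rw [← pow_add]; congr 1; omega
      _ ≤ (2⁻¹) ^ (K + 1) * 2 := by
          gcongr
          exact geom_half hξ
      _ = 2⁻¹ ^ K := by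
          rw [pow_succ, mul_assoc, ENNReal.inv_mul_cancel (by norm_num) (by norm_num), mul_one]
  have hone : ∀ yS ∈ walkSet x m, μ {w | bigSum w bad K ∅ (nearS L yS.2) ((2 * d + 3) * (m + 1))} ≤
      4 ^ (m + 1) * 2⁻¹ ^ ((2 * d + 3) * (m + 1)) := by
    intro yS hyS
    have hb := bigSum_bound h K (nearS L yS.2) ∅ ((2 * d + 3) * (m + 1))
    simp only [Finset.notMem_empty, Set.iInter_of_empty, Set.iInter_univ, Set.univ_inter, Finset.card_empty,
      pow_zero, one_mul] at hb
    refine hb.trans ?_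
    refine mul_le_mul_left ?_ _
    have hc : (nearS L yS.2).card ≤ 2 ^ K * (m + 1) := by
      unfold nearS
      refine (Finset.card_biUnion_le_card_mul _ _ (2 ^ K) (fun g _ => ?_)).trans ?_
      · rw [card_bxF]
        refine le_trans (le_of_eq ?_) hK
        congr 1; omega
      · rw [mul_comm]
        exact Nat.mul_le_mul_left _ (card_image_walk hyS)
    calc _ ≤ (1 + (2⁻¹ : ℝ≥0∞) ^ K) ^ (nearS L yS.2).card := pow_le_pow_left' hΘ _
      _ ≤ (1 + (2⁻¹ : ℝ≥0∞) ^ K) ^ (2 ^ K * (m + 1)) := pow_le_pow_right₀ (by simp) hc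
      _ ≤ _ := one_add_pow_le K (m + 1)
  have hsub : {w | ∃ yS ∈ walkSet x m, bigSum w bad K ∅ (nearS L yS.2) ((2 * d + 3) * (m + 1))} ⊆
      ⋃ yS ∈ walkSet x m, {w | bigSum w bad K ∅ (nearS L yS.2) ((2 * d + 3) * (m + 1))} := by
    rintro w ⟨yS, h1, h2⟩
    simp only [Set.mem_iUnion]
    exact ⟨yS, h1, h2⟩
  refine (measure_mono hsub).trans ((measure_biUnion_finset_le _ _).trans ?_)
  refine (Finset.sum_le_sum hone).trans ?_
  rw [Finset.sum_const, nsmul_eq_mul]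
  have hcw : ((walkSet x m).card : ℝ≥0∞) ≤ 2 ^ (2 * d * (m + 1)) := by
    have : (walkSet x m).card ≤ 2 ^ (2 * d * (m + 1)) := by
      refine (card_walkSet x m).trans ?_
      rw [pow_mul 2 (2 * d), pow_mul 2 2]
      calc (3 ^ d) ^ m ≤ ((2 ^ 2) ^ d) ^ m := by gcongr; norm_num
        _ ≤ _ := Nat.pow_le_pow_right (by positivity) (by omega)
    exact_mod_cast this
  calc _ ≤ (2 : ℝ≥0∞) ^ (2 * d * (m + 1)) * (4 ^ (m + 1) * 2⁻¹ ^ ((2 * d + 3) * (m + 1))) := mul_le_mul_left hcw _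
    _ = ((2 : ℝ≥0∞) ^ ((2 * d + 2) * (m + 1)) * 2⁻¹ ^ ((2 * d + 2) * (m + 1))) * 2⁻¹ ^ (m + 1) := by
        rw [show (4 : ℝ≥0∞) = 2 ^ 2 by norm_num, ← pow_mul, ← mul_assoc, ← pow_add,
          show (2 * d + 3) * (m + 1) = (2 * d + 2) * (m + 1) + (m + 1) by ring, pow_add (2⁻¹ : ℝ≥0∞), ← mul_assoc,
          show 2 * d * (m + 1) + 2 * (m + 1) = (2 * d + 2) * (m + 1) by ring]
    _ = _ := by
        rw [← mul_pow, ENNReal.mul_inv_cancel (by norm_num) (by norm_num), one_pow, one_mul]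

lemma jj_nb_far {L : ℕ} (hL : 1 ≤ L) {u v : V d} (h : v ∈ bx u L) : nb (jj L u) (jj L v) := by
  intro k
  have hR' : (0 : ℤ) < L := by exact_mod_cast hL
  have h0 := abs_le.1 (h k)
  simp only [jj]
  have h1 : u k / (L : ℤ) ≤ v k / (L : ℤ) + 1 := by
    have := Int.ediv_le_ediv hR' (by linarith : u k ≤ v k + (L : ℤ))
    rwa [Int.add_ediv_of_dvd_right (dvd_refl _), Int.ediv_self hR'.ne'] at this
  have h2 : v k / (L : ℤ) ≤ u k / (L : ℤ) + 1 := by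
    have := Int.ediv_le_ediv hR' (by linarith : v k ≤ u k + (L : ℤ))
    rwa [Int.add_ediv_of_dvd_right (dvd_refl _), Int.ediv_self hR'.ne'] at this
  rw [abs_le]
  constructor <;> linarith

lemma nb_steps {g : ℕ → V d} (hg : ∀ i, nb (g i) (g (i + 1))) (a n : ℕ) : g (a + n) ∈ bx (g a) n := by
  induction n with
  | zero => exact mem_bx_self _ _
  | succ n ih =>
    intro k
    have h1 := ih k
    have h2 := hg (a + n) k
    rw [abs_sub_comm] at h2
    have := abs_sub_le (g (a + (n + 1)) k) (g (a + n) k) (g a k)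
    push_cast
    have h3 : |g (a + (n + 1)) k - g (a + n) k| ≤ 1 := h2
    linarith

/-- the blocks visited by a path of length at most `M` are near a coarse walk -/
lemma coarse {L M : ℕ} (hL : 1 ≤ L) (g : ℕ → V d) (hg : ∀ i, nb (g i) (g (i + 1))) :
    ∃ yS ∈ walkSet (jj L (g 0)) (M / L), ∀ t ≤ M, g t ∈ nearS L yS.2 := by
  classical
  have h := mem_walkSet (fun i => jj L (g (i * L))) (M / L) (fun i _ => by
    refine jj_nb_far hL ?_
    have := nb_steps hg (i * L) L
    rwa [show i * L + L = (i + 1) * L by ring] at this)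
  simp only [zero_mul] at h
  refine ⟨_, h, fun t ht => ?_⟩
  unfold nearS
  refine Finset.mem_biUnion.2 ⟨jj L (g (t / L * L)), ?_, ?_⟩
  · refine Finset.mem_image.2 ⟨t / L, ?_, rfl⟩
    rw [Finset.mem_range]
    exact Nat.lt_succ_of_le (Nat.div_le_div_right ht)
  · refine mem_bxF.2 ?_
    have h1 := nb_steps hg (t / L * L) (t % L)
    rw [Nat.div_add_mod' t L] at h1
    have h2 := jj_mem hL (g (t / L * L))
    have h3 : t % L < L := Nat.mod_lt _ hL
    exact bx_subset h2 (by omega) h1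

end Part14

section Part15

variable {d : ℕ}

noncomputable def CM (d : ℕ) (q s : ℝ) : Measure (Cfg2 d) := BP (fun k : Edge d × Bool => if k.2 then s else q)

instance (q s : ℝ) : IsProbabilityMeasure (CM d q s) := by unfold CM; infer_instance

/-- the thinned configuration -/
def cfgN (w : Cfg2 d) : Config d := fun e => w (e, false) && w (e, true)

lemma measurable_cfgN : Measurable (cfgN : Cfg2 d → Config d) := by
  unfold cfgN
  refine measurable_pi_lambda _ fun e => ?_
  have h : Measurable (fun b : Bool × Bool => b.1 && b.2) := measurable_of_finite _
  have h' : Measurable (fun w : Cfg2 d => (w (e, false), w (e, true))) :=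
    (measurable_pi_apply (e, false)).prodMk (measurable_pi_apply (e, true))
  exact h.comp h'

lemma measurable_cfgA : Measurable (cfgA : Cfg2 d → Config d) :=
  measurable_pi_lambda _ fun e => measurable_pi_apply (e, false)

lemma CM_N {q s : ℝ} (hq : 0 ≤ q) (hq1 : q ≤ 1) (hs : 0 ≤ s) (hs1 : s ≤ 1) :
    (CM d q s).map cfgN = PB d (q * s) := BP_and hq hq1 hs hs1

lemma CM_A (q s : ℝ) : (CM d q s).map cfgA = PB d q := by
  have := BP_reindex (fun e : Edge d => (e, false)) (fun a b h => (Prod.mk.inj h).1)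
    (fun k : Edge d × Bool => if k.2 then s else q)
  exact this

lemma cfgN_le (w : Cfg2 d) (e : Edge d) (h : cfgN w e = true) : cfgA w e = true := by
  simp only [cfgN, Bool.and_eq_true] at h
  exact h.1

lemma CM_closed {q s : ℝ} (hs : 0 ≤ s) (hs1 : s ≤ 1) (e : Edge d) :
    CM d q s {w | w (e, true) = false} = ENNReal.ofReal (1 - s) := by
  have := BP_cyl (p := fun k : Edge d × Bool => if k.2 then s else q) {(e, true)} (fun _ => false)
  simp only [Finset.mem_singleton, forall_eq, Finset.prod_singleton, if_true] at this
  rw [bern_singleton hs hs1] at this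
  simpa [CM] using this

noncomputable def closedIn (w : Cfg2 d) (E : Finset (Edge d)) : Finset (Edge d) :=
  E.filter fun e => w (e, true) = false

lemma closed_dep [DecidableEq (Edge d)] (b : ℕ) (E : Finset (Edge d)) :
    Dep (E.image fun e => (e, true)) {w : Cfg2 d | b ≤ (closedIn w E).card} := by
  intro w w' h hw
  have : closedIn w' E = closedIn w E := by
    unfold closedIn
    refine Finset.filter_congr fun e he => ?_
    rw [h (e, true) (Finset.mem_image.2 ⟨e, he, rfl⟩)]
  simp only [Set.mem_ofPred_eq] at hw ⊢
  rwa [this]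

lemma markov {q s : ℝ} (hs : 0 ≤ s) (hs1 : s ≤ 1) (b : ℕ) (E : Finset (Edge d)) :
    (b : ℝ≥0∞) * CM d q s {w | b ≤ (closedIn w E).card} ≤ E.card * ENNReal.ofReal (1 - s) := by
  classical
  have hm : ∀ e : Edge d, MeasurableSet {w : Cfg2 d | w (e, true) = false} := fun e =>
    measurableSet_eq_fun (measurable_pi_apply (e, true)) measurable_const
  set F : Cfg2 d → ℝ≥0∞ := fun w => ∑ e ∈ E, Set.indicator {w : Cfg2 d | w (e, true) = false} 1 w with hF
  have hFm : Measurable F := by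
    refine Finset.measurable_sum _ fun e _ => ?_
    exact measurable_one.indicator (hm e)
  have hFe : ∀ w, F w = (closedIn w E).card := by
    intro w
    simp only [hF, closedIn, Finset.card_filter, Set.indicator_apply, Set.mem_ofPred_eq, Pi.one_apply]
    push_cast
    rfl
  have h := mul_meas_ge_le_lintegral (μ := CM d q s) hFm (b : ℝ≥0∞)
  have h1 : {w | b ≤ (closedIn w E).card} = {w | (b : ℝ≥0∞) ≤ F w} := by
    ext w
    simp only [Set.mem_ofPred_eq, hFe, Nat.cast_le]
  rw [h1]
  refine h.trans (le_of_eq ?_)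
  rw [hF, lintegral_finsetSum _ (fun e _ => measurable_one.indicator (hm e))]
  rw [Finset.sum_congr rfl (g := fun _ => ENNReal.ofReal (1 - s)) (fun e _ => by
    rw [lintegral_indicator_one (hm e), CM_closed hs hs1])]
  simp

lemma closed_split {q s : ℝ} (b : ℕ) (δ : ℝ≥0∞) [DecidableEq (Edge d)] (ℰ : Finset (Finset (Edge d))) :
    (∀ E ∈ ℰ, CM d q s {w | b ≤ (closedIn w E).card} ≤ δ) →
    ∀ (S : Finset (Edge d)) (B : Set (Cfg2 d)), Dep (S.image fun e => (e, false)) B →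
    CM d q s (B ∩ {w | (∃ E ∈ ℰ, ∀ e ∈ E, w (e, false) = true) ∧
      ∀ E ∈ ℰ, (∀ e ∈ E, w (e, false) = true) → b ≤ (closedIn w E).card}) ≤ δ * CM d q s B := by
  classical
  induction ℰ using Finset.induction_on with
  | empty => intro _ S B _; simp
  | insert E ℰ hE ih =>
    intro hδ S B hB
    set O : Set (Cfg2 d) := {w | ∀ e ∈ E, w (e, false) = true} with hO
    have hOd : Dep (E.image fun e => (e, false)) O := by
      intro w w' h hw e he
      rw [← h (e, false) (Finset.mem_image.2 ⟨e, he, rfl⟩)]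
      exact hw e he
    have hB' : Dep ((S ∪ E).image fun e => (e, false)) B :=
      hB.mono (Finset.image_subset_image Finset.subset_union_left)
    have hO' : Dep ((S ∪ E).image fun e => (e, false)) O :=
      hOd.mono (Finset.image_subset_image Finset.subset_union_right)
    have h1 := ih (fun E' hE' => hδ E' (Finset.mem_insert_of_mem hE')) (S ∪ E) (B \ O) (hB'.diff hO')
    have h2 : CM d q s ((B ∩ O) ∩ {w | b ≤ (closedIn w E).card}) ≤ δ * CM d q s (B ∩ O) := by
      have hdis : Disjoint ((S ∪ E).image fun e : Edge d => (e, false)) (E.image fun e => (e, true)) := by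
        rw [Finset.disjoint_left]
        intro k hk hk'
        obtain ⟨a, _, rfl⟩ := Finset.mem_image.1 hk
        obtain ⟨a', _, h'⟩ := Finset.mem_image.1 hk'
        simp at h'
      have := Dep.indep (BP_ind (fun k : Edge d × Bool => if k.2 then s else q)) hdis (hB'.inter hO') (closed_dep b E)
      rw [CM, this, mul_comm]
      refine mul_le_mul_left ?_ _
      exact hδ E (Finset.mem_insert_self _ _)
    have hsub : B ∩ {w | (∃ E' ∈ insert E ℰ, ∀ e ∈ E', w (e, false) = true) ∧
        ∀ E' ∈ insert E ℰ, (∀ e ∈ E', w (e, false) = true) → b ≤ (closedIn w E').card} ⊆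
        ((B ∩ O) ∩ {w | b ≤ (closedIn w E).card}) ∪ ((B \ O) ∩ {w | (∃ E ∈ ℰ, ∀ e ∈ E, w (e, false) = true) ∧
          ∀ E ∈ ℰ, (∀ e ∈ E, w (e, false) = true) → b ≤ (closedIn w E).card}) := by
      rintro w ⟨hwB, ⟨E', hE', hop⟩, hall⟩
      by_cases hwO : w ∈ O
      · left
        exact ⟨⟨hwB, hwO⟩, hall E (Finset.mem_insert_self _ _) hwO⟩
      · right
        refine ⟨⟨hwB, hwO⟩, ⟨E', ?_, hop⟩, fun E'' hE'' => hall E'' (Finset.mem_insert_of_mem hE'')⟩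
        rcases Finset.mem_insert.1 hE' with rfl | h
        · exact absurd hop hwO
        · exact h
    calc _ ≤ _ := measure_mono hsub
      _ ≤ _ := measure_union_le _ _
      _ ≤ δ * CM d q s (B ∩ O) + δ * CM d q s (B \ O) := add_le_add h2 h1
      _ = δ * CM d q s B := by
        rw [← mul_add, measure_inter_add_sdiff _ hOd.measurableSet]

/-- edge sets of lattice paths -/
def IsPathEdges (x y : V d) (M : ℕ) (E : Finset (Edge d)) : Prop :=
  ∃ (m : ℕ) (f : ℕ → V d), m ≤ M ∧ f 0 = x ∧ f m = y ∧ (∀ i < m, sym2dist1 s(f i, f (i + 1)) = 1) ∧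
    ∀ e : Edge d, e ∈ E ↔ ∃ i < m, e.1 = s(f i, f (i + 1))

open Classical in
noncomputable def pathFam (x y : V d) (M : ℕ) : Finset (Finset (Edge d)) :=
  (edgesIn (bxF x M)).powerset.filter fun E => IsPathEdges x y M E

lemma pathEdges_card {x y : V d} {M : ℕ} {E : Finset (Edge d)} (h : IsPathEdges x y M E) : E.card ≤ M := by
  classical
  obtain ⟨m, f, hm, -, -, -, hE⟩ := h
  have h1 : E.image Subtype.val ⊆ (Finset.range m).image (fun i => s(f i, f (i + 1))) := by
    intro z hz
    obtain ⟨e, he, rfl⟩ := Finset.mem_image.1 hz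
    obtain ⟨i, hi, h⟩ := (hE e).1 he
    exact Finset.mem_image.2 ⟨i, by simpa using hi, h.symm⟩
  have h2 := Finset.card_le_card h1
  have h3 : (E.image Subtype.val).card = E.card := Finset.card_image_of_injective E Subtype.val_injective
  have h2 := h3.symm.le.trans h2
  exact (h2.trans Finset.card_image_le).trans (by simpa using hm)

lemma pathFam_of_distLe {ω : Config d} {x y : V d} {a : ℝ} (h : distLe ω x y a) :
    ∃ E ∈ pathFam x y ⌊a⌋₊, ∀ e ∈ E, ω e = true := by
  classical
  obtain ⟨m, f, hm, hf, h0, h1⟩ := h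
  have hmM : m ≤ ⌊a⌋₊ := Nat.le_floor hm
  have hbx : ∀ i ≤ m, f i ∈ bxF x ⌊a⌋₊ := by
    intro i hi
    have h2 : f i ∈ bx (f 0) i := by
      clear h1 hmM hm
      induction i with
      | zero => exact mem_bx_self _ _
      | succ i ih =>
        intro k
        have h3 := ih (by omega) k
        have h4 := (edgeOpen_nb (hf i (by omega))).symm k
        have h5 := abs_sub_le (f (i + 1) k) (f i k) (f 0 k)
        push_cast; linarith
    rw [h0] at h2
    exact mem_bxF.2 (bx_mono _ (hi.trans hmM) h2)
  set E : Finset (Edge d) := (edgesIn (bxF x ⌊a⌋₊)).filter (fun e => ∃ i < m, e.1 = s(f i, f (i + 1))) with hE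
  have hmem : ∀ e : Edge d, e ∈ E ↔ ∃ i < m, e.1 = s(f i, f (i + 1)) := by
    intro e
    rw [hE, Finset.mem_filter]
    refine ⟨fun h => h.2, fun h => ⟨?_, h⟩⟩
    obtain ⟨i, hi, h⟩ := h
    refine mem_edgesIn.2 ?_
    rw [h]
    exact Finset.mk_mem_sym2_iff.2 ⟨hbx i (by omega), hbx _ (by omega)⟩
  refine ⟨E, ?_, ?_⟩
  · simp only [pathFam, Finset.mem_filter, Finset.mem_powerset]
    refine ⟨Finset.filter_subset _ _, m, f, hmM, h0, h1, fun i hi => (hf i hi).1, hmem⟩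
  · intro e he
    obtain ⟨i, hi, h⟩ := (hmem e).1 he
    obtain ⟨g1, g2⟩ := hf i hi
    have : e = ⟨s(f i, f (i + 1)), g1⟩ := Subtype.ext h
    rw [this]; exact g2

/-- bad blocks -/
def nbad (R C : ℕ) (J : V d) : Set (Cfg2 d) :=
  {w | ¬ RGood R C (cfgN w) J} ∪ {w | ∃ e ∈ edgesIn (bxF (ctr R J) (3 * R)), w (e, true) = false}

lemma nbad_dep [DecidableEq (Edge d)] {R C : ℕ} (hR : 1 ≤ R) (hC : 5 ≤ C) (J : V d) :
    Dep ((edgesIn (bxF (ctr R J) (C * R))) ×ˢ Finset.univ) (nbad R C J) := by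
  refine Dep.union ?_ ?_
  · intro w w' h hw
    refine rgood_dep hR hC J (cfgN w) (cfgN w') (fun e he => ?_) hw
    simp only [cfgN]
    rw [h (e, false) (Finset.mem_product.2 ⟨he, by simp⟩), h (e, true) (Finset.mem_product.2 ⟨he, by simp⟩)]
  · rintro w w' h ⟨e, he, hw⟩
    refine ⟨e, he, ?_⟩
    rw [← h (e, true) (Finset.mem_product.2 ⟨?_, by simp⟩)]
    · exact hw
    · refine mem_edgesIn.2 (Finset.sym2_mono ?_ (mem_edgesIn.1 he))
      intro v hv
      exact mem_bxF.2 (bx_mono _ (Nat.mul_le_mul_right _ (by omega)) (mem_bxF.1 hv))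

lemma nbad_prob {q s : ℝ} (hq : 0 ≤ q) (hq1 : q ≤ 1) (hs : 0 ≤ s) (hs1 : s ≤ 1) {R C : ℕ} (hR : 1 ≤ R) (hC : 5 ≤ C)
    (J : V d) : CM d q s (nbad R C J) ≤ PB d (q * s) {a | ¬ RGood R C a J} +
      (Nat.choose ((2 * (3 * R) + 1) ^ d + 1) 2 : ℕ) * ENNReal.ofReal (1 - s) := by
  refine (measure_union_le _ _).trans (add_le_add ?_ ?_)
  · rw [← CM_N hq hq1 hs hs1, Measure.map_apply measurable_cfgN (rgood_dep hR hC J).measurableSet]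
    exact le_rfl
  · have : {w : Cfg2 d | ∃ e ∈ edgesIn (bxF (ctr R J) (3 * R)), w (e, true) = false} ⊆
        ⋃ e ∈ edgesIn (bxF (ctr R J) (3 * R)), {w : Cfg2 d | w (e, true) = false} := by
      rintro w ⟨e, he, hw⟩
      simp only [Set.mem_iUnion]
      exact ⟨e, he, hw⟩
    refine (measure_mono this).trans ((measure_biUnion_finset_le _ _).trans ?_)
    rw [Finset.sum_congr rfl (fun e _ => CM_closed hs hs1 e), Finset.sum_const, nsmul_eq_mul]
    refine mul_le_mul_left ?_ _
    exact_mod_cast card_edgesIn_le _ _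

lemma nbad_sparse {q s : ℝ} {R C : ℕ} (hR : 1 ≤ R) (hC : 5 ≤ C) {ξ : ℝ≥0∞} (hξ : ξ ≤ 1)
    (h : ∀ J : V d, CM d q s (nbad R C J) ≤ ξ ^ ((2 * C + 1) ^ d)) : Sparse (CM d q s) (nbad (d := d) R C) ξ := by
  classical
  refine sparse_of_dep (BP_ind _) (nbad_dep hR hC) (2 * C) ?_ hξ h
  rintro i j ⟨k, hk⟩
  rw [Finset.disjoint_left]
  intro e h1 h2
  obtain ⟨v, hv⟩ := edge_mem e.1
  have h3 := mem_bxF.1 (Finset.mem_sym2_iff.1 (mem_edgesIn.1 (Finset.mem_product.1 h1).1) v hv) k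
  have h4 := mem_bxF.1 (Finset.mem_sym2_iff.1 (mem_edgesIn.1 (Finset.mem_product.1 h2).1) v hv) k
  simp only [ctr] at h3 h4
  rw [abs_le] at h3 h4
  push_cast at *
  have hr : (1 : ℤ) ≤ R := by exact_mod_cast hR
  rcases lt_abs.1 hk with h | h <;> nlinarith

end Part15

section Part16

variable {d : ℕ}

lemma det2 (hd : 2 ≤ d) {w : Cfg2 d} {R C K L M b : ℕ} (hR : 1 ≤ R) (hL : 1 ≤ L) {x y : V d}
    (hy : InInfiniteCluster (cfgN w) y)
    (h0 : Hp {i | w ∈ nbad R C i} (jj R x)) (hm : Hp {i | w ∈ nbad R C i} (jj R y))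
    {E : Finset (Edge d)} (hE : E ∈ pathFam x y M) (hop : ∀ e ∈ E, w (e, false) = true)
    (hcl : (closedIn w E).card ≤ b)
    (hbig : ¬ ∃ yS ∈ walkSet (jj L (jj R x)) (M / L),
      bigSum w (nbad R C) K ∅ (nearS L yS.2) ((2 * d + 3) * (M / L + 1))) :
    distLe (cfgN w) x y ((M + 3 ^ d * (2 * (C * R) + 1) ^ d * (K * (2 * b) + (2 * d + 3) * (M / L + 1)) : ℕ) : ℝ) := by
  classical
  simp only [pathFam, Finset.mem_filter] at hE
  obtain ⟨-, m, f, hmM, rfl, rfl, hs1, hEm⟩ := hE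
  have hf : IsOpenPath (cfgA w) m f := by
    intro i hi
    exact ⟨hs1 i hi, hop _ ((hEm _).2 ⟨i, hi, rfl⟩)⟩
  have hBd : ∀ J, w ∉ nbad R C J → RGood R C (cfgN w) J ∧
      ∀ e ∈ edgesIn (bxF (ctr R J) (3 * R)), cfgA w e = true → cfgN w e = true := by
    intro J hJ
    have hJ1 : ¬ ¬ RGood R C (cfgN w) J := fun h => hJ (Or.inl h)
    refine ⟨not_not.1 hJ1, fun e he hA => ?_⟩
    have hT : w (e, true) = true := by
      by_contra hne
      exact hJ (Or.inr ⟨e, he, by simpa using hne⟩)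
    simp only [cfgN, Bool.and_eq_true]
    exact ⟨hA, hT⟩
  set A : Finset (V d) := (closedIn w E).biUnion (fun e => e.1.toFinset.image (jj R)) with hA
  have hAc : A.card ≤ 2 * b := by
    refine (Finset.card_biUnion_le_card_mul _ _ 2 (fun e _ => ?_)).trans ?_
    · refine Finset.card_image_le.trans ?_
      rw [Sym2.card_toFinset]
      split_ifs <;> omega
    · omega
  have hA1 : ∀ t < m, ¬ edgeOpen (cfgN w) (f t) (f (t + 1)) → jj R (f t) ∈ A := by
    intro t ht hc
    refine Finset.mem_biUnion.2 ⟨⟨s(f t, f (t + 1)), hs1 t ht⟩, ?_, ?_⟩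
    · have hin : (⟨s(f t, f (t + 1)), hs1 t ht⟩ : Edge d) ∈ E := (hEm _).2 ⟨t, ht, rfl⟩
      refine Finset.mem_filter.2 ⟨hin, ?_⟩
      by_contra hne
      refine hc ⟨hs1 t ht, ?_⟩
      simp only [cfgN, Bool.and_eq_true]
      exact ⟨hop _ hin, by simpa using hne⟩
    · refine Finset.mem_image.2 ⟨f t, ?_, rfl⟩
      rw [Sym2.mem_toFinset]
      exact Sym2.mem_mk_left _ _
  obtain ⟨yS, hyS, hnear⟩ := coarse (M := M) hL (fun t => jj R (f (min t m))) (fun t => by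
    rcases lt_or_ge t m with h | h
    · rw [min_eq_left h.le, min_eq_left (by omega : t + 1 ≤ m)]
      exact jj_nb hR (edgeOpen_nb (hf t h))
    · rw [min_eq_right h, min_eq_right (by omega : m ≤ t + 1)]
      exact nb_refl _)
  simp only [Nat.zero_min] at hyS
  have hnb : ¬ bigSum w (nbad R C) K ∅ (nearS L yS.2) ((2 * d + 3) * (M / L + 1)) :=
    fun h => hbig ⟨yS, hyS, h⟩
  have := det_bound hd hR hf hy hBd h0 hm A (nearS L yS.2) K _ hA1 (fun t ht => by
    have := hnear t (ht.trans hmM)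
    rwa [min_eq_left ht] at this) hnb
  obtain ⟨n, g, hn, hg⟩ := this
  refine ⟨n, g, hn.trans ?_, hg⟩
  rw [Nat.cast_le]
  gcongr

lemma big_tendsto {a : ℝ} (ha : 0 < a) {L : ℕ} (hL : 1 ≤ L) :
    Tendsto (fun n : ℕ => (2⁻¹ : ℝ≥0∞) ^ (⌊(n : ℝ) * a⌋₊ / L + 1)) atTop (𝓝 0) := by
  have h1 : Tendsto (fun n : ℕ => ⌊(n : ℝ) * a⌋₊) atTop atTop :=
    tendsto_nat_floor_atTop.comp (tendsto_natCast_atTop_atTop.atTop_mul_const ha)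
  have h2 : Tendsto (fun n : ℕ => ⌊(n : ℝ) * a⌋₊ / L + 1) atTop atTop := by
    have h4 : Tendsto (fun n : ℕ => ⌊(n : ℝ) * a⌋₊ / L) atTop atTop :=
      (Nat.tendsto_div_const_atTop (by omega)).comp h1
    exact tendsto_atTop_mono (fun n => Nat.le_succ _) h4
  have h3 : Tendsto (fun n : ℕ => (2⁻¹ : ℝ≥0∞) ^ n) atTop (𝓝 0) :=
    ENNReal.tendsto_pow_atTop_nhds_zero_of_lt_one (by
      rw [ENNReal.inv_lt_one]; norm_num)
  exact h3.comp h2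

lemma core (hd : 2 ≤ d) {p q : ℝ} (hp : 0 < p) (hpq : p ≤ q) (hq1 : q ≤ 1) {tp tq : V d → ℝ}
    (htp : ASTimeConstant (PB d p) tp) (htq : ASTimeConstant (PB d q) tq) {x : V d} (hx : 0 < tq x)
    {R C K L : ℕ} (hR : 1 ≤ R) (hL : 1 ≤ L) (hK : (4 * L + 1) ^ d ≤ 2 ^ K) {ξ : ℝ≥0∞}
    (hsp : Sparse (CM d q (p / q)) (nbad (d := d) R C) ξ) {c : ℝ} (hc : 0 < c) (hc1 : c ≤ 1)
    (htwo : ∀ n0, 1 ≤ n0 → ∃ n, n0 ≤ n ∧ c ≤ (PB d p).real {ω | InInfiniteCluster ω 0 ∧ InInfiniteCluster ω (n • x)})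
    (hξ : 2 * (27 ^ d * ξ) ≤ ENNReal.ofReal (c / 8)) {δ : ℝ} (hδ : 0 < δ) (n0 : ℕ) :
    ∃ n M : ℕ, n0 ≤ n ∧ (M : ℝ) ≤ n * (tq x + δ) ∧
      n * (tp x - δ) ≤ ((M + 3 ^ d * (2 * (C * R) + 1) ^ d * (K * (2 * ⌊8 * M * (1 - p / q) / c⌋₊) +
        (2 * d + 3) * (M / L + 1)) : ℕ) : ℝ) := by
  classical
  have hq : 0 < q := hp.trans_le hpq
  have hs0 : 0 ≤ p / q := by positivity
  have hs1 : p / q ≤ 1 := (div_le_one hq).2 hpq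
  have hqp : q * (p / q) = p := by field_simp
  set ν := CM d q (p / q) with hν
  set c8 : ℝ≥0∞ := ENNReal.ofReal (c / 8) with hc8
  have hc8pos : 0 < c8 := ENNReal.ofReal_pos.2 (by positivity)
  have hc8half : c8 ≤ 2⁻¹ := by
    rw [hc8, ← ENNReal.ofReal_ofNat 2, ← ENNReal.ofReal_inv_of_pos (by norm_num)]
    exact ENNReal.ofReal_le_ofReal (by linarith)
  have hξ27 : 27 ^ d * ξ ≤ 2⁻¹ := by
    refine le_trans ?_ (hξ.trans hc8half)
    calc 27 ^ d * ξ = 1 * (27 ^ d * ξ) := (one_mul _).symm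
      _ ≤ _ := by gcongr; norm_num
  have hξ9 : 2 * 9 ^ d * ξ ≤ 2⁻¹ := by
    refine le_trans ?_ (hξ.trans hc8half)
    rw [mul_assoc]
    gcongr
    norm_num
  have e1 := ((upper_tendsto htq x hx hδ).eventually_lt_const hc8pos)
  have e2 := ((lower_tendsto htp x hδ).eventually_lt_const hc8pos)
  have e3 := ((big_tendsto (by positivity : 0 < tq x + δ) hL).eventually_lt_const hc8pos)
  obtain ⟨n1, hn1⟩ := eventually_atTop.1 (e1.and (e2.and e3))
  obtain ⟨n, hn, hG⟩ := htwo (max (max n0 n1) 1) (le_max_right _ _)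
  have hnn0 : n0 ≤ n := (le_max_left _ _).trans ((le_max_left _ _).trans hn)
  obtain ⟨g1, g2, g3⟩ := hn1 n ((le_max_right _ _).trans ((le_max_left _ _).trans hn))
  set M : ℕ := ⌊(n : ℝ) * (tq x + δ)⌋₊ with hM
  set b : ℕ := ⌊8 * M * (1 - p / q) / c⌋₊ with hb
  set y : V d := n • x with hy
  refine ⟨n, M, hnn0, Nat.floor_le (by positivity), ?_⟩
  -- events
  set G : Set (Cfg2 d) := {w | InInfiniteCluster (cfgN w) 0 ∧ InInfiniteCluster (cfgN w) y} with hGdef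
  set B1 : Set (Cfg2 d) := {w | ¬ Hp {i | w ∈ nbad R C i} (jj R 0)} with hB1
  set B2 : Set (Cfg2 d) := {w | ¬ Hp {i | w ∈ nbad R C i} (jj R y)} with hB2
  set B3 : Set (Cfg2 d) := {w | (∃ E ∈ pathFam 0 y M, ∀ e ∈ E, w (e, false) = true) ∧
      ∀ E ∈ pathFam 0 y M, (∀ e ∈ E, w (e, false) = true) → b + 1 ≤ (closedIn w E).card} with hB3
  set B4 : Set (Cfg2 d) := {w | ∃ yS ∈ walkSet (jj L (jj R 0)) (M / L),
      bigSum w (nbad R C) K ∅ (nearS L yS.2) ((2 * d + 3) * (M / L + 1))} with hB4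
  set B5 : Set (Cfg2 d) := {w | InInfiniteCluster (cfgA w) 0 ∧ InInfiniteCluster (cfgA w) y ∧
      ¬ distLe (cfgA w) 0 y (n * (tq x + δ))} with hB5
  set B6 : Set (Cfg2 d) := {w | InInfiniteCluster (cfgN w) 0 ∧ InInfiniteCluster (cfgN w) y ∧
      distLe (cfgN w) 0 y (n * (tp x - δ))} with hB6
  have k1 : ν B1 ≤ c8 := (Hp_prob hsp hξ27 _).trans hξ
  have k2 : ν B2 ≤ c8 := (Hp_prob hsp hξ27 _).trans hξ
  have k3 : ν B3 ≤ c8 := by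
    have hone : ∀ E ∈ pathFam 0 y M, ν {w | b + 1 ≤ (closedIn w E).card} ≤ c8 := by
      intro E hE
      have hmk := markov (q := q) hs0 hs1 (b + 1) E
      simp only [pathFam, Finset.mem_filter] at hE
      have hcard := pathEdges_card hE.2
      have hbb : ((b + 1 : ℕ) : ℝ≥0∞) * ν {w | b + 1 ≤ (closedIn w E).card} ≤ ((b + 1 : ℕ) : ℝ≥0∞) * c8 := by
        refine hmk.trans ?_
        calc (E.card : ℝ≥0∞) * ENNReal.ofReal (1 - p / q) ≤ (M : ℝ≥0∞) * ENNReal.ofReal (1 - p / q) := by gcongr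
          _ = ENNReal.ofReal (M * (1 - p / q)) := by
              rw [ENNReal.ofReal_mul (by positivity), ENNReal.ofReal_natCast]
          _ ≤ ENNReal.ofReal (((b + 1 : ℕ) : ℝ) * (c / 8)) := by
              refine ENNReal.ofReal_le_ofReal ?_
              have h1 := Nat.lt_floor_add_one (8 * M * (1 - p / q) / c)
              rw [← hb, div_lt_iff₀ hc] at h1
              push_cast
              linarith
          _ = _ := by rw [ENNReal.ofReal_mul (by positivity), ENNReal.ofReal_natCast]
      exact (ENNReal.mul_le_mul_iff_right (by simp) (by simp)).1 hbb
    have := closed_split (q := q) (s := p / q) (b + 1) c8 (pathFam 0 y M) hone ∅ Set.univ (fun _ _ _ _ => trivial)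
    rwa [Set.univ_inter, measure_univ, mul_one] at this
  have k4 : ν B4 ≤ c8 := (bigS_prob hsp hξ9 K L (M / L) hK _).trans g3.le
  have k5 : ν B5 ≤ c8 := by
    refine le_trans ?_ g1.le
    rw [← CM_A q (p / q)]
    exact Measure.le_map_apply measurable_cfgA.aemeasurable _
  have k6 : ν B6 ≤ c8 := by
    refine le_trans ?_ g2.le
    rw [show PB d p = (CM d q (p / q)).map cfgN by rw [CM_N hq.le hq1 hs0 hs1, hqp]]
    exact Measure.le_map_apply measurable_cfgN.aemeasurable _
  have kG : ENNReal.ofReal c ≤ ν G := by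
    have hms : MeasurableSet {ω : Config d | InInfiniteCluster ω 0 ∧ InInfiniteCluster ω y} :=
      (measurable_infinite 0).inter (measurable_infinite y)
    have : ν G = PB d p {ω | InInfiniteCluster ω 0 ∧ InInfiniteCluster ω y} := by
      rw [show PB d p = (CM d q (p / q)).map cfgN by rw [CM_N hq.le hq1 hs0 hs1, hqp],
        Measure.map_apply measurable_cfgN hms]
      rfl
    rw [this]
    refine ENNReal.ofReal_le_of_le_toReal ?_
    exact hG
  by_contra hcon
  have hsub : G ⊆ B1 ∪ B2 ∪ B3 ∪ B4 ∪ B5 ∪ B6 := by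
    rintro w ⟨hw0, hwy⟩
    by_contra hnot
    simp only [Set.mem_union, not_or] at hnot
    obtain ⟨⟨⟨⟨⟨n1, n2⟩, n3⟩, n4⟩, n5⟩, n6⟩ := hnot
    have m5 : distLe (cfgA w) 0 y (n * (tq x + δ)) := by
      by_contra h
      exact n5 ⟨infinite_mono (cfgN_le w) hw0, infinite_mono (cfgN_le w) hwy, h⟩
    have m3 : ∃ E ∈ pathFam 0 y M, (∀ e ∈ E, w (e, false) = true) ∧ (closedIn w E).card ≤ b := by
      by_contra h
      push Not at h
      exact n3 ⟨pathFam_of_distLe m5, fun E hE ho => h E hE ho⟩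
    obtain ⟨E, hE, ho, hcl⟩ := m3
    have hfin := det2 hd hR hL hwy (not_not.1 n1) (not_not.1 n2) hE ho hcl n4
    refine n6 ⟨hw0, hwy, ?_⟩
    obtain ⟨l, g, hl, hg⟩ := hfin
    exact ⟨l, g, hl.trans (not_le.1 hcon).le, hg⟩
  have hle : ENNReal.ofReal c ≤ c8 + c8 + c8 + c8 + c8 + c8 := by
    refine kG.trans ((measure_mono hsub).trans ?_)
    refine (measure_union_le _ _).trans (add_le_add ?_ k6)
    refine (measure_union_le _ _).trans (add_le_add ?_ k5)
    refine (measure_union_le _ _).trans (add_le_add ?_ k4)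
    refine (measure_union_le _ _).trans (add_le_add ?_ k3)
    exact (measure_union_le _ _).trans (add_le_add k1 k2)
  rw [hc8, ← ENNReal.ofReal_add (by positivity) (by positivity), ← ENNReal.ofReal_add (by positivity) (by positivity),
    ← ENNReal.ofReal_add (by positivity) (by positivity), ← ENNReal.ofReal_add (by positivity) (by positivity),
    ← ENNReal.ofReal_add (by positivity) (by positivity), ENNReal.ofReal_le_ofReal_iff (by positivity)] at hle
  linarith

end Part16

section Part17

variable {d : ℕ}

lemma core_lim (hd : 2 ≤ d) {p q : ℝ} (hp : 0 < p) (hpq : p ≤ q) (hq1 : q ≤ 1) {tp tq : V d → ℝ}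
    (htp : ASTimeConstant (PB d p) tp) (htq : ASTimeConstant (PB d q) tq) {x : V d} (hx : 0 < tq x)
    {R C K L : ℕ} (hR : 1 ≤ R) (hL : 1 ≤ L) (hK : (4 * L + 1) ^ d ≤ 2 ^ K) {ξ : ℝ≥0∞}
    (hsp : Sparse (CM d q (p / q)) (nbad (d := d) R C) ξ) {c : ℝ} (hc : 0 < c) (hc1 : c ≤ 1)
    (htwo : ∀ n0, 1 ≤ n0 → ∃ n, n0 ≤ n ∧ c ≤ (PB d p).real {ω | InInfiniteCluster ω 0 ∧ InInfiniteCluster ω (n • x)})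
    (hξ : 2 * (27 ^ d * ξ) ≤ ENNReal.ofReal (c / 8)) :
    tp x ≤ tq x * (1 + ((3 ^ d * (2 * (C * R) + 1) ^ d : ℕ) : ℝ) *
      (16 * K * (1 - p / q) / c + (2 * d + 3) / L)) := by
  have hq : 0 < q := hp.trans_le hpq
  have hs1 : p / q ≤ 1 := (div_le_one hq).2 hpq
  have hs' : 0 ≤ 1 - p / q := by linarith
  set K1 : ℕ := 3 ^ d * (2 * (C * R) + 1) ^ d with hK1
  set B : ℝ := (K1 : ℝ) * (16 * K * (1 - p / q) / c + (2 * d + 3) / L) with hB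
  have hLpos : (0 : ℝ) < L := by exact_mod_cast hL
  have hB0 : 0 ≤ B := by positivity
  have key : ∀ δ : ℝ, 0 < δ → tp x - δ ≤ (tq x + δ) * (1 + B) + δ := by
    intro δ hδ
    obtain ⟨n0, hn0⟩ := exists_nat_gt ((K1 : ℝ) * (2 * d + 3) / δ)
    obtain ⟨n, M, hn, hM, hle⟩ := core hd hp hpq hq1 htp htq hx hR hL hK hsp hc hc1 htwo hξ hδ (max n0 1)
    have hn1 : 1 ≤ n := (le_max_right _ _).trans hn
    have hnn : (n0 : ℝ) ≤ n := by exact_mod_cast (le_max_left _ _).trans hn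
    have hnpos : (0 : ℝ) < n := by exact_mod_cast hn1
    have hfl : (⌊8 * M * (1 - p / q) / c⌋₊ : ℝ) ≤ 8 * M * (1 - p / q) / c :=
      Nat.floor_le (by positivity)
    have hdv : ((M / L : ℕ) : ℝ) ≤ M / L := Nat.cast_div_le
    have h1 : ((M + K1 * (K * (2 * ⌊8 * M * (1 - p / q) / c⌋₊) + (2 * d + 3) * (M / L + 1)) : ℕ) : ℝ) ≤
        M * (1 + B) + K1 * (2 * d + 3) := by
      push_cast
      calc (M : ℝ) + K1 * (K * (2 * (⌊8 * M * (1 - p / q) / c⌋₊ : ℝ)) + (2 * d + 3) * (((M / L : ℕ) : ℝ) + 1))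
          ≤ M + K1 * (K * (2 * (8 * M * (1 - p / q) / c)) + (2 * d + 3) * ((M : ℝ) / L + 1)) := by gcongr
        _ = _ := by rw [hB]; ring
    have h2 : (K1 : ℝ) * (2 * d + 3) ≤ n * δ := by
      rw [div_lt_iff₀ hδ] at hn0
      nlinarith
    have h3 : (M : ℝ) * (1 + B) ≤ n * (tq x + δ) * (1 + B) := by gcongr
    have h4 : n * (tp x - δ) ≤ n * ((tq x + δ) * (1 + B) + δ) := by
      have := hle.trans h1
      linarith
    exact le_of_mul_le_mul_left h4 hnpos
  refine le_of_forall_pos_le_add fun e he => ?_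
  have := key (e / (3 + B)) (by positivity)
  have h5 : e / (3 + B) * (3 + B) = e := by field_simp
  linarith

lemma PB_coupling {p q : ℝ} (hp : 0 ≤ p) (hpq : p ≤ q) (hq : 0 < q) (hq1 : q ≤ 1) :
    PB d p = (CM d q (p / q)).map cfgN := by
  rw [CM_N hq.le hq1 (by positivity) ((div_le_one hq).2 hpq)]
  congr 1
  field_simp

lemma theta_mono {p q : ℝ} (hp : 0 ≤ p) (hpq : p ≤ q) (hq : 0 < q) (hq1 : q ≤ 1) :
    (PB d p).real {ω | InInfiniteCluster ω 0} ≤ (PB d q).real {ω | InInfiniteCluster ω 0} := by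
  rw [Measure.real, Measure.real, ENNReal.toReal_le_toReal (measure_ne_top _ _) (measure_ne_top _ _),
    PB_coupling hp hpq hq hq1, ← CM_A q (p / q), Measure.map_apply measurable_cfgN (measurable_infinite 0),
    Measure.map_apply measurable_cfgA (measurable_infinite 0)]
  exact measure_mono fun w hw => infinite_mono (cfgN_le w) hw

lemma distLe_mono {ω ω' : Config d} (h : ∀ e, ω e = true → ω' e = true) {x y : V d} {a : ℝ}
    (hx : distLe ω x y a) : distLe ω' x y a := by
  obtain ⟨n, f, hn, hf, h0, h1⟩ := hx
  refine ⟨n, f, hn, fun i hi => ?_, h0, h1⟩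
  obtain ⟨h2, h3⟩ := hf i hi
  exact ⟨h2, h _ h3⟩

lemma mu_mono {p q : ℝ} (hp : 0 < p) (hpq : p ≤ q) (hq1 : q ≤ 1) {tp tq : V d → ℝ}
    (htp : ASTimeConstant (PB d p) tp) (htq : ASTimeConstant (PB d q) tq) {x : V d} (hx : 0 < tp x)
    {c : ℝ} (hc : 0 < c)
    (htwo : ∀ n0, 1 ≤ n0 → ∃ n, n0 ≤ n ∧ c ≤ (PB d p).real {ω | InInfiniteCluster ω 0 ∧ InInfiniteCluster ω (n • x)}) :
    tq x ≤ tp x := by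
  have hq : 0 < q := hp.trans_le hpq
  by_contra hlt
  push Not at hlt
  set δ : ℝ := (tq x - tp x) / 2 with hδd
  have hδ : 0 < δ := by rw [hδd]; linarith
  have hpos : 0 < ENNReal.ofReal (c / 4) := ENNReal.ofReal_pos.2 (by positivity)
  have e1 := (upper_tendsto htp x hx hδ).eventually_lt_const hpos
  have e2 := (lower_tendsto htq x hδ).eventually_lt_const hpos
  obtain ⟨n1, hn1⟩ := eventually_atTop.1 (e1.and e2)
  obtain ⟨n, hn, hG⟩ := htwo (max n1 1) (le_max_right _ _)
  obtain ⟨g1, g2⟩ := hn1 n ((le_max_left _ _).trans hn)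
  have hG' : ENNReal.ofReal c ≤ PB d p {ω | InInfiniteCluster ω 0 ∧ InInfiniteCluster ω (n • x)} :=
    ENNReal.ofReal_le_of_le_toReal hG
  have hmp := measurable_cfgN (d := d)
  have m1 : MeasurableSet {ω : Config d | InInfiniteCluster ω 0 ∧ InInfiniteCluster ω (n • x)} :=
    (measurable_infinite _).inter (measurable_infinite _)
  rw [PB_coupling hp.le hpq hq hq1, Measure.map_apply measurable_cfgN m1] at hG'
  have g1' := (Measure.le_map_apply (μ := CM d q (p / q)) measurable_cfgN.aemeasurable
    {ω | InInfiniteCluster ω 0 ∧ InInfiniteCluster ω (n • x) ∧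
      ¬ distLe ω 0 (n • x) (n * (tp x + δ))})
  rw [← PB_coupling hp.le hpq hq hq1] at g1'
  have g2' := (Measure.le_map_apply (μ := CM d q (p / q)) measurable_cfgA.aemeasurable
    {ω | InInfiniteCluster ω 0 ∧ InInfiniteCluster ω (n • x) ∧
      distLe ω 0 (n • x) (n * (tq x - δ))})
  rw [CM_A] at g2'
  have hle : ENNReal.ofReal c ≤ ENNReal.ofReal (c / 4) + ENNReal.ofReal (c / 4) := by
    refine hG'.trans (le_trans (measure_mono ?_) ((measure_union_le _ _).trans
      (add_le_add (g1'.trans g1.le) (g2'.trans g2.le))))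
    rintro w ⟨h0, h1⟩
    by_cases hD : distLe (cfgN w) 0 (n • x) (n * (tp x + δ))
    · right
      refine ⟨infinite_mono (cfgN_le w) h0, infinite_mono (cfgN_le w) h1, ?_⟩
      have : tq x - δ = tp x + δ := by rw [hδd]; ring
      rw [this]
      exact distLe_mono (cfgN_le w) hD
    · left
      exact ⟨h0, h1, hD⟩
  rw [← ENNReal.ofReal_add (by positivity) (by positivity), ENNReal.ofReal_le_ofReal_iff (by positivity)] at hle
  linarith

lemma IsNorm.le_sum {f : EuclideanSpace ℝ (Fin d) → ℝ} (hf : IsNorm f) (z : EuclideanSpace ℝ (Fin d)) :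
    f z ≤ ∑ i, |z i| * f (EuclideanSpace.single i 1) := by
  obtain ⟨h0, hz, hm, ha⟩ := hf
  have hz' : z = ∑ i, z i • EuclideanSpace.single i (1 : ℝ) := by
    ext j
    simp [Finset.sum_apply, Pi.single_apply]
  have hs : ∀ s : Finset (Fin d), f (∑ i ∈ s, z i • EuclideanSpace.single i (1 : ℝ)) ≤
      ∑ i ∈ s, |z i| * f (EuclideanSpace.single i 1) := by
    classical
    intro s
    induction s using Finset.induction_on with
    | empty => simp [(hz 0).2 rfl]
    | insert a s has ih =>
      rw [Finset.sum_insert has, Finset.sum_insert has]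
      refine (ha _ _).trans (add_le_add (hm _ _).le ih)
  conv_lhs => rw [hz']
  exact hs _

lemma IsNorm.extend {f g : EuclideanSpace ℝ (Fin d) → ℝ} (hf : IsNorm f) (hg : IsNorm g) {T : ℝ} (hT : 0 ≤ T)
    (h : ∀ x : V d, f (toEuc x) ≤ T * g (toEuc x)) (x : EuclideanSpace ℝ (Fin d)) : f x ≤ T * g x := by
  set Sf := ∑ i, f (EuclideanSpace.single i (1 : ℝ))
  set Sg := ∑ i, g (EuclideanSpace.single i (1 : ℝ))
  have bd : ∀ {k : EuclideanSpace ℝ (Fin d) → ℝ}, IsNorm k → ∀ z : EuclideanSpace ℝ (Fin d),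
      (∀ i, |z i| ≤ 1) → k z ≤ ∑ i, k (EuclideanSpace.single i (1 : ℝ)) := by
    intro k hk z hz
    refine (hk.le_sum z).trans (Finset.sum_le_sum fun i _ => ?_)
    exact mul_le_of_le_one_left (hk.1 _) (hz i)
  have key : ∀ n : ℕ, n * (f x - T * g x) ≤ Sf + T * Sg := by
    intro n
    set y : V d := fun i => ⌊(n : ℝ) * x i⌋ with hy
    set z : EuclideanSpace ℝ (Fin d) := (n : ℝ) • x - toEuc y with hz
    have hzi : ∀ i, |z i| ≤ 1 := by
      intro i
      have : z i = Int.fract ((n : ℝ) * x i) := by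
        simp [hz, toEuc, hy]
      rw [this, Int.abs_fract]
      exact (Int.fract_lt_one _).le
    have hfz := bd hf z hzi
    have hgz := bd hg (-z) (fun i => by simpa using hzi i)
    have h1 : f ((n : ℝ) • x) ≤ f (toEuc y) + f z := by
      have := hf.2.2.2 (toEuc y) z
      rwa [hz, add_sub_cancel] at this
    have h2 : g (toEuc y) ≤ g ((n : ℝ) • x) + g (-z) := by
      have := hg.2.2.2 ((n : ℝ) • x) (-z)
      rwa [show (n : ℝ) • x + -z = toEuc y by rw [hz]; abel] at this
    rw [hf.2.2.1, abs_of_nonneg (by positivity)] at h1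
    rw [hg.2.2.1, abs_of_nonneg (by positivity)] at h2
    have h3 := h y
    have h4 : T * g (toEuc y) ≤ T * (n * g x + Sg) := by
      gcongr
      linarith
    linarith
  by_contra hlt
  push Not at hlt
  obtain ⟨n, hn⟩ := exists_nat_gt ((Sf + T * Sg) / (f x - T * g x))
  rw [div_lt_iff₀ (by linarith)] at hn
  linarith [key n]

lemma choose_KL {ε : ℝ} (d : ℕ) (h0 : 0 < ε) (h1 : ε ≤ 1 / 16) : ∃ K L : ℕ, 1 ≤ L ∧ (4 * L + 1) ^ d ≤ 2 ^ K ∧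
    1 / (L : ℝ) ≤ ε ∧ (K : ℝ) ≤ 5 * d * |Real.log ε| ∧ 1 ≤ |Real.log ε| := by
  have hl2 : 0.6931471803 < Real.log 2 := Real.log_two_gt_d9
  have hlog : Real.log ε ≤ -1 := by
    have : Real.log ε ≤ Real.log (1 / 16) := Real.log_le_log h0 h1
    rw [show (1 / 16 : ℝ) = (2 ^ 4)⁻¹ by norm_num, Real.log_inv, Real.log_pow] at this
    push_cast at this
    linarith
  have habs : |Real.log ε| = - Real.log ε := abs_of_nonpos (by linarith)
  set L : ℕ := ⌈1 / ε⌉₊ with hL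
  have hLge : 1 / ε ≤ L := Nat.le_ceil _
  have hLlt : (L : ℝ) < 1 / ε + 1 := Nat.ceil_lt_add_one (by positivity)
  have hLpos : 0 < L := Nat.ceil_pos.2 (by positivity)
  have hLpos' : (0 : ℝ) < L := by exact_mod_cast hLpos
  set k : ℕ := ⌈Real.log (4 * L + 1) / Real.log 2⌉₊ with hk
  have hlpos : 0 ≤ Real.log (4 * L + 1) := Real.log_nonneg (by linarith)
  have hkge : Real.log (4 * L + 1) / Real.log 2 ≤ k := Nat.le_ceil _
  have hklt : (k : ℝ) < Real.log (4 * L + 1) / Real.log 2 + 1 := Nat.ceil_lt_add_one (by positivity)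
  have hb : Real.log (4 * L + 1) ≤ 2 * (- Real.log ε) := by
    have : (4 * L + 1 : ℝ) ≤ (ε ^ 2)⁻¹ := by
      have h5 : (4 * L + 1 : ℝ) ≤ 4 * (1 / ε) + 5 := by linarith
      refine h5.trans ?_
      rw [le_inv_comm₀ (by positivity) (by positivity)]
      rw [show 4 * (1 / ε) + 5 = (4 + 5 * ε) / ε by field_simp, inv_div, le_div_iff₀ (by positivity)]
      nlinarith
    have := Real.log_le_log (by positivity) this
    rw [Real.log_inv, Real.log_pow] at this
    push_cast at this
    linarith
  refine ⟨k * d, L, hLpos, ?_, ?_, ?_, by rw [habs]; linarith⟩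
  · rw [pow_mul]
    refine Nat.pow_le_pow_left ?_ _
    rw [div_le_iff₀ (by linarith), ← Real.log_pow] at hkge
    have := (Real.log_le_log_iff (by positivity) (by positivity)).1 hkge
    exact_mod_cast this
  · rw [div_le_iff₀ hLpos']
    rw [div_le_iff₀ h0] at hLge
    linarith
  · have : (k : ℝ) ≤ 5 * (- Real.log ε) := by
      have h6 : Real.log (4 * L + 1) / Real.log 2 ≤ 4 * (- Real.log ε) := by
        rw [div_le_iff₀ (by linarith)]
        nlinarith
      linarith
    rw [habs]
    push_cast
    calc (k : ℝ) * d ≤ 5 * (- Real.log ε) * d := by gcongr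
      _ = _ := by ring

end Part17

section Part18

variable {d : ℕ}

lemma toEuc_ne_zero {x : V d} (hx : x ≠ 0) : toEuc x ≠ 0 := by
  intro h
  apply hx
  funext i
  have := congrArg (fun z : EuclideanSpace ℝ (Fin d) => z i) h
  simpa [toEuc] using this

lemma pc_nonneg (F : BernoulliFamily d) : 0 ≤ pc F := Real.sInf_nonneg fun _ h => h.1

/-- The comparison on lattice points, with all constants uniform over `[p₀, 1]`. -/
lemma lattice_bound (hd : 2 ≤ d) {p1 p0 : ℝ} (hp1 : 0 ≤ p1) (hp10 : p1 < p0) (μ : ℝ → EuclideanSpace ℝ (Fin d) → ℝ)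
    (hn : ∀ p, p1 ≤ p → p ≤ 1 → IsNorm (μ p)) (hp01 : p0 ≤ 1)
    (ht : ∀ p, p1 ≤ p → p ≤ 1 → ASTimeConstant (PB d p) (fun x : V d => μ p (toEuc x))) :
    ∃ A ε0 : ℝ, 0 ≤ A ∧ 0 < ε0 ∧ ∀ p q, p0 ≤ p → p < q → q ≤ 1 →
      (∀ x : V d, μ q (toEuc x) ≤ 1 * μ p (toEuc x)) ∧
      (q - p ≤ ε0 → ∀ x : V d, μ p (toEuc x) ≤ (1 + A * ((q - p) * |Real.log (q - p)|)) * μ q (toEuc x)) := by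
  have hpos : ∀ p, p1 ≤ p → p ≤ 1 → ∀ x : V d, x ≠ 0 → 0 < μ p (toEuc x) := by
    intro p h h' x hx
    refine lt_of_le_of_ne ((hn p h h').1 _) fun h0 => toEuc_ne_zero hx (((hn p h h').2.1 _).1 h0.symm)
  have hp0 : 0 < p0 := hp1.trans_lt hp10
  have hp11 : p1 ≤ 1 := hp10.le.trans hp01
  have hθ0 := theta_pos hd (ht p1 le_rfl hp11) (hpos p1 le_rfl hp11)
  set θ : ℝ := (PB d p1).real {ω | InInfiniteCluster ω 0} with hθd
  have hθ : 0 < θ := ENNReal.toReal_pos hθ0.ne' (measure_ne_top _ _)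
  obtain ⟨m, hm⟩ := exists_nat_ge (max 1 (2 / θ))
  have hm1 : (1 : ℝ) ≤ m := (le_max_left _ _).trans hm
  have hm2 : 2 ≤ m * θ := by
    have := (le_max_right _ _).trans hm
    rwa [div_le_iff₀ hθ] at this
  set c : ℝ := 1 / (m : ℝ) ^ 2 with hcd
  have hc : 0 < c := by positivity
  have hc1 : c ≤ 1 := by
    rw [hcd, div_le_one (by positivity)]
    exact one_le_pow₀ hm1
  obtain ⟨C, hC, hRG⟩ := rgood_prob hd (ht p1 le_rfl hp11) (hpos p1 le_rfl hp11) hp1 hp10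
  set ξr : ℝ := c / 8 / (2 * 27 ^ d) with hξr
  have hξr0 : 0 < ξr := by positivity
  set ξ : ℝ≥0∞ := ENNReal.ofReal ξr with hξ
  have h27 : (1 : ℝ) ≤ 27 ^ d := one_le_pow₀ (by norm_num)
  have hξ1 : ξ ≤ 1 := by
    rw [hξ, ENNReal.ofReal_le_one, hξr, div_le_one (by positivity)]
    linarith
  have hξ2 : 2 * (27 ^ d * ξ) ≤ ENNReal.ofReal (c / 8) := by
    rw [hξ, show (2 : ℝ≥0∞) = ENNReal.ofReal 2 by simp, show (27 : ℝ≥0∞) = ENNReal.ofReal 27 by simp,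
      ← ENNReal.ofReal_pow (by norm_num), ← ENNReal.ofReal_mul (by positivity), ← ENNReal.ofReal_mul (by positivity)]
    refine ENNReal.ofReal_le_ofReal (le_of_eq ?_)
    rw [hξr]
    field_simp
  set ηr : ℝ := ξr ^ ((2 * C + 1) ^ d) / 2 with hηr
  have hηr0 : 0 < ηr := by positivity
  obtain ⟨R, hR, hRG⟩ := hRG (ENNReal.ofReal ηr) (ENNReal.ofReal_pos.2 hηr0)
  set Q : ℕ := Nat.choose ((2 * (3 * R) + 1) ^ d + 1) 2 with hQ
  set ε0 : ℝ := min (1 / 16) (ηr * p0 / (Q + 1)) with hε0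
  set K1 : ℕ := 3 ^ d * (2 * (C * R) + 1) ^ d with hK1
  refine ⟨K1 * (80 * d / (p0 * c) + (2 * d + 3)), ε0, by positivity, by positivity, ?_⟩
  intro p q hp hpq hq1
  have hp' : 0 < p := hp0.trans_le hp
  have hq' : 0 < q := hp'.trans hpq
  have hpp1 : p1 ≤ p := hp10.le.trans hp
  have hqp1 : p1 ≤ q := hpp1.trans hpq.le
  have hp1' : p ≤ 1 := hpq.le.trans hq1
  have htwo : ∀ x : V d, ∀ n0, 1 ≤ n0 → ∃ n, n0 ≤ n ∧
      c ≤ (PB d p).real {ω | InInfiniteCluster ω 0 ∧ InInfiniteCluster ω (n • x)} :=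
    fun x n0 hn0 => two_point p θ hθ (theta_mono hp1 hpp1 hp' hp1') x m hm2 n0 hn0
  have hz : ∀ r, p1 ≤ r → r ≤ 1 → μ r (toEuc (0 : V d)) = 0 := fun r h h' => by
    rw [(hn r h h').2.1]
    ext i
    simp [toEuc]
  constructor
  · intro x
    rw [one_mul]
    by_cases hx : x = 0
    · rw [hx, hz q hqp1 hq1, hz p hpp1 hp1']
    exact mu_mono hp' hpq.le hq1 (ht p hpp1 hp1') (ht q hqp1 hq1) (hpos p hpp1 hp1' x hx) hc (htwo x)
  · intro hε x
    by_cases hx : x = 0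
    · rw [hx, hz q hqp1 hq1, hz p hpp1 hp1', mul_zero]
    set ε : ℝ := q - p with hεd
    have hεpos : 0 < ε := by rw [hεd]; linarith
    have hs : 1 - p / q ≤ ε / p0 := by
      rw [hεd, show 1 - p / q = (q - p) / q by field_simp]
      exact div_le_div_of_nonneg_left hεpos.le hp0 (hp.trans hpq.le)
    have hs1 : p / q ≤ 1 := (div_le_one hq').2 hpq.le
    obtain ⟨K, L, hL, hKL, hLε, hKε, hlog⟩ := choose_KL d hεpos (hε.trans (min_le_left _ _))
    have hsp : Sparse (CM d q (p / q)) (nbad (d := d) R C) ξ := by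
      refine nbad_sparse hR hC hξ1 fun J => ?_
      refine (nbad_prob hq'.le hq1 (by positivity) hs1 hR hC J).trans ?_
      rw [show q * (p / q) = p by field_simp]
      have h2 : ((Q : ℕ) : ℝ≥0∞) * ENNReal.ofReal (1 - p / q) ≤ ENNReal.ofReal ηr := by
        rw [← ENNReal.ofReal_natCast, ← ENNReal.ofReal_mul (by positivity)]
        refine ENNReal.ofReal_le_ofReal ?_
        have h3 : ε ≤ ηr * p0 / (Q + 1) := hε.trans (min_le_right _ _)
        rw [le_div_iff₀ (by positivity)] at h3
        calc (Q : ℝ) * (1 - p / q) ≤ Q * (ε / p0) := by gcongr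
          _ = Q * ε / p0 := by ring
          _ ≤ ηr := by
            rw [div_le_iff₀ hp0]
            nlinarith
      refine (add_le_add (hRG p hp (hpq.trans_le hq1) J) h2).trans (le_of_eq ?_)
      rw [← ENNReal.ofReal_add hηr0.le hηr0.le, hξ, ← ENNReal.ofReal_pow hξr0.le, hηr]
      congr 1
      ring
    have hfin := core_lim hd hp' hpq.le hq1 (ht p hpp1 hp1') (ht q hqp1 hq1) (x := x)
      (hpos q hqp1 hq1 x hx) hR hL hKL hsp hc hc1 (htwo x) hξ2
    refine hfin.trans ?_
    rw [mul_comm]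
    refine mul_le_mul_of_nonneg_right ?_ ((hn q hqp1 hq1).1 _)
    rw [← hK1]
    have hs0 : 0 ≤ 1 - p / q := by linarith
    have hA : 16 * K * (1 - p / q) / c ≤ 80 * d / (p0 * c) * (ε * |Real.log ε|) := by
      calc 16 * K * (1 - p / q) / c ≤ 16 * (5 * d * |Real.log ε|) * (ε / p0) / c := by gcongr
        _ = _ := by field_simp; ring
    have hB : (2 * d + 3 : ℝ) / L ≤ (2 * d + 3) * (ε * |Real.log ε|) := by
      rw [div_eq_mul_one_div]
      gcongr
      exact hLε.trans (le_mul_of_one_le_right hεpos.le hlog)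
    have : (K1 : ℝ) * (16 * K * (1 - p / q) / c + (2 * d + 3) / L) ≤
        K1 * (80 * d / (p0 * c) + (2 * d + 3)) * (ε * |Real.log ε|) := by
      calc _ ≤ (K1 : ℝ) * (80 * d / (p0 * c) * (ε * |Real.log ε|) + (2 * d + 3) * (ε * |Real.log ε|)) := by gcongr
        _ = _ := by ring
    linarith

lemma main_bound (hd : 2 ≤ d) (F : BernoulliFamily d) (p₀ : ℝ) (hp₀ : pc F < p₀) (hp₀1 : p₀ ≤ 1)
    (μ : ℝ → EuclideanSpace ℝ (Fin d) → ℝ) (hnorm : ∀ p, pc F < p → p ≤ 1 → IsNorm (μ p))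
    (hconv : ∀ p, pc F < p → p ≤ 1 → ASTimeConstant (F.P p) (fun x : V d => μ p (toEuc x))) :
    ∃ κ : ℝ, 0 < κ ∧ ∀ p q : ℝ, p₀ ≤ p → p ≤ q → q ≤ 1 → ∀ x : EuclideanSpace ℝ (Fin d), ‖x‖ = 1 →
      |μ p x - μ q x| ≤ κ * (q - p) * |Real.log (q - p)| := by
  rcases hp₀1.eq_or_lt with h1 | hlt1
  · refine ⟨1, one_pos, fun p q hp hpq hq x _ => ?_⟩
    have : p = q := by linarith
    subst this
    simp
  have hpc := pc_nonneg F
  obtain ⟨p1, hp1, hp10⟩ := exists_between hp₀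
  have hp1n : 0 ≤ p1 := hpc.trans hp1.le
  have hn : ∀ p, p1 ≤ p → p ≤ 1 → IsNorm (μ p) := fun p h h' => hnorm p (hp1.trans_le h) h'
  have ht : ∀ p, p1 ≤ p → p ≤ 1 → ASTimeConstant (PB d p) (fun x : V d => μ p (toEuc x)) := by
    intro p h h'
    have := hconv p (hp1.trans_le h) h'
    rwa [P_eq_BP F (hp1n.trans h) h'] at this
  obtain ⟨A, ε0, hA, hε0, hmain⟩ := lattice_bound hd hp1n hp10 μ hn hp₀1 ht
  have hp0n : 0 < p₀ := hp1n.trans_lt hp10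
  have hN0 : IsNorm (μ p₀) := hn p₀ hp10.le hp₀1
  set S : ℝ := ∑ i, μ p₀ (EuclideanSpace.single i 1) with hS
  have hS0 : 0 ≤ S := Finset.sum_nonneg fun i _ => hN0.1 _
  have hmono : ∀ p q, p₀ ≤ p → p ≤ q → q ≤ 1 → ∀ x, μ q x ≤ μ p x := by
    intro p q hp hpq hq x
    rcases hpq.eq_or_lt with rfl | hlt
    · exact le_rfl
    have := IsNorm.extend (hn q (hp10.le.trans (hp.trans hpq)) hq) (hn p (hp10.le.trans hp) (hpq.trans hq))
      zero_le_one (hmain p q hp hlt hq).1 x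
    rwa [one_mul] at this
  have hbS : ∀ p, p₀ ≤ p → p ≤ 1 → ∀ x : EuclideanSpace ℝ (Fin d), ‖x‖ = 1 → μ p x ≤ S := by
    intro p hp hp1' x hx
    refine (hmono p₀ p le_rfl hp hp1' x).trans ((hN0.le_sum x).trans (Finset.sum_le_sum fun i _ => ?_))
    refine mul_le_of_le_one_left (hN0.1 _) ?_
    have := EuclideanSpace.norm_eq x
    have h := PiLp.norm_apply_le x i
    rw [hx] at h
    exact h
  set ℓ0 : ℝ := -Real.log (1 - p₀) with hℓ0
  have hℓpos : 0 < ℓ0 := by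
    have := Real.log_neg (show 0 < 1 - p₀ by linarith) (by linarith)
    linarith
  refine ⟨A * S + S / (ε0 * ℓ0) + 1, by positivity, fun p q hp hpq hq x hx => ?_⟩
  rcases hpq.eq_or_lt with rfl | hlt
  · simp
  have hmn := hmono p q hp hpq hq x
  have hNp := hn p (hp10.le.trans hp) (hpq.trans hq)
  have hNq := hn q (hp10.le.trans (hp.trans hpq)) hq
  rw [abs_of_nonneg (by linarith)]
  set ε : ℝ := q - p with hε
  have hεpos : 0 < ε := by rw [hε]; linarith
  set ℓ : ℝ := |Real.log ε| with hℓ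
  have hℓn : 0 ≤ ℓ := abs_nonneg _
  have hx0 : 0 ≤ ε * ℓ := by positivity
  have hq0 := hbS q (hp.trans hpq) hq x hx
  have hp0 := hbS p hp (hpq.trans hq) x hx
  have hqn := hNq.1 x
  have hdv : 0 ≤ S / (ε0 * ℓ0) := by positivity
  rw [mul_assoc]
  by_cases hc : ε ≤ ε0
  · have h2 := IsNorm.extend hNp hNq (by positivity) ((hmain p q hp hlt hq).2 hc) x
    have h3 : A * (ε * ℓ) * μ q x ≤ A * (ε * ℓ) * S := by gcongr
    calc μ p x - μ q x ≤ A * S * (ε * ℓ) := by linarith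
      _ ≤ _ := by gcongr; linarith
  · push Not at hc
    have h4 : ℓ0 ≤ ℓ := by
      have : Real.log ε ≤ Real.log (1 - p₀) := Real.log_le_log hεpos (by rw [hε]; linarith)
      have h5 := neg_le_abs (Real.log ε)
      rw [hℓ0]
      linarith
    calc μ p x - μ q x ≤ S := by linarith
      _ = S / (ε0 * ℓ0) * (ε0 * ℓ0) := by field_simp
      _ ≤ S / (ε0 * ℓ0) * (ε * ℓ) := by gcongr
      _ ≤ _ := by
        gcongr
        have : 0 ≤ A * S := by positivity
        linarith

end Part18

/-- **Regularity of the time constant.**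
Let `d ≥ 2` and `p₀ > p_c(d)`. There is a constant `κ_d > 0`, depending only on `d` and
`p₀`, such that for all `p ≤ q` in `[p₀, 1]`,
`sup_{x ∈ S^{d-1}} |μ_p(x) - μ_q(x)| ≤ κ_d (q-p)|log (q-p)|`. -/
theorem statement_0 (d : ℕ) (hd : 2 ≤ d) (F : BernoulliFamily d)
    (p₀ : ℝ) (hp₀ : pc F < p₀) (hp₀1 : p₀ ≤ 1)
    (μ : ℝ → EuclideanSpace ℝ (Fin d) → ℝ)
    (hnorm : ∀ p, pc F < p → p ≤ 1 → IsNorm (μ p))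
    (hconv : ∀ p, pc F < p → p ≤ 1 →
      ASTimeConstant (F.P p) (fun x : V d => μ p (toEuc x))) :
    ∃ κ : ℝ, 0 < κ ∧ ∀ p q : ℝ, p₀ ≤ p → p ≤ q → q ≤ 1 →
      ∀ x : EuclideanSpace ℝ (Fin d), ‖x‖ = 1 →
        |μ p x - μ q x| ≤ κ * (q - p) * |Real.log (q - p)| := by
  exact main_bound hd F p₀ hp₀ hp₀1 μ hnorm hconv

end Perco
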